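/- arXiv:math/0507030 — 2 statements merged into one kernel-verified Lean document; each statement's English description precedes it below -/
import Mathlib

section
/- (Korshunov's theorem, equation (2.3) of the paper.) Let M(n) denote the set of all monotone Boolean functions of n variables, and let M_0(n) \subseteq M(n) be defined as follows. For even n, M_0(n) consists of those f \in M(n) such that every minimal one of f lies in E^{n,n/2-1}, E^{n,n/2}, or E^{n,n/2+1}, and f(x) = 1 for every x with at least n/2+2 ones. For odd n, M_0(n) consists of those f \in M(n) such that either (a) every minimal one of f lies in E^{n,(n-3)/2}, E^{n,(n-1)/2}, or E^{n,(n+1)/2} and f(x) = 1 for every x with at least (n+3)/2 ones, or (b) every minimal one of f lies in E^{n,(n-1)/2}, E^{n,(n+1)/2}, or E^{n,(n+3)/2} and f(x) = 1 for every x with at least (n+5)/2 ones. Then |M_0(n)| / |M(n)| \to 1 as n \to \infty. -/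
open Finset

/-- `x` with its `j`-th coordinate set to `b`. -/
def setCoord {n : ℕ} (x : Fin n → Bool) (j : Fin n) (b : Bool) : Fin n → Bool :=
  Function.update x j b

/-- `x` with its `j`-th coordinate flipped (`x ⊕ e_j`). -/
def flipCoord {n : ℕ} (x : Fin n → Bool) (j : Fin n) : Fin n → Bool :=
  Function.update x j (!x j)

/-- Number of ones of a Boolean vector. -/
def weight {n : ℕ} (x : Fin n → Bool) : ℕ :=
  (Finset.univ.filter fun i => x i = true).card

/-- The activity `α_j^f = 2^{-n} ∑_x (f(x^{(j,0)}) ⊕ f(x^{(j,1)}))`. -/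
noncomputable def activity {n : ℕ} (f : (Fin n → Bool) → Bool) (j : Fin n) : ℝ :=
  (2 ^ n : ℝ)⁻¹ * ∑ x : Fin n → Bool,
    (if f (setCoord x j false) ≠ f (setCoord x j true) then (1 : ℝ) else 0)

/-- The sensitivity `s^f(x)` of `f` at `x`. -/
def sensAt {n : ℕ} (f : (Fin n → Bool) → Bool) (x : Fin n → Bool) : ℕ :=
  (Finset.univ.filter fun i => f (flipCoord x i) ≠ f x).card

/-- The average sensitivity `s^f`. -/
noncomputable def avgSens {n : ℕ} (f : (Fin n → Bool) → Bool) : ℝ :=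
  (2 ^ n : ℝ)⁻¹ * ∑ x : Fin n → Bool, (sensAt f x : ℝ)

/-- `x` is a minimal one of the (monotone) function `f`. -/
def MinimalOne {n : ℕ} (f : (Fin n → Bool) → Bool) (x : Fin n → Bool) : Prop :=
  f x = true ∧ ∀ y, y < x → f y = false

/-- `x` is a maximal zero of the (monotone) function `f`. -/
def MaximalZero {n : ℕ} (f : (Fin n → Bool) → Bool) (x : Fin n → Bool) : Prop :=
  f x = false ∧ ∀ y, x < y → f y = true

open Classical in
/-- The set `M(n)` of all monotone Boolean functions of `n` variables. -/
noncomputable def monotoneFuns (n : ℕ) : Finset ((Fin n → Bool) → Bool) :=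
  Finset.univ.filter fun f => Monotone f

/-- The defining condition of `M_0(n)` for even `n`. -/
def evenCond (n : ℕ) (f : (Fin n → Bool) → Bool) : Prop :=
  (∀ x, MinimalOne f x →
    weight x = n / 2 - 1 ∨ weight x = n / 2 ∨ weight x = n / 2 + 1) ∧
  (∀ x, n / 2 + 2 ≤ weight x → f x = true)

/-- The first alternative of the defining condition of `M_0(n)` for odd `n`. -/
def oddCondA (n : ℕ) (f : (Fin n → Bool) → Bool) : Prop :=
  (∀ x, MinimalOne f x →
    weight x = (n - 3) / 2 ∨ weight x = (n - 1) / 2 ∨ weight x = (n + 1) / 2) ∧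
  (∀ x, (n + 3) / 2 ≤ weight x → f x = true)

/-- The second alternative of the defining condition of `M_0(n)` for odd `n`. -/
def oddCondB (n : ℕ) (f : (Fin n → Bool) → Bool) : Prop :=
  (∀ x, MinimalOne f x →
    weight x = (n - 1) / 2 ∨ weight x = (n + 1) / 2 ∨ weight x = (n + 3) / 2) ∧
  (∀ x, (n + 5) / 2 ≤ weight x → f x = true)

open Classical in
/-- Korshunov's set `M_0(n)` of monotone Boolean functions. -/
noncomputable def M0 (n : ℕ) : Finset ((Fin n → Bool) → Bool) :=
  (monotoneFuns n).filter fun f =>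
    (Even n ∧ evenCond n f) ∨ (Odd n ∧ (oddCondA n f ∨ oddCondB n f))

namespace Dedekind

variable {n : ℕ}

/-- The sets obtained from `x` by deleting one element. -/
def dn (x : Finset (Fin n)) : Finset (Finset (Fin n)) := x.image x.erase

/-- The sets obtained from `y` by adding one element. -/
def up (y : Finset (Fin n)) : Finset (Finset (Fin n)) := yᶜ.image fun i => insert i y

/-- The shadow of a family. -/
def sh (A : Finset (Finset (Fin n))) : Finset (Finset (Fin n)) := A.biUnion dn

/-- The `K`-th layer. -/
def lay (n K : ℕ) : Finset (Finset (Fin n)) := powersetCard K univ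

/-- The largest subfamily of layer `K` whose shadow lies in the shadow of `A`. -/
def cl (K : ℕ) (A : Finset (Finset (Fin n))) : Finset (Finset (Fin n)) :=
  (lay n K).filter fun x => dn x ⊆ sh A

lemma mem_lay {K : ℕ} {x : Finset (Fin n)} : x ∈ lay n K ↔ x.card = K := by
  simp [lay, mem_powersetCard]

lemma mem_dn {x y : Finset (Fin n)} : y ∈ dn x ↔ ∃ i ∈ x, x.erase i = y := by
  simp [dn]

lemma mem_up {x y : Finset (Fin n)} : x ∈ up y ↔ ∃ i ∉ y, insert i y = x := by
  simp [up]

lemma mem_up_iff {x y : Finset (Fin n)} : x ∈ up y ↔ y ∈ dn x := by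
  rw [mem_dn, mem_up]
  constructor
  · rintro ⟨i, hi, rfl⟩
    exact ⟨i, mem_insert_self _ _, erase_insert hi⟩
  · rintro ⟨i, hi, rfl⟩
    exact ⟨i, notMem_erase _ _, insert_erase hi⟩

lemma card_dn (x : Finset (Fin n)) : (dn x).card = x.card :=
  card_image_of_injOn fun _ hi _ _ h => (erase_inj x hi).1 h

lemma card_up (y : Finset (Fin n)) : (up y).card = n - y.card := by
  rw [up, card_image_of_injOn, card_compl, Fintype.card_fin]
  intro i hi j hj h
  have hi' : i ∉ y := by simpa using hi
  have : i ∈ insert j y := by rw [← show insert i y = insert j y from h]; exact mem_insert_self _ _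
  rcases mem_insert.1 this with h | h
  · exact h
  · exact absurd h hi'

lemma card_of_mem_dn {x y : Finset (Fin n)} (h : y ∈ dn x) : y.card + 1 = x.card := by
  obtain ⟨i, hi, rfl⟩ := mem_dn.1 h
  exact card_erase_add_one hi

lemma subset_of_mem_dn {x y : Finset (Fin n)} (h : y ∈ dn x) : y ⊆ x := by
  obtain ⟨i, hi, rfl⟩ := mem_dn.1 h
  exact erase_subset _ _

lemma mem_sh {A : Finset (Finset (Fin n))} {y : Finset (Fin n)} :
    y ∈ sh A ↔ ∃ x ∈ A, y ∈ dn x := by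
  simp [sh]

lemma sh_eq_shadow (A : Finset (Finset (Fin n))) : sh A = A.shadow := by
  ext y
  simp [mem_sh, mem_dn, mem_shadow_iff]

lemma sh_mono {A B : Finset (Finset (Fin n))} (h : A ⊆ B) : sh A ⊆ sh B :=
  biUnion_subset_biUnion_of_subset_left _ h

lemma dn_subset_sh {A : Finset (Finset (Fin n))} {x : Finset (Fin n)} (h : x ∈ A) :
    dn x ⊆ sh A := fun _ hy => mem_sh.2 ⟨x, h, hy⟩

lemma sh_union (A B : Finset (Finset (Fin n))) : sh (A ∪ B) = sh A ∪ sh B := by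
  ext y; simp only [mem_sh, mem_union, or_and_right, exists_or]

lemma mem_cl {K : ℕ} {A : Finset (Finset (Fin n))} {x : Finset (Fin n)} :
    x ∈ cl K A ↔ x.card = K ∧ dn x ⊆ sh A := by
  simp [cl, mem_lay]

lemma subset_cl {K : ℕ} {A : Finset (Finset (Fin n))} (hA : A ⊆ lay n K) : A ⊆ cl K A :=
  fun _ hx => mem_cl.2 ⟨mem_lay.1 (hA hx), dn_subset_sh hx⟩

lemma cl_mono {K : ℕ} {A B : Finset (Finset (Fin n))} (h : A ⊆ B) : cl K A ⊆ cl K B :=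
  fun _ hx => mem_cl.2 ⟨(mem_cl.1 hx).1, (mem_cl.1 hx).2.trans (sh_mono h)⟩

lemma cl_subset_lay {K : ℕ} {A : Finset (Finset (Fin n))} : cl K A ⊆ lay n K :=
  filter_subset _ _

lemma sh_cl {K : ℕ} {A : Finset (Finset (Fin n))} (hA : A ⊆ lay n K) : sh (cl K A) = sh A := by
  refine Subset.antisymm ?_ (sh_mono (subset_cl hA))
  intro y hy
  obtain ⟨x, hx, hyx⟩ := mem_sh.1 hy
  exact (mem_cl.1 hx).2 hyx

lemma sh_subset_lay {K : ℕ} {A : Finset (Finset (Fin n))} (hA : A ⊆ lay n (K + 1)) :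
    sh A ⊆ lay n K := by
  intro y hy
  obtain ⟨x, hx, hyx⟩ := mem_sh.1 hy
  have := card_of_mem_dn hyx
  have h2 := mem_lay.1 (hA hx)
  exact mem_lay.2 (by omega)

/-- Double counting of incidences between two families. -/
lemma sum_dn_inter (A B : Finset (Finset (Fin n))) :
    ∑ x ∈ A, (dn x ∩ B).card = ∑ y ∈ B, (up y ∩ A).card := by
  have := sum_card_bipartiteAbove_eq_sum_card_bipartiteBelow
    (s := A) (t := B) (fun x y => y ∈ dn x)
  convert this using 3
  · ext y; simp [bipartiteAbove, and_comm]
  · ext x; simp [bipartiteBelow, and_comm, mem_up_iff]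

/-- Two distinct sets have at most one common upper neighbour. -/
lemma up_inter_unique {y z x x' : Finset (Fin n)} (hyz : y ≠ z) (h1 : y ∈ dn x) (h2 : z ∈ dn x)
    (h3 : y ∈ dn x') (h4 : z ∈ dn x') : x = x' := by
  have key : ∀ w : Finset (Fin n), y ∈ dn w → z ∈ dn w → w = y ∪ z := by
    intro w hy hz
    have hyc := card_of_mem_dn hy
    have hzc := card_of_mem_dn hz
    symm
    apply eq_of_subset_of_card_le (union_subset (subset_of_mem_dn hy) (subset_of_mem_dn hz))
    have : y.card < (y ∪ z).card := by
      apply card_lt_card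
      refine ⟨subset_union_left, fun h => hyz ?_⟩
      exact (eq_of_subset_of_card_le (fun i hi => h (mem_union_right _ hi)) (by omega)).symm
    omega
  rw [key x h1 h2, key x' h3 h4]

/-- The local LYM inequality. -/
lemma local_lym {K : ℕ} {A : Finset (Finset (Fin n))} (hA : A ⊆ lay n K) :
    A.card * K ≤ (sh A).card * (n - K + 1) := by
  have := card_mul_le_card_shadow_mul (𝒜 := A) (r := K)
    (fun x hx => mem_lay.1 (hA hx))
  rw [sh_eq_shadow]
  simpa using this

section Linked

variable {β : Type*} [DecidableEq β]

/-- A finite set is linked if it cannot be split into two parts with no relation across. -/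
def Linked (r : β → β → Prop) (T : Finset β) : Prop :=
  ∀ P ⊆ T, P.Nonempty → P ≠ T → ∃ p ∈ P, ∃ q ∈ T \ P, r p q

lemma Linked.mono {r s : β → β → Prop} (h : ∀ x y, r x y → s x y) {T : Finset β}
    (hT : Linked r T) : Linked s T := by
  intro P hP hne hPT
  obtain ⟨p, hp, q, hq, hr⟩ := hT P hP hne hPT
  exact ⟨p, hp, q, hq, h _ _ hr⟩

lemma linked_singleton (r : β → β → Prop) (v : β) : Linked r {v} := by
  intro P hP hne hPT
  rcases subset_singleton_iff.1 hP with h | h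
  · simp [h] at hne
  · exact absurd h hPT

lemma Linked.insert {r : β → β → Prop} (hsymm : ∀ x y, r x y → r y x) {T : Finset β}
    (hT : Linked r T) {c z : β} (hc : c ∈ T) (hcz : r c z) : Linked r (insert z T) := by
  by_cases hzT : z ∈ T
  · rwa [insert_eq_of_mem hzT]
  intro P hP hne hPT
  by_cases h1 : (P ∩ T).Nonempty
  · by_cases h2 : P ∩ T = T
    · have hzP : z ∉ P := fun hz => hPT
        (Subset.antisymm hP (insert_subset hz (inter_eq_right.1 h2)))
      exact ⟨c, inter_eq_right.1 h2 hc, z, mem_sdiff.2 ⟨mem_insert_self _ _, hzP⟩, hcz⟩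
    · obtain ⟨p, hp, q, hq, hr⟩ := hT (P ∩ T) inter_subset_right h1 h2
      rw [mem_sdiff, mem_inter, not_and] at hq
      exact ⟨p, (mem_inter.1 hp).1, q,
        mem_sdiff.2 ⟨mem_insert_of_mem hq.1, fun h => hq.2 h hq.1⟩, hr⟩
  · have hP' : ∀ p ∈ P, p = z := fun p hp => by
      rcases mem_insert.1 (hP hp) with h | h
      · exact h
      · exact absurd ⟨p, mem_inter.2 ⟨hp, h⟩⟩ h1
    obtain ⟨p, hp⟩ := hne
    refine ⟨p, hp, c, mem_sdiff.2 ⟨mem_insert_of_mem hc, fun h => hzT ?_⟩, ?_⟩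
    · rw [← hP' c h]; exact hc
    · rw [hP' p hp]; exact hsymm _ _ hcz

/-- Every element of a finite set lies in a linked subset related to nothing outside it. -/
lemma exists_component {r : β → β → Prop} (hsymm : ∀ x y, r x y → r y x) {Z : Finset β} {v : β}
    (hv : v ∈ Z) :
    ∃ C ⊆ Z, v ∈ C ∧ Linked r C ∧ ∀ c ∈ C, ∀ z ∈ Z \ C, ¬ r c z := by
  classical
  obtain ⟨C, hC, hmax⟩ := exists_max_image (Z.powerset.filter fun C => v ∈ C ∧ Linked r C) card
    ⟨{v}, by simp [hv, linked_singleton]⟩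
  simp only [mem_filter, mem_powerset] at hC hmax
  refine ⟨C, hC.1, hC.2.1, hC.2.2, fun c hc z hz hr => ?_⟩
  rw [mem_sdiff] at hz
  have := hmax (insert z C) ⟨insert_subset hz.1 hC.1, mem_insert_of_mem hC.2.1,
    hC.2.2.insert hsymm hc hr⟩
  rw [card_insert_of_notMem hz.2] at this
  omega

/-- The vertex sets of walks with `k` steps from `v`. -/
def walks (nb : β → Finset β) : ℕ → β → Finset (Finset β)
  | 0, v => {{v}}
  | k + 1, v => (nb v).biUnion fun u => (walks nb k u).image (insert v)

lemma card_walks_le (nb : β → Finset β) {D : ℕ} (hD : ∀ v, (nb v).card ≤ D) (k : ℕ) (v : β) :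
    (walks nb k v).card ≤ D ^ k := by
  induction k generalizing v with
  | zero => simp [walks]
  | succ k ih =>
    rw [walks]
    calc _ ≤ ∑ u ∈ nb v, ((walks nb k u).image (insert v)).card := card_biUnion_le
      _ ≤ ∑ u ∈ nb v, D ^ k := sum_le_sum fun u _ => card_image_le.trans (ih u)
      _ = (nb v).card * D ^ k := by simp
      _ ≤ D * D ^ k := Nat.mul_le_mul_right _ (hD v)
      _ = D ^ (k + 1) := by ring

lemma mem_of_mem_walks {nb : β → Finset β} {k : ℕ} {v : β} {T : Finset β}
    (h : T ∈ walks nb k v) : v ∈ T := by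
  cases k with
  | zero => simp [walks] at h; simp [h]
  | succ k =>
    simp only [walks, mem_biUnion, mem_image] at h
    obtain ⟨u, _, T', _, rfl⟩ := h
    exact mem_insert_self _ _

lemma insert_mem_walks {nb : β → Finset β} {k : ℕ} {u v : β} {T : Finset β} (hu : u ∈ nb v)
    (h : T ∈ walks nb k u) : insert v T ∈ walks nb (k + 1) v := by
  simp only [walks, mem_biUnion, mem_image]
  exact ⟨u, hu, T, h, rfl⟩

lemma walks_succ {nb : β → Finset β} (hrefl : ∀ v, v ∈ nb v) {k : ℕ} {v : β} {T : Finset β}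
    (h : T ∈ walks nb k v) : T ∈ walks nb (k + 1) v := by
  have := insert_mem_walks (hrefl v) h
  rwa [insert_eq_of_mem (mem_of_mem_walks h)] at this

lemma walks_mono {nb : β → Finset β} (hrefl : ∀ v, v ∈ nb v) {k l : ℕ} (hkl : k ≤ l) {v : β}
    {T : Finset β} (h : T ∈ walks nb k v) : T ∈ walks nb l v := by
  induction l, hkl using Nat.le_induction with
  | base => exact h
  | succ l _ ih => exact walks_succ hrefl ih

lemma walks_detour {nb : β → Finset β} (hsymm : ∀ u v, u ∈ nb v → v ∈ nb u) {k : ℕ}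
    {u v w : β} {T : Finset β} (h : T ∈ walks nb k v) (hu : u ∈ T) (hw : w ∈ nb u) :
    insert w T ∈ walks nb (k + 2) v := by
  have here : ∀ k (v : β) (T : Finset β), T ∈ walks nb k v → w ∈ nb v →
      insert w T ∈ walks nb (k + 2) v := by
    intro k v T h hw
    have := insert_mem_walks hw (insert_mem_walks (hsymm _ _ hw) h)
    rwa [insert_eq_of_mem (mem_insert_of_mem (mem_of_mem_walks h))] at this
  induction k generalizing v T with
  | zero =>
    have : u = v := by simp [walks] at h; simpa [h] using hu
    subst this
    exact here _ _ _ h hw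
  | succ k ih =>
    by_cases huv : u = v
    · subst huv
      exact here _ _ _ h hw
    · have h' := h
      simp only [walks, mem_biUnion, mem_image] at h'
      obtain ⟨u', hu', T', hT', rfl⟩ := h'
      rw [mem_insert] at hu
      have := insert_mem_walks hu' (ih hT' (hu.resolve_left huv))
      rwa [insert_comm] at this

lemma Linked.mem_walks {nb : β → Finset β} (hsymm : ∀ u v, u ∈ nb v → v ∈ nb u)
    {T : Finset β} (hT : Linked (fun x y => y ∈ nb x) T) {v : β} (hv : v ∈ T) :
    T ∈ walks nb (2 * (T.card - 1)) v := by
  classical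
  obtain ⟨C, hC, hmax⟩ := exists_max_image
    (T.powerset.filter fun C => C ∈ walks nb (2 * (C.card - 1)) v) card
    ⟨{v}, by simp [hv, walks]⟩
  simp only [mem_filter, mem_powerset] at hC hmax
  by_cases hCT : C = T
  · subst hCT; exact hC.2
  obtain ⟨p, hp, q, hq, hr⟩ := hT C hC.1 ⟨v, mem_of_mem_walks hC.2⟩ hCT
  rw [mem_sdiff] at hq
  have hpos : 0 < C.card := card_pos.2 ⟨p, hp⟩
  have hcard := card_insert_of_notMem hq.2
  have := hmax (Insert.insert q C) ⟨insert_subset hq.1 hC.1, by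
    have := walks_detour hsymm hC.2 hp hr
    rw [hcard]
    convert this using 2
    omega⟩
  omega

/-- The number of linked sets of bounded size containing a given element. -/
lemma card_linked_le {nb : β → Finset β} (hsymm : ∀ u v, u ∈ nb v → v ∈ nb u)
    (hrefl : ∀ v, v ∈ nb v) {D : ℕ} (hD : ∀ v, (nb v).card ≤ D) (v : β) (j : ℕ)
    (F : Finset (Finset β))
    (hF : ∀ T ∈ F, Linked (fun x y => y ∈ nb x) T ∧ v ∈ T ∧ T.card ≤ j) :
    F.card ≤ D ^ (2 * j) := by
  refine (card_le_card fun T hT => ?_).trans (card_walks_le nb hD (2 * j) v)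
  obtain ⟨h1, h2, h3⟩ := hF T hT
  exact walks_mono hrefl (by omega) (h1.mem_walks hsymm h2)

end Linked

/-- The Hamming ball of radius `R` about `x`. -/
def ball (R : ℕ) (x : Finset (Fin n)) : Finset (Finset (Fin n)) :=
  univ.filter fun y => (symmDiff x y).card ≤ R

lemma mem_ball {R : ℕ} {x y : Finset (Fin n)} : y ∈ ball R x ↔ (symmDiff x y).card ≤ R := by
  simp [ball]

lemma mem_ball_symm {R : ℕ} (x y : Finset (Fin n)) (h : x ∈ ball R y) : y ∈ ball R x := by
  rw [mem_ball] at *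
  rwa [symmDiff_comm]

lemma self_mem_ball {R : ℕ} (x : Finset (Fin n)) : x ∈ ball R x := by
  rw [mem_ball]
  simp

lemma ball_trans {R S : ℕ} {x y z : Finset (Fin n)} (h : y ∈ ball R x) (h' : z ∈ ball S y) :
    z ∈ ball (R + S) x := by
  rw [mem_ball] at *
  calc (symmDiff x z).card ≤ (symmDiff x y ∪ symmDiff y z).card :=
        card_le_card (symmDiff_triangle x y z)
    _ ≤ _ := (card_union_le _ _).trans (by omega)

lemma ball_mono {R S : ℕ} (h : R ≤ S) {x y : Finset (Fin n)} (hy : y ∈ ball R x) :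
    y ∈ ball S x := by
  rw [mem_ball] at *; omega

lemma mem_ball_of_mem_dn {x y : Finset (Fin n)} (h : y ∈ dn x) : y ∈ ball 1 x := by
  obtain ⟨i, hi, rfl⟩ := mem_dn.1 h
  rw [mem_ball]
  calc _ ≤ ({i} : Finset (Fin n)).card := card_le_card (by
        intro j; simp only [mem_symmDiff, mem_erase, mem_singleton]; tauto)
    _ = 1 := card_singleton _

lemma card_subsets_le (R : ℕ) :
    ((univ : Finset (Finset (Fin n))).filter fun s => s.card ≤ R).card ≤ (n + 1) ^ R := by
  induction R with
  | zero => simp [card_eq_zero, filter_eq']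
  | succ R ih =>
    have : ((univ : Finset (Finset (Fin n))).filter fun s => s.card ≤ R + 1) ⊆
        ((univ : Finset (Option (Fin n))) ×ˢ
          ((univ : Finset (Finset (Fin n))).filter fun s => s.card ≤ R)).image
          (fun p => p.1.elim p.2 (fun i => insert i p.2)) := by
      intro s hs
      rw [mem_filter] at hs
      rw [mem_image]
      rcases s.eq_empty_or_nonempty with rfl | ⟨i, hi⟩
      · exact ⟨(none, ∅), by simp, rfl⟩
      · refine ⟨(some i, s.erase i), ?_, insert_erase hi⟩
        have := card_erase_add_one hi
        simp only [mem_product, mem_univ, true_and, mem_filter]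
        omega
    calc _ ≤ _ := card_le_card this
      _ ≤ _ := card_image_le
      _ = (n + 1) * _ := by rw [card_product]; simp
      _ ≤ (n + 1) * (n + 1) ^ R := Nat.mul_le_mul_left _ ih
      _ = _ := by ring

lemma card_ball_le (R : ℕ) (x : Finset (Fin n)) : (ball R x).card ≤ (n + 1) ^ R := by
  refine le_trans ?_ (card_subsets_le (n := n) R)
  refine card_le_card_of_injOn (fun y => symmDiff x y) (fun y hy => ?_) (fun y _ z _ h => ?_)
  · simpa [ball] using hy
  · exact symmDiff_right_injective x h

/-- Sets sharing a lower neighbour. -/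
def adj (x y : Finset (Fin n)) : Prop := ¬ Disjoint (dn x) (dn y)

lemma adj_symm (x y : Finset (Fin n)) (h : adj x y) : adj y x := fun h' => h h'.symm

lemma mem_ball_of_adj {x y : Finset (Fin n)} (h : adj x y) : y ∈ ball 2 x := by
  obtain ⟨z, hzx, hzy⟩ := not_disjoint_iff.1 h
  exact ball_trans (mem_ball_of_mem_dn hzx) (mem_ball_symm _ _ (mem_ball_of_mem_dn hzy))

/-- A set within bounded distance of a linked family, and conversely, is linked. -/
lemma linked_of_near {r : ℕ} {A T : Finset (Finset (Fin n))} (hA : Linked adj A)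
    (h1 : ∀ a ∈ A, ∃ t ∈ T, t ∈ ball r a) (h2 : ∀ t ∈ T, ∃ a ∈ A, a ∈ ball r t) :
    Linked (fun x y => y ∈ ball (2 * r + 2) x) T := by
  classical
  intro P hP ⟨p, hp⟩ hPT
  set AP := A.filter fun a => ∃ t ∈ P, t ∈ ball r a with hAP
  have hAP' : AP.Nonempty := by
    obtain ⟨a, ha, hat⟩ := h2 p (hP hp)
    exact ⟨a, mem_filter.2 ⟨ha, p, hp, mem_ball_symm _ _ hat⟩⟩
  obtain ⟨q, hq, hqP⟩ : ∃ q ∈ T, q ∉ P := by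
    by_contra! h
    exact hPT (Subset.antisymm hP h)
  by_cases hall : AP = A
  · obtain ⟨a, ha, haq⟩ := h2 q hq
    rw [← hall, mem_filter] at ha
    obtain ⟨_, t, ht, hta⟩ := ha
    exact ⟨t, ht, q, mem_sdiff.2 ⟨hq, hqP⟩,
      ball_mono (by omega) (ball_trans (mem_ball_symm _ _ hta) (mem_ball_symm _ _ haq))⟩
  · obtain ⟨a, ha, b, hb, hab⟩ := hA AP (filter_subset _ _) hAP' hall
    obtain ⟨_, t, ht, hta⟩ := mem_filter.1 ha
    rw [mem_sdiff] at hb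
    obtain ⟨s, hs, hsb⟩ := h1 b hb.1
    refine ⟨t, ht, s, mem_sdiff.2 ⟨hs, fun hsP => hb.2 (mem_filter.2 ⟨hb.1, s, hsP, hsb⟩)⟩, ?_⟩
    exact ball_mono (by omega)
      (ball_trans (ball_trans (mem_ball_symm _ _ hta) (mem_ball_of_adj hab)) hsb)

/-- Greedy covering: a small subfamily whose union nearly contains every member. -/
lemma exists_greedy {β γ : Type*} [DecidableEq β] [DecidableEq γ] (B : Finset β)
    (f : β → Finset γ) {η : ℝ} (hη : 0 < η) :
    ∃ T ⊆ B, η * T.card ≤ (T.biUnion f).card ∧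
      ∀ y ∈ B, ((f y \ T.biUnion f).card : ℝ) < η := by
  classical
  obtain ⟨T, hT, hmax⟩ := exists_max_image
    (B.powerset.filter fun T => η * T.card ≤ (T.biUnion f).card) card ⟨∅, by simp⟩
  simp only [mem_filter, mem_powerset] at hT hmax
  refine ⟨T, hT.1, hT.2, fun y hy => ?_⟩
  by_contra! h
  by_cases hyT : y ∈ T
  · rw [sdiff_eq_empty_iff_subset.2 (subset_biUnion_of_mem f hyT)] at h
    simp at h
    linarith
  · have hcard := card_insert_of_notMem hyT
    have := hmax (insert y T) ⟨insert_subset hy hT.1, by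
      rw [hcard, biUnion_insert, ← sdiff_union_self_eq_union, card_union_of_disjoint sdiff_disjoint]
      push_cast
      linarith [hT.2]⟩
    omega

lemma card_up_eq {K : ℕ} {A : Finset (Finset (Fin n))} (hA : A ⊆ lay n K)
    (hKn : K ≤ n) {y : Finset (Fin n)} (hy : y ∈ sh A) : ((up y).card : ℝ) = n - K + 1 := by
  obtain ⟨x, hx, hyx⟩ := mem_sh.1 hy
  have h1 := card_of_mem_dn hyx
  have h2 := mem_lay.1 (hA hx)
  rw [card_up]
  have : n - y.card = n - K + 1 := by omega
  rw [this]; push_cast [Nat.cast_sub hKn]; ring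

/-- The number of edges leaving the shadow of `A` towards sets outside the closure of `A`. -/
lemma sum_out_le {K : ℕ} {A : Finset (Finset (Fin n))} (hA : A ⊆ lay n K)
    (hKn : K ≤ n) (h2K : n + 1 ≤ 2 * K) :
    ∑ y ∈ sh A, ((up y \ cl K A).card : ℝ) ≤ K * ((sh A).card - (cl K A).card) := by
  have h1 : ∑ y ∈ sh A, ((up y ∩ cl K A).card : ℝ) = K * (cl K A).card := by
    have := sum_dn_inter (cl K A) (sh A)
    have h2 : ∑ x ∈ cl K A, (dn x ∩ sh A).card = ∑ x ∈ cl K A, K := by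
      refine sum_congr rfl fun x hx => ?_
      rw [inter_eq_left.2 (mem_cl.1 hx).2, card_dn, (mem_cl.1 hx).1]
    rw [h2] at this
    rw [← Nat.cast_sum, ← this]
    simp [mul_comm]
  have h2 : ∑ y ∈ sh A, ((up y \ cl K A).card : ℝ) + ∑ y ∈ sh A, ((up y ∩ cl K A).card : ℝ)
      = (sh A).card * (n - K + 1) := by
    rw [← sum_add_distrib, ← nsmul_eq_mul, ← sum_const]
    refine sum_congr rfl fun y hy => ?_
    rw [← card_up_eq hA hKn hy, ← Nat.cast_add, card_sdiff_add_card_inter]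
  have h3 : ((sh A).card : ℝ) * (n - K + 1) ≤ (sh A).card * K := by
    apply mul_le_mul_of_nonneg_left _ (Nat.cast_nonneg _)
    have : (n : ℝ) + 1 ≤ 2 * K := by exact_mod_cast h2K
    linarith
  rw [h1] at h2
  linarith

/-- The part of a shadow recovered from a certificate. -/
def decF (T₁ T₂ T₅ : Finset (Finset (Fin n))) : Finset (Finset (Fin n)) :=
  sh ((T₁.biUnion up \ T₅) ∪ T₂)

open Classical in
/-- The container recovered from a certificate. -/
noncomputable def decS (K : ℕ) (ψ : ℝ) (F T₃ : Finset (Finset (Fin n))) :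
    Finset (Finset (Fin n)) :=
  ((lay n K).filter fun x => ((dn x \ F).card : ℝ) < ψ) \ T₃.biUnion up

open Classical in
/-- The improved approximation of the shadow recovered from a certificate. -/
noncomputable def decF' (ψ : ℝ) (F S : Finset (Finset (Fin n))) : Finset (Finset (Fin n)) :=
  F ∪ univ.filter fun y => ψ ≤ ((up y ∩ S).card : ℝ)

/-- First approximation: a few vertices of the shadow, together with their neighbourhoods in the
closure, determine most of the shadow. -/
lemma exists_first_approx {K : ℕ} {A : Finset (Finset (Fin n))} (hA : A ⊆ lay n K)
    (hKn : K ≤ n) (h2K : n + 1 ≤ 2 * K) {θ η : ℝ} (hθ : 0 < θ) (hη : 0 < η)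
    (hθe : θ ≤ n - K + 1) :
    ∃ T₁ T₅ : Finset (Finset (Fin n)), T₁ ⊆ sh A ∧ T₅ ⊆ T₁.biUnion up ∧
      T₁.biUnion up \ T₅ ⊆ cl K A ∧ η * T₁.card ≤ (sh A).card ∧ T₅.card ≤ θ * T₁.card ∧
      K * (n - K + 1 - θ) * ((sh A \ sh (T₁.biUnion up \ T₅)).card -
          K * ((sh A).card - (cl K A).card) / θ) ≤
        (sh A).card * (η + n) + K * ((sh A).card - (cl K A).card) / θ * n ^ 2 := by
  classical
  set G := sh A with hG
  set B := cl K A with hB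
  set b : ℝ := K * (G.card - B.card) / θ with hb
  have hout := sum_out_le hA hKn h2K
  rw [← hG, ← hB] at hout
  set good := G.filter fun y => ((up y \ B).card : ℝ) ≤ θ with hgood
  set bad := G.filter fun y => ¬ ((up y \ B).card : ℝ) ≤ θ with hbad
  have hbadb : (bad.card : ℝ) ≤ b := by
    rw [hb, le_div_iff₀ hθ]
    calc (bad.card : ℝ) * θ = ∑ y ∈ bad, θ := by simp
      _ ≤ ∑ y ∈ bad, ((up y \ B).card : ℝ) :=
        sum_le_sum fun y hy => (not_le.1 (mem_filter.1 hy).2).le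
      _ ≤ ∑ y ∈ G, ((up y \ B).card : ℝ) :=
        sum_le_sum_of_subset_of_nonneg (filter_subset _ _) fun _ _ _ => Nat.cast_nonneg _
      _ ≤ _ := hout
  obtain ⟨T₁, hT₁, hT₁c, hT₁g⟩ := exists_greedy good (fun y => sh (up y ∩ B)) hη
  set T₅ := T₁.biUnion fun y => up y \ B with hT₅
  have hNA : T₁.biUnion up \ T₅ = T₁.biUnion fun y => up y ∩ B := by
    ext x
    simp only [hT₅, mem_sdiff, mem_biUnion, mem_inter, not_exists, not_and, not_not]
    constructor
    · rintro ⟨⟨y, hy, hxy⟩, h⟩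
      exact ⟨y, hy, hxy, h y hy hxy⟩
    · rintro ⟨y, hy, hxy, hx⟩
      exact ⟨⟨y, hy, hxy⟩, fun _ _ _ => hx⟩
  have hF1 : sh (T₁.biUnion up \ T₅) = T₁.biUnion fun y => sh (up y ∩ B) := by
    rw [hNA, sh, biUnion_biUnion]; rfl
  set F₁ := sh (T₁.biUnion up \ T₅) with hF₁
  have hNAB : T₁.biUnion up \ T₅ ⊆ B := by
    rw [hNA]; exact biUnion_subset.2 fun y _ => inter_subset_right
  have hF₁G : F₁ ⊆ G := by
    rw [hG, ← sh_cl hA]; exact sh_mono hNAB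
  refine ⟨T₁, T₅, hT₁.trans (filter_subset _ _), ?_, hNAB, ?_, ?_, ?_⟩
  · exact biUnion_subset.2 fun y hy => sdiff_subset.trans (subset_biUnion_of_mem up hy)
  · refine hT₁c.trans ?_
    rw [← hF1]
    exact_mod_cast card_le_card hF₁G
  · calc (T₅.card : ℝ) ≤ ((∑ y ∈ T₁, (up y \ B).card : ℕ) : ℝ) := by exact_mod_cast card_biUnion_le
      _ = ∑ y ∈ T₁, ((up y \ B).card : ℝ) := by push_cast; rfl
      _ ≤ ∑ y ∈ T₁, θ := sum_le_sum fun y hy => (mem_filter.1 (hT₁ hy)).2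
      _ = θ * T₁.card := by simp [mul_comm]
  set H := G \ F₁ with hH
  have hupn : ∀ y : Finset (Fin n), ((up y).card : ℝ) ≤ n := fun y => by
    rw [card_up]; exact_mod_cast Nat.sub_le _ _
  have hdnn : ∀ x : Finset (Fin n), ((dn x).card : ℝ) ≤ n := fun x => by
    rw [card_dn]; exact_mod_cast (card_le_univ x).trans (by simp)
  -- two-step neighbourhoods of good vertices meet the uncovered part rarely
  have hgoodsum : ∀ y ∈ good, ∑ x ∈ up y ∩ B, ((dn x ∩ H).card : ℝ) ≤ η + n := by
    intro y hy
    have h1 : ∀ x ∈ up y ∩ B, ((dn x ∩ H).card : ℝ) ≤ (((dn x ∩ H).erase y).card : ℝ) + 1 := by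
      intro x _
      have := pred_card_le_card_erase (s := dn x ∩ H) (a := y)
      exact_mod_cast (show (dn x ∩ H).card ≤ ((dn x ∩ H).erase y).card + 1 by omega)
    have hdisj : ((up y ∩ B : Finset _) : Set (Finset (Fin n))).PairwiseDisjoint
        fun x => (dn x ∩ H).erase y := by
      intro x hx x' hx' hne
      refine disjoint_left.2 fun z hz hz' => hne ?_
      simp only [mem_erase, mem_inter, coe_inter, Set.mem_inter_iff, mem_coe] at hz hz' hx hx'
      exact up_inter_unique (Ne.symm hz.1) (mem_up_iff.1 hx.1) hz.2.1 (mem_up_iff.1 hx'.1) hz'.2.1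
    have h2 : ∑ x ∈ up y ∩ B, ((dn x ∩ H).erase y).card ≤ (sh (up y ∩ B) \ F₁).card := by
      rw [← card_biUnion hdisj]
      refine card_le_card (biUnion_subset.2 fun x hx z hz => ?_)
      simp only [mem_erase, mem_inter, hH, mem_sdiff] at hz
      exact mem_sdiff.2 ⟨mem_sh.2 ⟨x, hx, hz.2.1⟩, hz.2.2.2⟩
    have h3 := hT₁g y hy
    rw [← hF1] at h3
    calc ∑ x ∈ up y ∩ B, ((dn x ∩ H).card : ℝ)
        ≤ ∑ x ∈ up y ∩ B, ((((dn x ∩ H).erase y).card : ℝ) + 1) := sum_le_sum h1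
      _ = ((∑ x ∈ up y ∩ B, ((dn x ∩ H).erase y).card : ℕ) : ℝ) + (up y ∩ B).card := by
          rw [sum_add_distrib]; simp
      _ ≤ η + n := by
          apply add_le_add
          · exact (Nat.cast_le.2 h2).trans h3.le
          · exact (Nat.cast_le.2 (card_le_card inter_subset_left)).trans (hupn y)
  have hbadsum : ∀ y ∈ bad, ∑ x ∈ up y ∩ B, ((dn x ∩ H).card : ℝ) ≤ n ^ 2 := by
    intro y _
    calc ∑ x ∈ up y ∩ B, ((dn x ∩ H).card : ℝ) ≤ ∑ x ∈ up y ∩ B, (n : ℝ) :=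
          sum_le_sum fun x _ => (Nat.cast_le.2 (card_le_card inter_subset_left)).trans (hdnn x)
      _ = (up y ∩ B).card * n := by simp
      _ ≤ n * n := by
          gcongr
          exact (card_le_card inter_subset_left).trans (by rw [card_up]; exact Nat.sub_le _ _)
      _ = _ := by ring
  set E : ℝ := ∑ x ∈ B, ((dn x ∩ H).card : ℝ) with hE
  have hswap : (K : ℝ) * E = ∑ y ∈ G, ∑ x ∈ up y ∩ B, ((dn x ∩ H).card : ℝ) := by
    have : ∑ y ∈ G, ∑ x ∈ up y ∩ B, ((dn x ∩ H).card : ℝ) =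
        ∑ x ∈ B, ∑ y ∈ dn x ∩ G, ((dn x ∩ H).card : ℝ) := by
      refine sum_comm' fun y x => ?_
      simp only [mem_inter, mem_up_iff]
      tauto
    rw [this, hE, mul_sum]
    refine sum_congr rfl fun x hx => ?_
    rw [sum_const, inter_eq_left.2 (mem_cl.1 hx).2, card_dn, (mem_cl.1 hx).1, nsmul_eq_mul]
  have hKE : (K : ℝ) * E ≤ G.card * (η + n) + b * n ^ 2 := by
    rw [hswap, ← sum_filter_add_sum_filter_not G fun y => ((up y \ B).card : ℝ) ≤ θ]
    apply add_le_add
    · calc _ ≤ ∑ y ∈ good, (η + n) := sum_le_sum hgoodsum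
        _ = good.card * (η + n) := by rw [sum_const, nsmul_eq_mul]
        _ ≤ G.card * (η + n) := by
            gcongr
            exact filter_subset _ _
    · calc _ ≤ ∑ y ∈ bad, (n : ℝ) ^ 2 := sum_le_sum hbadsum
        _ = bad.card * n ^ 2 := by simp
        _ ≤ b * n ^ 2 := by gcongr
  have hHE : (n - K + 1 - θ) * (H.card - b) ≤ E := by
    have h1 : E = ∑ y ∈ H, ((up y ∩ B).card : ℝ) := by
      rw [hE]; exact_mod_cast sum_dn_inter B H
    have h2 : ∀ y ∈ H ∩ good, (n - K + 1 - θ) ≤ ((up y ∩ B).card : ℝ) := by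
      intro y hy
      have hy' := mem_filter.1 (mem_inter.1 hy).2
      have e1 := card_up_eq hA hKn hy'.1
      rw [← card_sdiff_add_card_inter (up y) B] at e1
      push_cast at e1
      linarith [hy'.2]
    have h3 : (H.card : ℝ) - b ≤ (H ∩ good).card := by
      have : H ⊆ (H ∩ good) ∪ bad := by
        intro y hy
        have hyG : y ∈ G := (mem_sdiff.1 hy).1
        simp only [mem_union, mem_inter, hgood, hbad, mem_filter]
        tauto
      have h4 : (H.card : ℝ) ≤ (H ∩ good).card + bad.card := by
        exact_mod_cast (card_le_card this).trans (card_union_le _ _)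
      linarith
    calc (n - K + 1 - θ) * (H.card - b) ≤ (n - K + 1 - θ) * (H ∩ good).card :=
          mul_le_mul_of_nonneg_left h3 (by linarith)
      _ = ∑ y ∈ H ∩ good, ((n : ℝ) - K + 1 - θ) := by
        rw [sum_const, nsmul_eq_mul, mul_comm]
      _ ≤ ∑ y ∈ H ∩ good, ((up y ∩ B).card : ℝ) := sum_le_sum h2
      _ ≤ ∑ y ∈ H, ((up y ∩ B).card : ℝ) :=
        sum_le_sum_of_subset_of_nonneg inter_subset_left fun _ _ _ => Nat.cast_nonneg _
      _ = E := h1.symm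
  calc (K : ℝ) * (n - K + 1 - θ) * (H.card - b) = K * ((n - K + 1 - θ) * (H.card - b)) := by ring
    _ ≤ K * E := by gcongr
    _ ≤ _ := hKE

/-- Second approximation: refine the approximation `sh N` of the shadow, and find a set that
contains the closure and has few edges to the complement of the shadow. -/
lemma exists_second_approx {K : ℕ} {A N : Finset (Finset (Fin n))} (hA : A ⊆ lay n K)
    (hKn : K ≤ n) (h2K : n + 1 ≤ 2 * K) {ψ : ℝ} (hψ : 0 < ψ) (hψK : ψ ≤ K)
    (hN : N ⊆ cl K A) :
    ∃ T₂ T₃ F S F' : Finset (Finset (Fin n)), F = sh (N ∪ T₂) ∧ S = decS K ψ F T₃ ∧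
      F' = decF' ψ F S ∧ T₂ ⊆ cl K A ∧ ψ * T₂.card ≤ (sh A \ sh N).card ∧
      (∀ x ∈ cl K A, ((dn x \ F).card : ℝ) < ψ) ∧
      (∀ y ∈ T₃, ∃ x ∈ up y, x.card = K ∧ ((dn x \ F).card : ℝ) < ψ) ∧
      F ⊆ sh A ∧ cl K A ⊆ S ∧ F' ⊆ sh A ∧
      (K - ψ) * (S \ cl K A).card ≤ K * ((sh A).card - (cl K A).card) ∧
      (K - ψ) * (ψ * T₃.card) ≤ K * ((sh A).card - (cl K A).card) ∧
      (n - K + 1 - ψ) * (sh A \ F').card ≤ K * ((sh A).card - (cl K A).card) ∧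
      K * S.card ≤ (n - K + 1) * F'.card + ψ * (sh A \ F').card + ψ * (S \ cl K A).card := by
  classical
  set G := sh A with hG
  set B := cl K A with hB
  have hout := sum_out_le hA hKn h2K
  rw [← hG, ← hB] at hout
  have hshB : ∀ C ⊆ B, sh C ⊆ G := fun C hC => by rw [hG, ← sh_cl hA]; exact sh_mono hC
  obtain ⟨T₂, hT₂, hT₂c, hT₂g⟩ := exists_greedy B (fun x => dn x \ sh N) hψ
  set F := sh (N ∪ T₂) with hF
  have hFG : F ⊆ G := hshB _ (union_subset hN hT₂)
  have hBF : ∀ x ∈ B, ((dn x \ F).card : ℝ) < ψ := by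
    intro x hx
    refine lt_of_le_of_lt (Nat.cast_le.2 (card_le_card ?_)) (hT₂g x hx)
    intro z hz
    simp only [hF, sh_union, mem_sdiff, mem_union, not_or, mem_biUnion, not_exists, not_and,
      not_not] at hz ⊢
    exact ⟨⟨hz.1, hz.2.1⟩, fun w hw hzw => (hz.2.2 (mem_sh.2 ⟨w, hw, hzw⟩)).elim⟩
  set S₀ := (lay n K).filter fun x => ((dn x \ F).card : ℝ) < ψ with hS₀
  have hBS₀ : B ⊆ S₀ := fun x hx => mem_filter.2 ⟨cl_subset_lay hx, hBF x hx⟩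
  obtain ⟨T₃, hT₃, hT₃c, hT₃g⟩ := exists_greedy
    (univ.filter fun y => y ∉ G ∧ (up y ∩ S₀).Nonempty) (fun y => up y ∩ S₀) hψ
  set S := decS K ψ F T₃ with hS
  have hSS₀ : S ⊆ S₀ := sdiff_subset
  have hupB : ∀ y ∉ G, ∀ x ∈ up y, x ∉ B := fun y hy x hx hxB =>
    hy ((mem_cl.1 hxB).2 (mem_up_iff.1 hx))
  have hBS : B ⊆ S := by
    intro x hx
    refine mem_sdiff.2 ⟨hBS₀ hx, fun h => ?_⟩
    obtain ⟨y, hy, hxy⟩ := mem_biUnion.1 h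
    exact hupB y (mem_filter.1 (hT₃ hy)).2.1 x hxy hx
  have hyS : ∀ y ∉ G, ((up y ∩ S).card : ℝ) < ψ := by
    intro y hy
    by_cases hne : (up y ∩ S₀).Nonempty
    · refine lt_of_le_of_lt (Nat.cast_le.2 (card_le_card ?_))
        (hT₃g y (mem_filter.2 ⟨mem_univ _, hy, hne⟩))
      intro x hx
      have hxS := (mem_inter.1 hx).2
      refine mem_sdiff.2 ⟨mem_inter.2 ⟨(mem_inter.1 hx).1, hSS₀ hxS⟩, fun h => ?_⟩
      obtain ⟨w, hw, hxw⟩ := mem_biUnion.1 h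
      exact (mem_sdiff.1 hxS).2 (mem_biUnion.2 ⟨w, hw, (mem_inter.1 hxw).1⟩)
    · have : up y ∩ S = ∅ := by
        rw [not_nonempty_iff_eq_empty] at hne
        exact subset_empty.1 (hne ▸ inter_subset_inter_left hSS₀)
      simpa [this] using hψ
  set F' := decF' ψ F S with hF'
  have hF'G : F' ⊆ G := by
    refine union_subset hFG fun y hy => ?_
    by_contra h
    exact absurd (mem_filter.1 hy).2 (not_le.2 (hyS y h))
  have hS₀B : (K - ψ) * (S₀ \ B).card ≤ K * (G.card - B.card) := by
    have h1 : ∀ x ∈ S₀ \ B, (K : ℝ) - ψ ≤ ((dn x ∩ G).card : ℝ) := by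
      intro x hx
      have hx' := mem_filter.1 (mem_sdiff.1 hx).1
      have e1 : ((dn x \ F).card : ℝ) + (dn x ∩ F).card = K := by
        rw [← Nat.cast_add, card_sdiff_add_card_inter, card_dn, mem_lay.1 hx'.1]
      have e2 : ((dn x ∩ F).card : ℝ) ≤ (dn x ∩ G).card :=
        Nat.cast_le.2 (card_le_card (inter_subset_inter_left hFG))
      linarith [hx'.2]
    calc (K - ψ) * (S₀ \ B).card = ∑ x ∈ S₀ \ B, ((K : ℝ) - ψ) := by
          rw [sum_const, nsmul_eq_mul, mul_comm]
      _ ≤ ∑ x ∈ S₀ \ B, ((dn x ∩ G).card : ℝ) := sum_le_sum h1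
      _ = ∑ y ∈ G, ((up y ∩ (S₀ \ B)).card : ℝ) := by exact_mod_cast sum_dn_inter _ _
      _ ≤ ∑ y ∈ G, ((up y \ B).card : ℝ) := by
          refine sum_le_sum fun y _ => Nat.cast_le.2 (card_le_card fun x hx => ?_)
          simp only [mem_inter, mem_sdiff] at hx ⊢
          tauto
      _ ≤ _ := hout
  have hKψ : (0 : ℝ) ≤ K - ψ := by linarith
  refine ⟨T₂, T₃, F, S, F', rfl, rfl, rfl, hT₂, ?_, hBF, ?_, hFG, hBS, hF'G, ?_, ?_, ?_, ?_⟩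
  · refine hT₂c.trans (Nat.cast_le.2 (card_le_card (biUnion_subset.2 fun x hx => ?_)))
    exact sdiff_subset_sdiff (mem_cl.1 (hT₂ hx)).2 le_rfl
  · intro y hy
    obtain ⟨x, hx⟩ := (mem_filter.1 (hT₃ hy)).2.2
    have h2 := mem_filter.1 (mem_inter.1 hx).2
    exact ⟨x, (mem_inter.1 hx).1, mem_lay.1 h2.1, h2.2⟩
  · exact (mul_le_mul_of_nonneg_left
      (Nat.cast_le.2 (card_le_card (sdiff_subset_sdiff hSS₀ le_rfl))) hKψ).trans hS₀B
  · refine (mul_le_mul_of_nonneg_left (hT₃c.trans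
      (Nat.cast_le.2 (card_le_card (biUnion_subset.2 fun y hy x hx => ?_)))) hKψ).trans hS₀B
    have hx := mem_inter.1 hx
    exact mem_sdiff.2 ⟨hx.2, hupB y (mem_filter.1 (hT₃ hy)).2.1 x hx.1⟩
  · have h1 : ∀ y ∈ G \ F', (n : ℝ) - K + 1 - ψ ≤ ((up y \ B).card : ℝ) := by
      intro y hy
      obtain ⟨hyG, hyF⟩ := mem_sdiff.1 hy
      have e1 : ((up y \ B).card : ℝ) + (up y ∩ B).card = n - K + 1 := by
        rw [← Nat.cast_add, card_sdiff_add_card_inter, card_up_eq hA hKn hyG]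
      have e2 : ((up y ∩ B).card : ℝ) ≤ (up y ∩ S).card :=
        Nat.cast_le.2 (card_le_card (inter_subset_inter_left hBS))
      have e3 : ((up y ∩ S).card : ℝ) < ψ := by
        by_contra! h
        exact hyF (mem_union_right _ (mem_filter.2 ⟨mem_univ _, h⟩))
      linarith
    calc (n - K + 1 - ψ) * (G \ F').card = ∑ y ∈ G \ F', ((n : ℝ) - K + 1 - ψ) := by
          rw [sum_const, nsmul_eq_mul, mul_comm]
      _ ≤ ∑ y ∈ G \ F', ((up y \ B).card : ℝ) := sum_le_sum h1
      _ ≤ ∑ y ∈ G, ((up y \ B).card : ℝ) :=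
          sum_le_sum_of_subset_of_nonneg sdiff_subset fun _ _ _ => Nat.cast_nonneg _
      _ ≤ _ := hout
  · have hsplit : ∀ x ∈ S, (K : ℝ) =
        (dn x ∩ F').card + (dn x ∩ (G \ F')).card + (dn x \ G).card := by
      intro x hx
      have hxc := mem_lay.1 (mem_filter.1 (hSS₀ hx)).1
      have e1 := card_sdiff_add_card_inter (dn x) G
      have e2 : (dn x ∩ G).card = (dn x ∩ F').card + (dn x ∩ (G \ F')).card := by
        rw [← card_union_of_disjoint, ← inter_union_distrib_left, union_sdiff_of_subset hF'G]
        exact (disjoint_sdiff.mono inter_subset_right inter_subset_right)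
      rw [card_dn, hxc] at e1
      exact_mod_cast (by omega : K = _)
    have h0 : (K : ℝ) * S.card = ∑ x ∈ S, ((dn x ∩ F').card : ℝ) +
        ∑ x ∈ S, ((dn x ∩ (G \ F')).card : ℝ) + ∑ x ∈ S, ((dn x \ G).card : ℝ) := by
      rw [← sum_add_distrib, ← sum_add_distrib, ← sum_congr rfl hsplit, sum_const, nsmul_eq_mul,
        mul_comm]
    have h1 : ∑ x ∈ S, ((dn x ∩ F').card : ℝ) ≤ (n - K + 1) * F'.card := by
      calc ∑ x ∈ S, ((dn x ∩ F').card : ℝ) = ∑ y ∈ F', ((up y ∩ S).card : ℝ) := by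
            exact_mod_cast sum_dn_inter _ _
        _ ≤ ∑ y ∈ F', ((n : ℝ) - K + 1) := sum_le_sum fun y hy => by
            rw [← card_up_eq hA hKn (hF'G hy)]
            exact Nat.cast_le.2 (card_le_card inter_subset_left)
        _ = _ := by rw [sum_const, nsmul_eq_mul, mul_comm]
    have h2 : ∑ x ∈ S, ((dn x ∩ (G \ F')).card : ℝ) ≤ ψ * (G \ F').card := by
      calc ∑ x ∈ S, ((dn x ∩ (G \ F')).card : ℝ) = ∑ y ∈ G \ F', ((up y ∩ S).card : ℝ) := by
            exact_mod_cast sum_dn_inter _ _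
        _ ≤ ∑ y ∈ G \ F', ψ := sum_le_sum fun y hy => by
            by_contra! h
            exact (mem_sdiff.1 hy).2 (mem_union_right _ (mem_filter.2 ⟨mem_univ _, h.le⟩))
        _ = _ := by rw [sum_const, nsmul_eq_mul, mul_comm]
    have h3 : ∑ x ∈ S, ((dn x \ G).card : ℝ) ≤ ψ * (S \ B).card := by
      rw [← sum_sdiff hBS]
      have : ∑ x ∈ B, ((dn x \ G).card : ℝ) = 0 := sum_eq_zero fun x hx => by
        rw [sdiff_eq_empty_iff_subset.2 (mem_cl.1 hx).2]; simp
      rw [this, add_zero]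
      calc ∑ x ∈ S \ B, ((dn x \ G).card : ℝ) ≤ ∑ x ∈ S \ B, ψ := sum_le_sum fun x hx =>
            (Nat.cast_le.2 (card_le_card (sdiff_subset_sdiff le_rfl hFG))).trans
              (mem_filter.1 (hSS₀ (mem_sdiff.1 hx).1)).2.le
        _ = _ := by rw [sum_const, nsmul_eq_mul, mul_comm]
    linarith

section numerics

variable {l m K e t : ℝ}

lemma le_pow_mul_of_le (hl : 1000 ≤ l) (hm : 1 ≤ m) {i j : ℕ} (hij : i ≤ j) :
    l ^ i ≤ m * l ^ j :=
  (pow_le_pow_right₀ (by linarith) hij).trans (le_mul_of_one_le_left (by positivity) hm)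

lemma first_cert_bound (hl : 1000 ≤ l) (hm : 1 ≤ m) {g x : ℝ}
    (hgt : g ≤ m * l ^ 40 * t) (h : (m * l ^ 34) ^ 2 * x ≤ g) : m * l ^ 28 * x ≤ t := by
  have : (m * l ^ 40) * (m * l ^ 28 * x) ≤ (m * l ^ 40) * t := by
    linarith [show (m * l ^ 34) ^ 2 * x = (m * l ^ 40) * (m * l ^ 28 * x) by ring]
  exact le_of_mul_le_mul_left this (by positivity)

lemma uncovered_bound (hl : 1000 ≤ l) (hm : 1 ≤ m) (hK2 : m * l ^ 40 / 2 ≤ K)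
    (hKn : K ≤ m * l ^ 40) (he : m * l ^ 38 ≤ e) (ht : 0 ≤ t) {g h b : ℝ}
    (hgt : g ≤ m * l ^ 40 * t) (hb : b = K * t / (m * l ^ 23))
    (hh : K * (e - m * l ^ 23) * (h - b) ≤
      g * ((m * l ^ 34) ^ 2 + m * l ^ 40) + b * (m * l ^ 40) ^ 2) :
    h ≤ 9 * m * l ^ 30 * t := by
  have hl0 : 0 < l := by linarith
  have hb' : b ≤ l ^ 17 * t := by
    rw [hb, div_le_iff₀ (by positivity)]
    calc K * t ≤ m * l ^ 40 * t := by gcongr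
      _ = _ := by ring
  have e1 : l ^ 2 * t ≤ m * l ^ 30 * t := by
    gcongr; exact le_pow_mul_of_le hl hm (by norm_num)
  have e2 : l ^ 19 * t ≤ m * l ^ 30 * t / 4 := by
    have : l ^ 19 * 4 ≤ m * l ^ 30 := by
      calc l ^ 19 * 4 ≤ l ^ 19 * l := by gcongr; linarith
        _ = l ^ 20 := by ring
        _ ≤ _ := le_pow_mul_of_le hl hm (by norm_num)
    nlinarith
  have e3 : l ^ 17 * t ≤ l ^ 19 * t := by
    gcongr <;> [linarith; norm_num]
  have e4 : 0 ≤ l ^ 17 * t := by positivity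
  by_cases hhb : h ≤ b
  · linarith
  push Not at hhb
  have h2 : m * l ^ 38 / 2 ≤ e - m * l ^ 23 := by
    have : m * l ^ 23 * 2 ≤ m * l ^ 38 := by
      calc m * l ^ 23 * 2 ≤ m * l ^ 23 * l := by gcongr; linarith
        _ = m * l ^ 24 := by ring
        _ ≤ _ := by gcongr <;> [linarith; norm_num]
    linarith
  have h3 : (m * l ^ 40 / 2) * (m * l ^ 38 / 2) * (h - b) ≤ K * (e - m * l ^ 23) * (h - b) := by
    have : 0 ≤ h - b := by linarith
    have hK0 : 0 ≤ K := le_trans (by positivity) hK2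
    gcongr
  have h4 : g * ((m * l ^ 34) ^ 2 + m * l ^ 40) + b * (m * l ^ 40) ^ 2 ≤
      m * l ^ 40 * t * ((m * l ^ 34) ^ 2 + m * l ^ 40) + l ^ 17 * t * (m * l ^ 40) ^ 2 := by
    gcongr
  have h5 : (m ^ 2 * l ^ 78 / 4) * (h - b) ≤
      (m ^ 2 * l ^ 78 / 4) * (4 * (m * l ^ 30 * t) + 4 * (l ^ 2 * t) + 4 * (l ^ 19 * t)) := by
    calc _ = (m * l ^ 40 / 2) * (m * l ^ 38 / 2) * (h - b) := by ring
      _ ≤ _ := h3.trans (hh.trans h4)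
      _ = _ := by ring
  have h6 := le_of_mul_le_mul_left h5 (by positivity)
  have e5 : 4 * (l ^ 2 * t) ≤ m * l ^ 30 * t := by
    have : l ^ 2 * t * 4 ≤ l ^ 19 * t * 4 := by gcongr <;> [linarith; norm_num]
    linarith
  nlinarith

lemma psi_le (hl : 1000 ≤ l) (hm : 1 ≤ m) : m * l ^ 35 * 2 ≤ m * l ^ 38 := by
  calc m * l ^ 35 * 2 ≤ m * l ^ 35 * l := by gcongr; linarith
    _ = m * l ^ 36 := by ring
    _ ≤ _ := by gcongr <;> [linarith; norm_num]

lemma le_two_mul_of_mul_le (hl : 1000 ≤ l) (hm : 1 ≤ m) (hK2 : m * l ^ 40 / 2 ≤ K) {x : ℝ}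
    (ht : 0 ≤ t) (h : (K - m * l ^ 35) * x ≤ K * t) : x ≤ 2 * t := by
  have hl0 : 0 < l := by linarith
  have h1 : m * l ^ 35 ≤ K / 2 := by
    have : m * l ^ 35 * 4 ≤ m * l ^ 40 := by
      calc m * l ^ 35 * 4 ≤ m * l ^ 35 * l := by gcongr; linarith
        _ = m * l ^ 36 := by ring
        _ ≤ _ := by gcongr <;> [linarith; norm_num]
    linarith
  have hK0 : 0 < K := lt_of_lt_of_le (by positivity) hK2
  by_contra! hx
  nlinarith

lemma missing_bound (hl : 1000 ≤ l) (hm : 1 ≤ m) (hKn : K ≤ m * l ^ 40) (he : m * l ^ 38 ≤ e)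
    (ht : 0 ≤ t) {w : ℝ} (hw : 0 ≤ w) (h : (e - m * l ^ 35) * w ≤ K * t) :
    w ≤ 2 * l ^ 2 * t := by
  have hl0 : 0 < l := by linarith
  have h1 : m * l ^ 38 / 2 ≤ e - m * l ^ 35 := by linarith [psi_le hl hm]
  have h2 : m * l ^ 38 / 2 * w ≤ m * l ^ 38 / 2 * (2 * l ^ 2 * t) := by
    calc m * l ^ 38 / 2 * w ≤ (e - m * l ^ 35) * w := by gcongr
      _ ≤ K * t := h
      _ ≤ m * l ^ 40 * t := by gcongr
      _ = _ := by ring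
  exact le_of_mul_le_mul_left h2 (by positivity)

lemma container_bound (hl : 1000 ≤ l) (hm : 1 ≤ m) (hK2 : m * l ^ 40 / 2 ≤ K) (heK : e ≤ K)
    (ht : 0 ≤ t) {S f w s : ℝ} (hf : 0 ≤ f) (hw : w ≤ 2 * l ^ 2 * t) (hs : s ≤ 2 * t)
    (h : K * S ≤ e * f + m * l ^ 35 * w + m * l ^ 35 * s) : S ≤ f + 6 * t / l ^ 3 := by
  have hl0 : 0 < l := by linarith
  have hK0 : 0 < K := lt_of_lt_of_le (by positivity) hK2
  have h1 : K * S ≤ K * (f + 6 * t / l ^ 3) := by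
    calc K * S ≤ e * f + m * l ^ 35 * w + m * l ^ 35 * s := h
      _ ≤ K * f + m * l ^ 35 * (2 * l ^ 2 * t) + m * l ^ 35 * (l ^ 2 * t) := by
          have : 2 * t ≤ l ^ 2 * t := by gcongr; nlinarith
          gcongr
          linarith
      _ = K * f + (m * l ^ 40 / 2) * (6 * t / l ^ 3) := by field_simp; ring
      _ ≤ K * f + K * (6 * t / l ^ 3) := by gcongr
      _ = _ := by ring
  exact le_of_mul_le_mul_left h1 hK0

lemma six_div_le (hl : 1000 ≤ l) (ht : 0 ≤ t) : 6 * t / l ^ 3 ≤ t / (2 * l ^ 2) := by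
  have hl0 : 0 < l := by linarith
  rw [div_le_div_iff₀ (by positivity) (by positivity)]
  calc 6 * t * (2 * l ^ 2) = t * (12 * l ^ 2) := by ring
    _ ≤ t * (l * l ^ 2) := by gcongr; linarith
    _ = _ := by ring

lemma twelve_div_le (hl : 1000 ≤ l) (ht : 0 ≤ t) : 12 * t / l ^ 5 ≤ t / l ^ 2 := by
  have hl0 : 0 < l := by linarith
  rw [div_le_div_iff₀ (by positivity) (by positivity)]
  calc 12 * t * l ^ 2 = t * (12 * l ^ 2) := by ring
    _ ≤ t * (l * l ^ 2) := by gcongr; linarith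
    _ = t * l ^ 3 := by ring
    _ ≤ _ := by gcongr <;> [linarith; norm_num]

end numerics

lemma mem_ball_three {K : ℕ} {A F : Finset (Finset (Fin n))} (hF : F ⊆ sh A) {ψ : ℝ} (hψ : ψ ≤ K)
    {x : Finset (Fin n)} (hx : x.card = K) (hxF : ((dn x \ F).card : ℝ) < ψ) :
    ∃ a ∈ A, a ∈ ball 2 x := by
  have : (dn x ∩ F).Nonempty := by
    rw [nonempty_iff_ne_empty]
    intro h
    have e := card_sdiff_add_card_inter (dn x) F
    rw [h, card_empty, add_zero, card_dn, hx] at e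
    rw [e] at hxF
    linarith
  obtain ⟨z, hz⟩ := this
  obtain ⟨a, ha, hza⟩ := mem_sh.1 (hF (mem_inter.1 hz).2)
  exact ⟨a, ha, ball_trans (mem_ball_of_mem_dn (mem_inter.1 hz).1)
    (mem_ball_symm _ _ (mem_ball_of_mem_dn hza))⟩

set_option maxHeartbeats 800000 in
/-- Certificates for a linked set `A`: either a container noticeably smaller than the shadow of `A`
from a very small certificate, or the closure of `A` itself from a slightly larger one. -/
lemma exists_certificate {K : ℕ} {A : Finset (Finset (Fin n))} (hA : A ⊆ lay n K)
    (hlink : Linked adj A) {v : Finset (Fin n)} (hv : v ∈ A)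
    (hKn : K ≤ n) (h2K : n + 1 ≤ 2 * K) {l t : ℝ} (hl : 1000 ≤ l) (hln : l ^ 40 ≤ n)
    (he : n / l ^ 2 ≤ (n : ℝ) - K + 1) (ht : t = (sh A).card - (cl K A).card) (ht0 : 0 ≤ t)
    (hgt : ((sh A).card : ℝ) ≤ n * t) :
    ∃ T T₁ T₂ T₃ T₄ T₅ : Finset (Finset (Fin n)), v ∈ T ∧ T₁ ⊆ T ∧ T₂ ⊆ T ∧ T₃ ⊆ T ∧ T₄ ⊆ T ∧
      T₅ ⊆ T ∧ Linked (fun x y => y ∈ ball 8 x) T ∧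
      (((T.card : ℝ) ≤ 12 * t / l ^ 5 + 1 ∧
        A ⊆ decS K (n / l ^ 5) (decF T₁ T₂ T₅) T₃ ∧
        ((decS K (n / l ^ 5) (decF T₁ T₂ T₅) T₃).card : ℝ) ≤ (sh A).card - t / (2 * l ^ 2)) ∨
       ((T.card : ℝ) ≤ 2 * t / l ^ 2 + 1 ∧
        cl K A = (lay n K).filter fun x => dn x ⊆ decF' (n / l ^ 5) (decF T₁ T₂ T₅)
          (decS K (n / l ^ 5) (decF T₁ T₂ T₅) T₃) ∪ T₄)) := by
  classical
  have hl0 : (0 : ℝ) < l := by linarith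
  obtain ⟨m, hnm⟩ : ∃ m : ℝ, (n : ℝ) = m * l ^ 40 := ⟨n / l ^ 40, by field_simp⟩
  have hm : 1 ≤ m := by
    rw [hnm] at hln
    exact le_of_mul_le_mul_right (by linarith) (show 0 < l ^ 40 by positivity)
  have hK2 : m * l ^ 40 / 2 ≤ K := by
    have : (n : ℝ) + 1 ≤ 2 * K := by exact_mod_cast h2K
    linarith
  have hKn' : (K : ℝ) ≤ m * l ^ 40 := by rw [← hnm]; exact_mod_cast hKn
  have heK : (n : ℝ) - K + 1 ≤ K := by
    have : (n : ℝ) + 1 ≤ 2 * K := by exact_mod_cast h2K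
    linarith
  have he' : m * l ^ 38 ≤ (n : ℝ) - K + 1 := by
    refine le_trans (le_of_eq ?_) he
    rw [hnm]; field_simp
  have hψ : (n : ℝ) / l ^ 5 = m * l ^ 35 := by rw [hnm]; field_simp
  have hψe : m * l ^ 35 * 2 ≤ (n : ℝ) - K + 1 := (psi_le hl hm).trans he'
  have hψ0 : 0 < m * l ^ 35 := by positivity
  have hθe : m * l ^ 23 ≤ (n : ℝ) - K + 1 := le_trans (by gcongr <;> [linarith; norm_num]) he'
  rw [hψ]
  obtain ⟨T₁, T₅, hT₁, hT₅, hNB, hT₁c, hT₅c, hH⟩ := exists_first_approx hA hKn h2K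
    (show 0 < m * l ^ 23 by positivity) (show 0 < (m * l ^ 34) ^ 2 by positivity) hθe
  obtain ⟨T₂, T₃, F, S, F', hF, hS, hF', hT₂, hT₂c, hclF, hT₃, hFG, hBS, hF'G, hSB, hT₃c, hGF',
    hKS⟩ := exists_second_approx hA hKn h2K hψ0 (by linarith) hNB
  have hFdec : F = decF T₁ T₂ T₅ := hF
  rw [hnm] at hgt
  rw [← ht] at hH hSB hT₃c hGF'
  have b1 := first_cert_bound hl hm hgt hT₁c
  have b1' : l ^ 5 * (T₁.card : ℝ) ≤ t := le_trans (by
    gcongr; exact le_pow_mul_of_le hl hm (by norm_num)) b1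
  have b5 : l ^ 5 * (T₅.card : ℝ) ≤ t := by
    refine le_trans ?_ b1
    calc l ^ 5 * (T₅.card : ℝ) ≤ l ^ 5 * (m * l ^ 23 * T₁.card) := by gcongr
      _ = _ := by ring
  have bH := uncovered_bound hl hm hK2 hKn' he' ht0 hgt rfl (by rw [← hnm]; exact hH)
  have b2 : l ^ 5 * (T₂.card : ℝ) ≤ 9 * t := by
    have : (m * l ^ 30) * (l ^ 5 * (T₂.card : ℝ)) ≤ (m * l ^ 30) * (9 * t) := by
      calc _ = m * l ^ 35 * T₂.card := by ring
        _ ≤ _ := hT₂c.trans bH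
        _ = _ := by ring
    exact le_of_mul_le_mul_left this (by positivity)
  have b3 : l ^ 5 * (T₃.card : ℝ) ≤ t := by
    have h1 := le_two_mul_of_mul_le hl hm hK2 ht0 hT₃c
    have : 2 * (l ^ 5 * (T₃.card : ℝ)) ≤ m * l ^ 35 * T₃.card := by
      rw [← mul_assoc]
      refine mul_le_mul_of_nonneg_right ?_ (Nat.cast_nonneg _)
      calc 2 * l ^ 5 ≤ l * l ^ 5 := by gcongr; linarith
        _ = l ^ 6 := by ring
        _ ≤ _ := le_pow_mul_of_le hl hm (by norm_num)
    linarith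
  have bS := le_two_mul_of_mul_le hl hm hK2 ht0 hSB
  have bw := missing_bound hl hm hKn' he' ht0 (Nat.cast_nonneg _) hGF'
  have bc := container_bound hl hm hK2 heK ht0 (Nat.cast_nonneg _) bw bS hKS
  have hgf : ((sh A \ F').card : ℝ) = (sh A).card - F'.card := by
    rw [card_sdiff_of_subset hF'G, Nat.cast_sub (card_le_card hF'G)]
  have hψK : m * l ^ 35 ≤ K := by linarith
  -- linkedness of the certificate
  have hlinked : ∀ T₄ ⊆ sh A, Linked (fun x y => y ∈ ball 8 x)
      (insert v (T₁ ∪ T₂ ∪ T₃ ∪ T₄ ∪ T₅)) := by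
    intro T₄ hT₄
    have hshA : ∀ y ∈ sh A, ∃ a ∈ A, a ∈ ball 1 y := fun y hy => by
      obtain ⟨a, ha, hya⟩ := mem_sh.1 hy
      exact ⟨a, ha, mem_ball_symm _ _ (mem_ball_of_mem_dn hya)⟩
    refine linked_of_near (r := 3) hlink ?_ ?_
    · intro a ha
      obtain ⟨z, hz⟩ : (dn a ∩ F).Nonempty := by
        rw [nonempty_iff_ne_empty]
        intro h
        have e := card_sdiff_add_card_inter (dn a) F
        rw [h, card_empty, add_zero, card_dn, mem_lay.1 (hA ha)] at e
        have := hclF a (subset_cl hA ha)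
        rw [e] at this
        linarith
      obtain ⟨w, hw, hzw⟩ := mem_sh.1 (hF ▸ (mem_inter.1 hz).2)
      have haw : w ∈ ball 2 a := ball_trans (mem_ball_of_mem_dn (mem_inter.1 hz).1)
        (mem_ball_symm _ _ (mem_ball_of_mem_dn hzw))
      rcases mem_union.1 hw with hw | hw
      · obtain ⟨y, hy, hwy⟩ := mem_biUnion.1 (mem_sdiff.1 hw).1
        exact ⟨y, by simp [hy], ball_trans haw (mem_ball_of_mem_dn (mem_up_iff.1 hwy))⟩
      · exact ⟨w, by simp [hw], ball_mono (by norm_num) haw⟩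
    · intro s hs
      simp only [mem_insert, mem_union] at hs
      rcases hs with rfl | (((hs | hs) | hs) | hs) | hs
      · exact ⟨s, hv, self_mem_ball _⟩
      · obtain ⟨a, ha, h⟩ := hshA s (hT₁ hs)
        exact ⟨a, ha, ball_mono (by norm_num) h⟩
      · obtain ⟨a, ha, h⟩ := mem_ball_three hFG hψK (mem_cl.1 (hT₂ hs)).1 (hclF s (hT₂ hs))
        exact ⟨a, ha, ball_mono (by norm_num) h⟩
      · obtain ⟨x, hx, hxK, hxF⟩ := hT₃ s hs
        obtain ⟨a, ha, h⟩ := mem_ball_three hFG hψK hxK hxF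
        exact ⟨a, ha, ball_trans (mem_ball_symm _ _ (mem_ball_of_mem_dn (mem_up_iff.1 hx))) h⟩
      · obtain ⟨a, ha, h⟩ := hshA s (hT₄ hs)
        exact ⟨a, ha, ball_mono (by norm_num) h⟩
      · obtain ⟨y, hy, hsy⟩ := mem_biUnion.1 (hT₅ hs)
        obtain ⟨a, ha, h⟩ := hshA y (hT₁ hy)
        exact ⟨a, ha, ball_mono (by norm_num)
          (ball_trans (mem_ball_of_mem_dn (mem_up_iff.1 hsy)) h)⟩
  have hcard : ∀ T₄ : Finset (Finset (Fin n)),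
      ((insert v (T₁ ∪ T₂ ∪ T₃ ∪ T₄ ∪ T₅)).card : ℝ) ≤ 12 * t / l ^ 5 + T₄.card + 1 := by
    intro T₄
    have h1 : (insert v (T₁ ∪ T₂ ∪ T₃ ∪ T₄ ∪ T₅)).card ≤
        T₁.card + T₂.card + T₃.card + T₄.card + T₅.card + 1 := by
      refine (card_insert_le _ _).trans ?_
      have e1 := card_union_le T₁ T₂
      have e2 := card_union_le (T₁ ∪ T₂) T₃
      have e3 := card_union_le (T₁ ∪ T₂ ∪ T₃) T₄
      have e4 := card_union_le (T₁ ∪ T₂ ∪ T₃ ∪ T₄) T₅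
      omega
    have h2 : ((insert v (T₁ ∪ T₂ ∪ T₃ ∪ T₄ ∪ T₅)).card : ℝ) ≤
        T₁.card + T₂.card + T₃.card + T₄.card + T₅.card + 1 := by exact_mod_cast h1
    have h3 : (T₁.card : ℝ) + T₂.card + T₃.card + T₅.card ≤ 12 * t / l ^ 5 := by
      rw [le_div_iff₀ (by positivity)]
      linarith
    linarith
  have hsub : ∀ T₄ : Finset (Finset (Fin n)), ∀ X : Finset (Finset (Fin n)),
      X ⊆ T₁ ∪ T₂ ∪ T₃ ∪ T₄ ∪ T₅ → X ⊆ insert v (T₁ ∪ T₂ ∪ T₃ ∪ T₄ ∪ T₅) :=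
    fun T₄ X hX => hX.trans (subset_insert _ _)
  by_cases hcase : (F'.card : ℝ) ≤ (sh A).card - t / l ^ 2
  · refine ⟨insert v (T₁ ∪ T₂ ∪ T₃ ∪ ∅ ∪ T₅), T₁, T₂, T₃, ∅, T₅, mem_insert_self _ _,
      hsub _ _ ?_, hsub _ _ ?_, hsub _ _ ?_, empty_subset _, hsub _ _ ?_, hlinked ∅ (by simp),
      Or.inl ⟨?_, by rw [← hFdec, ← hS]; exact (subset_cl hA).trans hBS, ?_⟩⟩
    any_goals (intro x hx; simp [hx])
    · simpa using hcard ∅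
    · rw [← hFdec, ← hS]
      have h6 : 6 * t / l ^ 3 ≤ t / (2 * l ^ 2) := six_div_le hl ht0
      have h7 : t / l ^ 2 = 2 * (t / (2 * l ^ 2)) := by field_simp
      linarith
  · push Not at hcase
    refine ⟨insert v (T₁ ∪ T₂ ∪ T₃ ∪ (sh A \ F') ∪ T₅), T₁, T₂, T₃, sh A \ F', T₅,
      mem_insert_self _ _, hsub _ _ ?_, hsub _ _ ?_, hsub _ _ ?_, hsub _ _ ?_, hsub _ _ ?_,
      hlinked _ sdiff_subset, Or.inr ⟨?_, ?_⟩⟩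
    any_goals (intro x hx; simp only [mem_union, hx]; tauto)
    · refine (hcard _).trans ?_
      rw [hgf]
      have : 12 * t / l ^ 5 ≤ t / l ^ 2 := twelve_div_le hl ht0
      have h7 : 2 * t / l ^ 2 = 2 * (t / l ^ 2) := by ring
      linarith
    · rw [← hFdec, ← hS, ← hF', union_sdiff_of_subset hF'G]; rfl

lemma card_linked_ball_le {L : ℕ} (hL : n + 1 ≤ 2 ^ L) (R : ℕ) (v : Finset (Fin n)) (j : ℕ)
    (F : Finset (Finset (Finset (Fin n))))
    (hF : ∀ T ∈ F, Linked (fun x y => y ∈ ball R x) T ∧ v ∈ T ∧ T.card ≤ j) :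
    F.card ≤ 2 ^ (2 * R * L * j) := by
  have h := card_linked_le (nb := fun x => ball R x) (fun u v h => mem_ball_symm _ _ h)
    (fun v => self_mem_ball v) (card_ball_le (n := n) R) v j F hF
  refine h.trans ?_
  calc ((n + 1) ^ R) ^ (2 * j) ≤ ((2 ^ L) ^ R) ^ (2 * j) := by gcongr
    _ = _ := by rw [← pow_mul, ← pow_mul]; congr 1; ring

/-- Few objects can be decoded from small linked certificates through a given vertex. -/
lemma exists_decoded_family {L : ℕ} (hL : n + 1 ≤ 2 ^ L) (hL5 : 5 ≤ L) (v : Finset (Fin n)) (j : ℕ)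
    {δ : Type*} [DecidableEq δ]
    (dec : Finset (Finset (Fin n)) → Finset (Finset (Fin n)) → Finset (Finset (Fin n)) →
      Finset (Finset (Fin n)) → Finset (Finset (Fin n)) → δ) :
    ∃ 𝒮 : Finset δ, 𝒮.card ≤ 2 ^ (17 * L * j) ∧
      ∀ T T₁ T₂ T₃ T₄ T₅ : Finset (Finset (Fin n)), v ∈ T → T₁ ⊆ T → T₂ ⊆ T → T₃ ⊆ T → T₄ ⊆ T →
        T₅ ⊆ T → Linked (fun x y => y ∈ ball 8 x) T → T.card ≤ j → dec T₁ T₂ T₃ T₄ T₅ ∈ 𝒮 := by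
  classical
  set 𝒯 : Finset (Finset (Finset (Fin n))) :=
    univ.filter fun T => Linked (fun x y => y ∈ ball 8 x) T ∧ v ∈ T ∧ T.card ≤ j with h𝒯
  have hcard : 𝒯.card ≤ 2 ^ (2 * 8 * L * j) :=
    card_linked_ball_le hL 8 v j 𝒯 fun T hT => (mem_filter.1 hT).2
  refine ⟨𝒯.biUnion fun T =>
    (T.powerset ×ˢ T.powerset ×ˢ T.powerset ×ˢ T.powerset ×ˢ T.powerset).image
      fun p => dec p.1 p.2.1 p.2.2.1 p.2.2.2.1 p.2.2.2.2, ?_, ?_⟩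
  · calc _ ≤ ∑ T ∈ 𝒯, 2 ^ (5 * j) := by
          refine card_biUnion_le.trans (sum_le_sum fun T hT => card_image_le.trans ?_)
          simp only [card_product, card_powerset]
          calc _ = 2 ^ (5 * T.card) := by ring
            _ ≤ _ := Nat.pow_le_pow_right (by norm_num)
              (Nat.mul_le_mul_left _ (mem_filter.1 hT).2.2.2)
      _ = 𝒯.card * 2 ^ (5 * j) := by rw [sum_const, smul_eq_mul]
      _ ≤ 2 ^ (2 * 8 * L * j) * 2 ^ (5 * j) := by gcongr
      _ = 2 ^ ((16 * L + 5) * j) := by rw [← pow_add]; congr 1; ring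
      _ ≤ _ := Nat.pow_le_pow_right (by norm_num) (Nat.mul_le_mul_right _ (by omega))
  · intro T T₁ T₂ T₃ T₄ T₅ hv h₁ h₂ h₃ h₄ h₅ hl hj
    refine mem_biUnion.2 ⟨T, mem_filter.2 ⟨mem_univ _, hl, hv, hj⟩, mem_image.2
      ⟨(T₁, T₂, T₃, T₄, T₅), by simp [*], rfl⟩⟩

/-- The container lemma for linked sets with prescribed shadow and closure sizes. -/
lemma exists_containers {K L : ℕ} (hL : n + 1 ≤ 2 ^ L) (hL1 : 1000 ≤ L) (hLn : L ^ 40 ≤ n)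
    (hKn : K ≤ n) (h2K : n + 1 ≤ 2 * K) (he : (n : ℝ) / (L : ℝ) ^ 2 ≤ (n : ℝ) - K + 1)
    (v : Finset (Fin n)) {g a : ℕ} (hga : a ≤ g) (hgt : g ≤ n * (g - a)) :
    ∃ 𝒮 : Finset (Finset (Finset (Fin n))),
      (∀ A ⊆ lay n K, Linked adj A → v ∈ A → (sh A).card = g → (cl K A).card = a →
        ∃ S ∈ 𝒮, A ⊆ S) ∧
      (∀ S ∈ 𝒮, S ⊆ lay n K ∧ S.card ≤ g) ∧
      ∑ S ∈ 𝒮, (2 : ℝ) ^ S.card ≤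
        2 * (2 : ℝ) ^ ((g : ℝ) - ((g - a : ℕ) : ℝ) / (4 * L ^ 2) + 17 * L) := by
  classical
  set l : ℝ := (L : ℝ) with hl_def
  have hl : (1000 : ℝ) ≤ l := by rw [hl_def]; exact_mod_cast hL1
  have hl0 : (0 : ℝ) < l := by linarith
  have hln : l ^ 40 ≤ n := by rw [hl_def]; exact_mod_cast hLn
  set t : ℝ := ((g - a : ℕ) : ℝ) with ht
  have ht0 : 0 ≤ t := Nat.cast_nonneg _
  have hta : t = g - a := by rw [ht, Nat.cast_sub hga]
  set j₁ := ⌊12 * t / l ^ 5 + 1⌋₊ with hj₁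
  set j₂ := ⌊2 * t / l ^ 2 + 1⌋₊ with hj₂
  set dec₁ : Finset (Finset (Fin n)) → Finset (Finset (Fin n)) → Finset (Finset (Fin n)) →
      Finset (Finset (Fin n)) → Finset (Finset (Fin n)) → Finset (Finset (Fin n)) :=
    fun T₁ T₂ T₃ _ T₅ => decS K (n / l ^ 5) (decF T₁ T₂ T₅) T₃ with hdec₁
  set dec₂ : Finset (Finset (Fin n)) → Finset (Finset (Fin n)) → Finset (Finset (Fin n)) →
      Finset (Finset (Fin n)) → Finset (Finset (Fin n)) → Finset (Finset (Fin n)) :=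
    fun T₁ T₂ T₃ T₄ T₅ => (lay n K).filter fun x => dn x ⊆ decF' (n / l ^ 5) (decF T₁ T₂ T₅)
          (decS K (n / l ^ 5) (decF T₁ T₂ T₅) T₃) ∪ T₄ with hdec₂
  obtain ⟨𝒮₁, hc₁, hm₁⟩ := exists_decoded_family hL (by omega) v j₁ dec₁
  obtain ⟨𝒮₂, hc₂, hm₂⟩ := exists_decoded_family hL (by omega) v j₂ dec₂
  set 𝒜 := 𝒮₁.filter fun S => S ⊆ lay n K ∧ (S.card : ℝ) ≤ g - t / (2 * l ^ 2) with h𝒜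
  set ℬ := 𝒮₂.filter fun S => S ⊆ lay n K ∧ S.card = a with hℬ
  have hgt' : (g : ℝ) ≤ n * t := by rw [ht]; exact_mod_cast hgt
  have hsum : ∀ (𝒞 : Finset (Finset (Finset (Fin n)))) (j : ℕ) (r s : ℝ),
      𝒞.card ≤ 2 ^ (17 * L * j) →
      (j : ℝ) ≤ r → (∀ S ∈ 𝒞, (S.card : ℝ) ≤ s) → 17 * l * r + s ≤ g - t / (4 * l ^ 2) + 17 * l →
      ∑ S ∈ 𝒞, (2 : ℝ) ^ S.card ≤ (2 : ℝ) ^ ((g : ℝ) - t / (4 * l ^ 2) + 17 * l) := by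
    intro 𝒞 j r s hc hj hS hrs
    have h2 : (0 : ℝ) < 2 := by norm_num
    calc ∑ S ∈ 𝒞, (2 : ℝ) ^ S.card ≤ ∑ S ∈ 𝒞, (2 : ℝ) ^ s := by
          refine sum_le_sum fun S hSC => ?_
          rw [← Real.rpow_natCast]
          exact Real.rpow_le_rpow_of_exponent_le (by norm_num) (hS S hSC)
      _ = 𝒞.card * (2 : ℝ) ^ s := by rw [sum_const, nsmul_eq_mul]
      _ ≤ (2 : ℝ) ^ (17 * l * r) * (2 : ℝ) ^ s := by
          gcongr
          calc (𝒞.card : ℝ) ≤ ((2 ^ (17 * L * j) : ℕ) : ℝ) := by exact_mod_cast hc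
            _ = (2 : ℝ) ^ ((17 * L * j : ℕ) : ℝ) := by rw [Real.rpow_natCast]; push_cast; rfl
            _ ≤ _ := by
                apply Real.rpow_le_rpow_of_exponent_le (by norm_num)
                push_cast
                gcongr
      _ = (2 : ℝ) ^ (17 * l * r + s) := (Real.rpow_add h2 _ _).symm
      _ ≤ _ := Real.rpow_le_rpow_of_exponent_le (by norm_num) hrs
  have hA : ∑ S ∈ 𝒜, (2 : ℝ) ^ S.card ≤ (2 : ℝ) ^ ((g : ℝ) - t / (4 * l ^ 2) + 17 * l) := by
    refine hsum 𝒜 j₁ (12 * t / l ^ 5 + 1) (g - t / (2 * l ^ 2))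
      ((card_le_card (filter_subset _ _)).trans hc₁) (Nat.floor_le (by positivity))
      (fun S hS => (mem_filter.1 hS).2.2) ?_
    have h1 : 17 * l * (12 * t / l ^ 5) = 204 * t / l ^ 4 := by field_simp; ring
    have h2 : 204 * t / l ^ 4 ≤ t / (4 * l ^ 2) := by
      rw [div_le_div_iff₀ (by positivity) (by positivity)]
      calc 204 * t * (4 * l ^ 2) = t * (816 * 1 * l ^ 2) := by ring
        _ ≤ t * (l * l * l ^ 2) := by gcongr <;> linarith
        _ = _ := by ring
    have h3 : t / (2 * l ^ 2) = 2 * (t / (4 * l ^ 2)) := by field_simp; norm_num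
    linarith
  have hB : ∑ S ∈ ℬ, (2 : ℝ) ^ S.card ≤ (2 : ℝ) ^ ((g : ℝ) - t / (4 * l ^ 2) + 17 * l) := by
    refine hsum ℬ j₂ (2 * t / l ^ 2 + 1) (g - t)
      ((card_le_card (filter_subset _ _)).trans hc₂) (Nat.floor_le (by positivity))
      (fun S hS => by rw [(mem_filter.1 hS).2.2]; linarith) ?_
    have h1 : 17 * l * (2 * t / l ^ 2) = 34 * t / l := by field_simp; ring
    have h2 : 34 * t / l ≤ t / 2 := by
      rw [div_le_div_iff₀ (by positivity) (by positivity)]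
      nlinarith
    have h3 : t / (4 * l ^ 2) ≤ t / 2 := by
      apply div_le_div_of_nonneg_left ht0 (by norm_num)
      nlinarith
    linarith
  refine ⟨𝒜 ∪ ℬ, ?_, ?_, ?_⟩
  · intro A hAl hlink hv hg ha
    have htA : t = (sh A).card - (cl K A).card := by rw [hg, ha, hta]
    obtain ⟨T, T₁, T₂, T₃, T₄, T₅, hvT, h₁, h₂, h₃, h₄, h₅, hTl, h | h⟩ :=
      exists_certificate hAl hlink hv hKn h2K hl hln he htA ht0 (by rw [hg]; exact hgt')
    · refine ⟨dec₁ T₁ T₂ T₃ T₄ T₅, mem_union_left _ (mem_filter.2 ⟨?_, ?_, ?_⟩), h.2.1⟩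
      · exact hm₁ T T₁ T₂ T₃ T₄ T₅ hvT h₁ h₂ h₃ h₄ h₅ hTl (Nat.le_floor h.1)
      · exact sdiff_subset.trans (filter_subset _ _)
      · rw [← hg]; exact h.2.2
    · refine ⟨dec₂ T₁ T₂ T₃ T₄ T₅, mem_union_right _ (mem_filter.2 ⟨?_, filter_subset _ _, ?_⟩), ?_⟩
      · exact hm₂ T T₁ T₂ T₃ T₄ T₅ hvT h₁ h₂ h₃ h₄ h₅ hTl (Nat.le_floor h.1)
      · rw [← ha, h.2]
      · exact (subset_cl hAl).trans h.2.subset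
  · intro S hS
    rcases mem_union.1 hS with hS | hS
    · refine ⟨(mem_filter.1 hS).2.1, ?_⟩
      have := (mem_filter.1 hS).2.2
      have h0 : 0 ≤ t / (2 * l ^ 2) := by positivity
      exact_mod_cast (show (S.card : ℝ) ≤ g by linarith)
    · exact ⟨(mem_filter.1 hS).2.1, (mem_filter.1 hS).2.2.le.trans hga⟩
  · have : ∑ S ∈ 𝒜 ∪ ℬ, (2 : ℝ) ^ S.card ≤
        ∑ S ∈ 𝒜, (2 : ℝ) ^ S.card + ∑ S ∈ ℬ, (2 : ℝ) ^ S.card := by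
      rw [← sum_union_inter]
      exact le_add_of_nonneg_right (sum_nonneg fun _ _ => by positivity)
    linarith

/-- The nonempty sets all of whose lower neighbours lie in `C`. -/
def ext (C : Finset (Finset (Fin n))) : Finset (Finset (Fin n)) :=
  univ.filter fun x => x.Nonempty ∧ dn x ⊆ C

lemma mem_ext {C : Finset (Finset (Fin n))} {x : Finset (Fin n)} :
    x ∈ ext C ↔ x.Nonempty ∧ dn x ⊆ C := by simp [ext]

lemma dn_nonempty {x : Finset (Fin n)} (hx : x.Nonempty) : (dn x).Nonempty := hx.image _

lemma ext_mono {C D : Finset (Finset (Fin n))} (h : C ⊆ D) : ext C ⊆ ext D := fun _ hx =>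
  mem_ext.2 ⟨(mem_ext.1 hx).1, (mem_ext.1 hx).2.trans h⟩

lemma sh_subset_of_subset_ext {C U : Finset (Finset (Fin n))} (hU : U ⊆ ext C) : sh U ⊆ C :=
  biUnion_subset.2 fun _ hx => (mem_ext.1 (hU hx)).2

lemma ext_subset_lay {K : ℕ} {C : Finset (Finset (Fin n))} (hC : C ⊆ lay n K) :
    ext C ⊆ lay n (K + 1) := by
  intro x hx
  obtain ⟨y, hy⟩ := dn_nonempty (mem_ext.1 hx).1
  rw [mem_lay, ← card_of_mem_dn hy, mem_lay.1 (hC ((mem_ext.1 hx).2 hy))]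

lemma card_ext_le (C : Finset (Finset (Fin n))) : (ext C).card ≤ n * C.card := by
  have : ext C ⊆ C.biUnion up := by
    intro x hx
    obtain ⟨y, hy⟩ := dn_nonempty (mem_ext.1 hx).1
    exact mem_biUnion.2 ⟨y, (mem_ext.1 hx).2 hy, mem_up_iff.2 hy⟩
  refine (card_le_card this).trans (card_biUnion_le.trans ?_)
  calc ∑ y ∈ C, (up y).card ≤ ∑ y ∈ C, n := sum_le_sum fun y _ => by rw [card_up]; omega
    _ = _ := by rw [sum_const, smul_eq_mul, mul_comm]

lemma disjoint_of_disjoint_sh {C D : Finset (Finset (Fin n))} (hC : ∀ c ∈ C, c.Nonempty)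
    (h : Disjoint (sh C) (sh D)) : Disjoint C D := by
  refine disjoint_left.2 fun c hc hd => ?_
  obtain ⟨y, hy⟩ := dn_nonempty (hC c hc)
  exact disjoint_left.1 h (mem_sh.2 ⟨c, hc, hy⟩) (mem_sh.2 ⟨c, hd, hy⟩)

lemma ext_union {C D : Finset (Finset (Fin n))} (h : Disjoint (sh C) (sh D)) :
    ext (C ∪ D) = ext C ∪ ext D := by
  refine Subset.antisymm (fun x hx => ?_) (union_subset (ext_mono subset_union_left)
    (ext_mono subset_union_right))
  obtain ⟨⟨i, hi⟩, hx⟩ := mem_ext.1 hx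
  have key : ∀ E E' : Finset (Finset (Fin n)), Disjoint (sh E) (sh E') → dn x ⊆ E ∪ E' →
      x.erase i ∈ E → x ∈ ext E := by
    intro E E' hd hx hiE
    refine mem_ext.2 ⟨⟨i, hi⟩, fun y hy => ?_⟩
    obtain ⟨j, hj, rfl⟩ := mem_dn.1 hy
    rcases mem_union.1 (hx hy) with h' | h'
    · exact h'
    · by_cases hij : j = i
      · rwa [hij]
      · refine (disjoint_left.1 hd (mem_sh.2 ⟨_, hiE, mem_dn.2 ⟨j, mem_erase.2 ⟨hij, hj⟩, rfl⟩⟩)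
          (mem_sh.2 ⟨_, h', mem_dn.2 ⟨i, mem_erase.2 ⟨Ne.symm hij, hi⟩, ?_⟩⟩)).elim
        exact erase_right_comm
  rcases mem_union.1 (hx (mem_dn.2 ⟨i, hi, rfl⟩)) with hmem | hmem
  · exact mem_union_left _ (key C D h hx hmem)
  · exact mem_union_right _ (key D C h.symm (by rwa [union_comm]) hmem)

/-- The number of chains `C ⊇ sh U₁`, `U₁ ⊇ sh U₂`, … of length `j` above `C`. -/
def cnt : ℕ → Finset (Finset (Fin n)) → ℕ
  | 0, _ => 1
  | j + 1, C => ∑ U ∈ (ext C).powerset, cnt j U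

lemma sum_powerset_union {β : Type*} [DecidableEq β] {E E' : Finset β} (h : Disjoint E E')
    (f : Finset β → ℕ) :
    ∑ U ∈ (E ∪ E').powerset, f U = ∑ p ∈ E.powerset ×ˢ E'.powerset, f (p.1 ∪ p.2) := by
  refine sum_nbij' (fun U => (U ∩ E, U ∩ E')) (fun p => p.1 ∪ p.2) ?_ ?_ ?_ ?_ ?_
  · intro U _; simp
  · intro p hp
    simp only [mem_product, mem_powerset] at hp ⊢
    exact union_subset_union hp.1 hp.2
  · intro U hU
    rw [← inter_union_distrib_left, inter_eq_left.2 (mem_powerset.1 hU)]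
  · rintro ⟨p, q⟩ hp
    simp only [mem_product, mem_powerset] at hp
    simp only [union_inter_distrib_right, Prod.mk.injEq]
    rw [inter_eq_left.2 hp.1, inter_eq_left.2 hp.2,
      disjoint_iff_inter_eq_empty.1 (h.symm.mono_left hp.2),
      disjoint_iff_inter_eq_empty.1 (h.mono_left hp.1)]
    simp
  · intro U hU
    rw [← inter_union_distrib_left, inter_eq_left.2 (mem_powerset.1 hU)]

lemma cnt_union_le (j : ℕ) : ∀ {C D : Finset (Finset (Fin n))}, (∀ c ∈ C, c.Nonempty) →
    Disjoint (sh C) (sh D) → cnt j (C ∪ D) ≤ cnt j C * cnt j D := by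
  induction j with
  | zero => intros; simp [cnt]
  | succ j ih =>
    intro C D hC h
    have hCD := disjoint_of_disjoint_sh hC h
    have hne : ∀ {X : Finset (Finset (Fin n))}, ∀ c ∈ ext X, c.Nonempty := fun c hc =>
      (mem_ext.1 hc).1
    have hE : Disjoint (ext C) (ext D) := disjoint_of_disjoint_sh hne
      (hCD.mono (sh_subset_of_subset_ext subset_rfl) (sh_subset_of_subset_ext subset_rfl))
    rw [cnt, cnt, cnt, ext_union h, sum_powerset_union hE, sum_mul_sum, ← sum_product']
    refine sum_le_sum fun p hp => ?_
    simp only [mem_product, mem_powerset] at hp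
    exact ih (fun c hc => hne c (hp.1 hc))
      (hCD.mono (sh_subset_of_subset_ext hp.1) (sh_subset_of_subset_ext hp.2))

/-- Under twofold expansion of small families, the chain count is at most `2 ^ |C|`. -/
lemma cnt_le_two_pow {K₀ N : ℕ}
    (hexp : ∀ K, K₀ ≤ K → ∀ U ⊆ lay n K, U.card ≤ N → 2 * U.card ≤ (sh U).card) (j : ℕ) :
    ∀ {K : ℕ} {C : Finset (Finset (Fin n))}, K₀ ≤ K → C ⊆ lay n K → C.card ≤ N →
      cnt j C ≤ 2 ^ C.card := by
  induction j with
  | zero => intros; simp [cnt, Nat.one_le_two_pow]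
  | succ j ih =>
    intro K C hK hC hN
    have hsmall : ∀ U ⊆ ext C, U.card ≤ N → 2 * U.card ≤ C.card := fun U hU hUN =>
      (hexp (K + 1) (by omega) U (hU.trans (ext_subset_lay hC)) hUN).trans
        (card_le_card (sh_subset_of_subset_ext hU))
    have hext : 2 * (ext C).card ≤ C.card := by
      by_cases hE : (ext C).card ≤ N
      · exact hsmall _ subset_rfl hE
      · have hC0 : C.card ≠ 0 := by
          intro h0
          have : ext C = ∅ := by
            by_contra hne
            obtain ⟨x, hx⟩ := nonempty_iff_ne_empty.2 hne
            obtain ⟨y, hy⟩ := dn_nonempty (mem_ext.1 hx).1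
            have := (mem_ext.1 hx).2 hy
            rw [card_eq_zero.1 h0] at this
            simp at this
          simp [this] at hE
        obtain ⟨U, hU, hUN⟩ := exists_subset_card_eq (show N ≤ (ext C).card by omega)
        have := hsmall U hU hUN.le
        omega
    rw [cnt]
    calc ∑ U ∈ (ext C).powerset, cnt j U ≤ ∑ U ∈ (ext C).powerset, 2 ^ (ext C).card := by
          refine sum_le_sum fun U hU => ?_
          have hU' := mem_powerset.1 hU
          have hUc := card_le_card hU'
          exact (ih (by omega) (hU'.trans (ext_subset_lay hC)) (by omega)).trans
            (Nat.pow_le_pow_right (by norm_num) hUc)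
      _ = 2 ^ (2 * (ext C).card) := by
          rw [sum_const, card_powerset, smul_eq_mul, ← pow_add]; congr 1; ring
      _ ≤ _ := Nat.pow_le_pow_right (by norm_num) hext

/-- The weight of a family in layer `K`. -/
noncomputable def wt (K : ℕ) (C : Finset (Finset (Fin n))) : ℝ :=
  cnt (n - K) C / 2 ^ (sh C).card

lemma wt_nonneg (K : ℕ) (C : Finset (Finset (Fin n))) : 0 ≤ wt K C := by
  unfold wt; positivity

lemma cnt_empty (j : ℕ) : cnt j (∅ : Finset (Finset (Fin n))) = 1 := by
  induction j with
  | zero => rfl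
  | succ j ih =>
    have : ext (∅ : Finset (Finset (Fin n))) = ∅ := by
      have := card_ext_le (∅ : Finset (Finset (Fin n)))
      simpa using this
    rw [cnt, this]
    simpa using ih

lemma wt_empty (K : ℕ) : wt K (∅ : Finset (Finset (Fin n))) = 1 := by
  simp [wt, cnt_empty, sh]

lemma wt_union_le {K : ℕ} {C D : Finset (Finset (Fin n))} (hC : ∀ c ∈ C, c.Nonempty)
    (h : Disjoint (sh C) (sh D)) : wt K (C ∪ D) ≤ wt K C * wt K D := by
  rw [wt, wt, wt, sh_union, card_union_of_disjoint h, div_mul_div_comm, ← pow_add]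
  gcongr
  exact_mod_cast cnt_union_le (n - K) hC h

open Classical in
/-- The linked families in layer `K` through a given vertex. -/
noncomputable def linkedAt (K : ℕ) (v : Finset (Fin n)) : Finset (Finset (Finset (Fin n))) :=
  (lay n K).powerset.filter fun C => Linked adj C ∧ v ∈ C

/-- The total weight of all subfamilies, bounded through linked components. -/
lemma sum_wt_le {K : ℕ} (hK : 1 ≤ K) {δ : ℝ} (hδ : 0 ≤ δ)
    (hP : ∀ v ∈ lay n K, ∑ C ∈ linkedAt K v, wt K C ≤ δ) (S : Finset (Finset (Fin n)))
    (hS : S ⊆ lay n K) : ∑ C ∈ S.powerset, wt K C ≤ (1 + δ) ^ S.card := by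
  classical
  induction S using Finset.induction_on with
  | empty => simp [wt_empty]
  | insert v S hv ih =>
    have ih := ih ((subset_insert _ _).trans hS)
    have hvl := hS (mem_insert_self v S)
    have hne : ∀ c ∈ lay n K, c.Nonempty := fun c hc => by
      rw [← card_pos, mem_lay.1 hc]; exact hK
    have hcomp : ∀ C ∈ ((insert v S).powerset.filter fun C => v ∈ C), ∃ C₀ ⊆ C, v ∈ C₀ ∧
        Linked adj C₀ ∧ ∀ c ∈ C₀, ∀ z ∈ C \ C₀, ¬ adj c z := fun C hC =>
      exists_component adj_symm (mem_filter.1 hC).2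
    choose! c₀ hc₀ using hcomp
    have hsplit : ∑ C ∈ (insert v S).powerset, wt K C =
        ∑ C ∈ S.powerset, wt K C + ∑ C ∈ (insert v S).powerset.filter (fun C => v ∈ C), wt K C := by
      rw [← sum_filter_not_add_sum_filter _ (fun C => v ∈ C)]
      congr 1
      refine sum_congr ?_ fun _ _ => rfl
      ext C
      simp only [mem_filter, mem_powerset]
      constructor
      · rintro ⟨h1, h2⟩
        exact (subset_insert_iff_of_notMem h2).1 h1
      · intro h
        exact ⟨h.trans (subset_insert _ _), fun h' => hv (h h')⟩
    have hsecond : ∑ C ∈ (insert v S).powerset.filter (fun C => v ∈ C), wt K C ≤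
        ∑ p ∈ linkedAt K v ×ˢ S.powerset, wt K p.1 * wt K p.2 := by
      calc _ ≤ ∑ C ∈ (insert v S).powerset.filter (fun C => v ∈ C),
            wt K (c₀ C) * wt K (C \ c₀ C) := by
            refine sum_le_sum fun C hC => ?_
            obtain ⟨h1, h2, h3, h4⟩ := hc₀ C hC
            have hCl := (mem_powerset.1 (mem_filter.1 hC).1).trans hS
            conv_lhs => rw [← union_sdiff_of_subset h1]
            refine wt_union_le (fun c hc => hne c (hCl (h1 hc))) ?_
            refine disjoint_left.2 fun y hy hy' => ?_
            obtain ⟨x, hx, hyx⟩ := mem_sh.1 hy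
            obtain ⟨x', hx', hyx'⟩ := mem_sh.1 hy'
            exact h4 x hx x' hx' (not_disjoint_iff.2 ⟨y, hyx, hyx'⟩)
        _ = ∑ p ∈ ((insert v S).powerset.filter (fun C => v ∈ C)).image
              (fun C => (c₀ C, C \ c₀ C)), wt K p.1 * wt K p.2 := by
            rw [sum_image]
            intro C hC D hD hCD
            simp only [Prod.mk.injEq] at hCD
            rw [← union_sdiff_of_subset (hc₀ C hC).1, ← union_sdiff_of_subset (hc₀ D hD).1,
              hCD.2, hCD.1]
        _ ≤ _ := by
            refine sum_le_sum_of_subset_of_nonneg ?_ fun p _ _ =>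
              mul_nonneg (wt_nonneg _ _) (wt_nonneg _ _)
            intro p hp
            obtain ⟨C, hC, rfl⟩ := mem_image.1 hp
            obtain ⟨h1, h2, h3, h4⟩ := hc₀ C hC
            have hCl := mem_powerset.1 (mem_filter.1 hC).1
            refine mem_product.2 ⟨mem_filter.2 ⟨mem_powerset.2 (h1.trans (hCl.trans hS)), h3, h2⟩,
              mem_powerset.2 fun x hx => ?_⟩
            obtain ⟨hx1, hx2⟩ := mem_sdiff.1 hx
            rcases mem_insert.1 (hCl hx1) with rfl | h
            · exact (hx2 h2).elim
            · exact h
    rw [hsplit, card_insert_of_notMem hv, pow_succ]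
    rw [sum_product, ← sum_mul_sum] at hsecond
    have hT0 : 0 ≤ ∑ C ∈ S.powerset, wt K C := sum_nonneg fun C _ => wt_nonneg _ _
    calc _ ≤ ∑ C ∈ S.powerset, wt K C + δ * ∑ C ∈ S.powerset, wt K C := by
          refine add_le_add le_rfl (hsecond.trans ?_)
          exact mul_le_mul_of_nonneg_right (hP v hvl) hT0
      _ = (∑ C ∈ S.powerset, wt K C) * (1 + δ) := by ring
      _ ≤ _ := by gcongr

lemma card_filter_between {β : Type*} [DecidableEq β] {Q S : Finset β} (h : Q ⊆ S) :
    (S.powerset.filter fun C => Q ⊆ C).card = 2 ^ (S.card - Q.card) := by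
  have : (S.powerset.filter fun C => Q ⊆ C) = Finset.Icc Q S := by
    ext C; simp [Finset.mem_Icc, and_comm]
  rw [this, card_Icc_finset h]

/-- The total chain count over subfamilies of `S`. -/
lemma sum_cnt_le {K : ℕ} (hKn : K ≤ n) {δ : ℝ} (hδ : 0 ≤ δ)
    (hP : ∀ v ∈ lay n (K + 1), ∑ C ∈ linkedAt (K + 1) v, wt (K + 1) C ≤ δ)
    {S : Finset (Finset (Fin n))} (hS : S ⊆ lay n K) :
    ∑ C ∈ S.powerset, (cnt (n - K) C : ℝ) ≤ 2 ^ S.card * (1 + δ) ^ (n * S.card) := by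
  classical
  rcases hKn.eq_or_lt with rfl | hlt
  · simp only [Nat.sub_self, cnt, Nat.cast_one, sum_const, card_powerset, nsmul_eq_mul, mul_one]
    push_cast
    exact le_mul_of_one_le_right (by positivity) (one_le_pow₀ (by linarith))
  obtain ⟨j, hj⟩ : ∃ j, n - K = j + 1 := ⟨n - K - 1, by omega⟩
  have hj' : n - (K + 1) = j := by omega
  have h1 : ∑ C ∈ S.powerset, (cnt (n - K) C : ℝ) =
      ∑ U ∈ (ext S).powerset, ∑ C ∈ S.powerset.filter (fun C => sh U ⊆ C), (cnt j U : ℝ) := by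
    rw [hj]
    simp only [cnt, Nat.cast_sum]
    refine sum_comm' fun C U => ?_
    simp only [mem_powerset, mem_filter]
    constructor
    · rintro ⟨hC, hU⟩
      exact ⟨⟨hC, sh_subset_of_subset_ext hU⟩, hU.trans (ext_mono hC)⟩
    · rintro ⟨⟨hC, hUC⟩, hU⟩
      exact ⟨hC, fun x hx => mem_ext.2 ⟨(mem_ext.1 (hU hx)).1, (dn_subset_sh hx).trans hUC⟩⟩
  have h2 : ∀ U ∈ (ext S).powerset, ∑ C ∈ S.powerset.filter (fun C => sh U ⊆ C), (cnt j U : ℝ) =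
      2 ^ S.card * wt (K + 1) U := by
    intro U hU
    have hsub := sh_subset_of_subset_ext (mem_powerset.1 hU)
    rw [sum_const, card_filter_between hsub, nsmul_eq_mul, wt, hj']
    push_cast
    rw [pow_sub₀ _ (by norm_num) (card_le_card hsub)]
    field_simp
  rw [h1, sum_congr rfl h2, ← mul_sum]
  gcongr
  refine (sum_wt_le (by omega) hδ hP _ (ext_subset_lay hS)).trans ?_
  exact pow_le_pow_right₀ (by linarith) (card_ext_le S)

/-- Edge-isoperimetry in the cube: a set of at most `2 ^ s` vertices spans at most `s` times as many
edges as vertices. -/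
lemma sum_dn_inter_self_le (X : Finset (Finset (Fin n))) : ∀ s : ℕ, X.card ≤ 2 ^ s →
    ∑ x ∈ X, (dn x ∩ X).card ≤ s * X.card := by
  induction X using Finset.strongInduction with
  | H X ih =>
  intro s hs
  by_cases h1 : X.card ≤ 1
  · have : ∑ x ∈ X, (dn x ∩ X).card = 0 := by
      refine sum_eq_zero fun x hx => ?_
      rw [card_eq_zero, eq_empty_iff_forall_notMem]
      intro y hy
      have hyx : y = x := card_le_one.1 h1 y (mem_inter.1 hy).2 x hx
      have := card_of_mem_dn (mem_inter.1 hy).1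
      rw [hyx] at this
      omega
    omega
  · obtain ⟨a, ha, b, hb, hab⟩ := one_lt_card.1 (not_le.1 h1)
    obtain ⟨i, hi⟩ : ∃ i, ¬ (i ∈ a ↔ i ∈ b) := by
      by_contra! h
      exact hab (Finset.ext h)
    obtain ⟨s, rfl⟩ : ∃ r, s = r + 1 := ⟨s - 1, by
      rcases s with _ | s
      · simp at hs; omega
      · rfl⟩
    set X₀ := X.filter fun x => i ∉ x with hX₀
    set X₁ := X.filter fun x => i ∈ x with hX₁
    have hne : X₀.Nonempty ∧ X₁.Nonempty := by
      by_cases hia : i ∈ a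
      · have hib : i ∉ b := fun h => hi ⟨fun _ => h, fun _ => hia⟩
        exact ⟨⟨b, mem_filter.2 ⟨hb, hib⟩⟩, ⟨a, mem_filter.2 ⟨ha, hia⟩⟩⟩
      · have hib : i ∈ b := by
          by_contra h
          exact hi ⟨fun h' => (hia h').elim, fun h' => (h h').elim⟩
        exact ⟨⟨a, mem_filter.2 ⟨ha, hia⟩⟩, ⟨b, mem_filter.2 ⟨hb, hib⟩⟩⟩
    have hcard : X₁.card + X₀.card = X.card := card_filter_add_card_filter_not _
    have h0 := card_pos.2 hne.1
    have h1 := card_pos.2 hne.2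
    have hss₀ : X₀ ⊂ X := (filter_subset _ _).ssubset_of_ne fun h => by
      have : X₀.card = X.card := congrArg card h
      omega
    have hss₁ : X₁ ⊂ X := (filter_subset _ _).ssubset_of_ne fun h => by
      have : X₁.card = X.card := congrArg card h
      omega
    set cross := X₁.filter fun x => x.erase i ∈ X₀ with hcross
    have hc1 : cross.card ≤ X₁.card := card_le_card (filter_subset _ _)
    have hc0 : cross.card ≤ X₀.card := by
      refine card_le_card_of_injOn (fun x => x.erase i) (fun x hx => (mem_filter.1 hx).2) ?_
      intro x hx y hy hxy
      have h1 := (mem_filter.1 (mem_filter.1 hx).1).2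
      have h2 := (mem_filter.1 (mem_filter.1 hy).1).2
      rw [← insert_erase h1, ← insert_erase h2]
      exact congrArg (insert i) hxy
    have hsum : ∑ x ∈ X, (dn x ∩ X).card ≤
        ∑ x ∈ X₁, (dn x ∩ X₁).card + cross.card + ∑ x ∈ X₀, (dn x ∩ X₀).card := by
      rw [← sum_filter_add_sum_filter_not X fun x => i ∈ x]
      refine add_le_add ?_ ?_
      · rw [hcross, card_filter, ← sum_add_distrib]
        refine sum_le_sum fun x hx => ?_
        have hsub : dn x ∩ X ⊆ (dn x ∩ X₁) ∪ (if x.erase i ∈ X₀ then {x.erase i} else ∅) := by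
          intro y hy
          obtain ⟨hyx, hyX⟩ := mem_inter.1 hy
          by_cases hiy : i ∈ y
          · exact mem_union_left _ (mem_inter.2 ⟨hyx, mem_filter.2 ⟨hyX, hiy⟩⟩)
          · obtain ⟨k, hk, rfl⟩ := mem_dn.1 hyx
            have hki : k = i := by
              by_contra hne
              exact hiy (mem_erase.2 ⟨Ne.symm hne, (mem_filter.1 hx).2⟩)
            subst hki
            have : x.erase k ∈ X₀ := mem_filter.2 ⟨hyX, hiy⟩
            simp [this]
        refine (card_le_card hsub).trans ((card_union_le _ _).trans (Nat.add_le_add_left ?_ _))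
        split_ifs <;> simp
      · refine sum_le_sum fun x hx => card_le_card fun y hy => ?_
        obtain ⟨hyx, hyX⟩ := mem_inter.1 hy
        exact mem_inter.2 ⟨hyx, mem_filter.2 ⟨hyX, fun h =>
          (mem_filter.1 hx).2 (subset_of_mem_dn hyx h)⟩⟩
    rw [pow_succ] at hs
    rcases le_total X₀.card X₁.card with h | h
    · have e0 := ih X₀ hss₀ s (by omega)
      have e1 := ih X₁ hss₁ (s + 1) (by rw [pow_succ]; omega)
      nlinarith
    · have e0 := ih X₀ hss₀ (s + 1) (by rw [pow_succ]; omega)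
      have e1 := ih X₁ hss₁ s (by omega)
      nlinarith

/-- Small families expand by a large factor. -/
lemma small_expansion {K s : ℕ} {U : Finset (Finset (Fin n))} (hU : U ⊆ lay n K)
    (hs : U.card + (sh U).card ≤ 2 ^ s) : K * U.card ≤ s * (U.card + (sh U).card) := by
  have h1 := sum_dn_inter_self_le (U ∪ sh U) s ((card_union_le _ _).trans hs)
  calc K * U.card = ∑ x ∈ U, (dn x ∩ (U ∪ sh U)).card := by
        rw [mul_comm, ← smul_eq_mul, ← sum_const]
        refine sum_congr rfl fun x hx => ?_
        rw [inter_eq_left.2 ((dn_subset_sh hx).trans subset_union_right), card_dn,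
          mem_lay.1 (hU hx)]
    _ ≤ ∑ x ∈ U ∪ sh U, (dn x ∩ (U ∪ sh U)).card := sum_le_sum_of_subset subset_union_left
    _ ≤ _ := h1.trans (Nat.mul_le_mul_left _ (card_union_le _ _))

lemma card_sh_le {K : ℕ} {U : Finset (Finset (Fin n))} (hU : U ⊆ lay n K) :
    (sh U).card ≤ U.card * K := by
  refine card_biUnion_le.trans (le_of_eq ?_)
  rw [← smul_eq_mul, ← sum_const]
  exact sum_congr rfl fun x hx => by rw [card_dn, mem_lay.1 (hU hx)]

lemma large_bound {L : ℕ} (hL1 : 1000 ≤ L) (hLn : L ^ 40 ≤ n) : 1000000 * L ^ 2 ≤ n := by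
  calc 1000000 * L ^ 2 = (1000 * 1000) * L ^ 2 := by ring
    _ ≤ (L * L) * L ^ 2 := by gcongr
    _ = L ^ 4 := by ring
    _ ≤ L ^ 40 := Nat.pow_le_pow_right (by omega) (by norm_num)
    _ ≤ n := hLn

lemma expansion_of_card_le {K L : ℕ} (hL : n + 1 ≤ 2 ^ L) (hL1 : 1000 ≤ L) (hLn : L ^ 40 ≤ n)
    (h2K : n + 1 ≤ 2 * K) {U : Finset (Finset (Fin n))} (hU : U ⊆ lay n K)
    (hc : U.card ≤ n ^ 3) : 40 * L * U.card ≤ (sh U).card := by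
  rcases U.eq_empty_or_nonempty with rfl | ⟨u, hu⟩
  · simp
  have hKn : K ≤ n := by
    rw [← mem_lay.1 (hU hu)]
    exact (card_le_univ u).trans (by simp)
  have hs : U.card + (sh U).card ≤ 2 ^ (5 * L) := by
    have h1 := card_sh_le hU
    calc U.card + (sh U).card ≤ n ^ 3 + n ^ 3 * n := by
          refine add_le_add hc (h1.trans (Nat.mul_le_mul hc hKn))
      _ ≤ (n + 1) ^ 5 := by nlinarith [sq_nonneg n, pow_pos (show 0 < n + 1 by omega) 3]
      _ ≤ (2 ^ L) ^ 5 := by gcongr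
      _ = _ := by rw [← pow_mul]; congr 1; ring
  have h2 := small_expansion hU hs
  have h3 := large_bound hL1 hLn
  have h4 : 5 * L * (1 + 40 * L) ≤ K := by nlinarith
  have h5 : 5 * L * (1 + 40 * L) * U.card ≤ 5 * L * (U.card + (sh U).card) :=
    (Nat.mul_le_mul_right _ h4).trans h2
  rw [mul_assoc] at h5
  have h6 := Nat.le_of_mul_le_mul_left h5 (by omega)
  nlinarith

lemma expansion_of_high {K L : ℕ} (hL1 : 1000 ≤ L)
    (h2K : n + 1 ≤ 2 * K) (he : (n - K + 1) * L ^ 2 ≤ n)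
    {U : Finset (Finset (Fin n))} (hU : U ⊆ lay n K) : 40 * L * U.card ≤ (sh U).card := by
  have h1 := local_lym hU
  have h2 : (n - K + 1) * (40 * L) ≤ K := by
    have : (n - K + 1) * (80 * L) ≤ n := by
      refine le_trans (Nat.mul_le_mul_left _ ?_) he
      nlinarith
    nlinarith
  have h3 : (n - K + 1) * (40 * L * U.card) ≤ (n - K + 1) * (sh U).card := by
    calc (n - K + 1) * (40 * L * U.card) = U.card * ((n - K + 1) * (40 * L)) := by ring
      _ ≤ U.card * K := Nat.mul_le_mul_left _ h2
      _ ≤ _ := h1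
      _ = _ := mul_comm _ _
  exact Nat.le_of_mul_le_mul_left h3 (by omega)

/-- Linked families of bounded size that expand well have small total weight. -/
lemma sum_wt_small_le {K L N : ℕ} (hL : n + 1 ≤ 2 ^ L) (hL1 : 1 ≤ L)
    (hexp : ∀ K', K ≤ K' → ∀ U ⊆ lay n K', U.card ≤ N → 40 * L * U.card ≤ (sh U).card)
    (v : Finset (Fin n)) {q : ℕ} :
    ∑ C ∈ (linkedAt K v).filter (fun C => q ≤ C.card ∧ C.card ≤ N), wt K C ≤
      2 * (1 / 2 : ℝ) ^ (30 * L * q) := by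
  classical
  have hwt : ∀ C ⊆ lay n K, C.card ≤ N → wt K C ≤ (1 / 2 : ℝ) ^ ((40 * L - 1) * C.card) := by
    intro C hC hN
    have h1 : cnt (n - K) C ≤ 2 ^ C.card :=
      cnt_le_two_pow (K₀ := K) (N := N) (fun K' hK' U hU hUN =>
      (Nat.mul_le_mul_right _ (by omega)).trans (hexp K' hK' U hU hUN)) _ le_rfl hC hN
    have h2 := hexp K le_rfl C hC hN
    have h3 : (40 * L - 1) * C.card + C.card = 40 * L * C.card := by
      rw [← Nat.succ_mul]; congr 1; omega
    rw [wt, one_div, inv_pow, div_le_iff₀ (by positivity), inv_mul_eq_div,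
      le_div_iff₀ (by positivity)]
    calc (cnt (n - K) C : ℝ) * 2 ^ ((40 * L - 1) * C.card)
        ≤ 2 ^ C.card * 2 ^ ((40 * L - 1) * C.card) := by gcongr; exact_mod_cast h1
      _ = 2 ^ (40 * L * C.card) := by rw [← pow_add, ← h3, add_comm]
      _ ≤ _ := pow_le_pow_right₀ (by norm_num) h2
  set 𝓕 := (linkedAt K v).filter (fun C => q ≤ C.card ∧ C.card ≤ N) with h𝓕
  have hmaps : ∀ C ∈ 𝓕, C.card ∈ Ico q (N + 1) := fun C hC => by
    have := (mem_filter.1 hC).2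
    rw [mem_Ico]; omega
  rw [← sum_fiberwise_of_maps_to hmaps]
  have hfib : ∀ j ∈ Ico q (N + 1), ∑ C ∈ 𝓕.filter (fun C => C.card = j), wt K C ≤
      ((1 / 2 : ℝ) ^ (30 * L)) ^ j := by
    intro j _
    have hcount : (𝓕.filter fun C => C.card = j).card ≤ 2 ^ (2 * 2 * L * j) := by
      refine card_linked_ball_le hL 2 v j _ fun C hC => ?_
      obtain ⟨hC1, hC2⟩ := mem_filter.1 hC
      have hC3 := (mem_filter.1 (mem_filter.1 hC1).1).2
      exact ⟨hC3.1.mono fun x y h => mem_ball_of_adj h, hC3.2, hC2.le⟩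
    calc _ ≤ ∑ C ∈ 𝓕.filter (fun C => C.card = j), (1 / 2 : ℝ) ^ ((40 * L - 1) * j) := by
          refine sum_le_sum fun C hC => ?_
          obtain ⟨hC1, hC2⟩ := mem_filter.1 hC
          have hC3 := mem_filter.1 hC1
          rw [← hC2]
          exact hwt C (mem_powerset.1 (mem_filter.1 hC3.1).1) hC3.2.2
      _ ≤ 2 ^ (2 * 2 * L * j) * (1 / 2 : ℝ) ^ ((40 * L - 1) * j) := by
          rw [sum_const, nsmul_eq_mul]
          gcongr
          exact_mod_cast hcount
      _ ≤ 2 ^ (2 * 2 * L * j) * (1 / 2 : ℝ) ^ (2 * 2 * L * j + 30 * L * j) := by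
          gcongr ?_ * ?_
          refine pow_le_pow_of_le_one (by norm_num) (by norm_num) ?_
          rw [← Nat.add_mul]
          exact Nat.mul_le_mul_right _ (by omega)
      _ = _ := by
          rw [pow_add, ← mul_assoc, ← mul_pow, ← pow_mul]
          norm_num
  refine (sum_le_sum hfib).trans ?_
  have hr : (1 / 2 : ℝ) ^ (30 * L) ≤ 1 / 2 := by
    calc (1 / 2 : ℝ) ^ (30 * L) ≤ (1 / 2 : ℝ) ^ 1 :=
          pow_le_pow_of_le_one (by norm_num) (by norm_num) (by omega)
      _ = _ := by norm_num
  refine (geom_sum_Ico_le_of_lt_one (by positivity) (by linarith)).trans ?_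
  rw [← pow_mul, div_le_iff₀ (by linarith)]
  have : (0 : ℝ) ≤ (1 / 2 : ℝ) ^ (30 * L * q) := by positivity
  nlinarith

/-- The shadow of `C` exceeds the closure of `C` by a definite proportion. -/
def Gapped (K : ℕ) (C : Finset (Finset (Fin n))) : Prop :=
  (sh C).card ≤ n * ((sh C).card - (cl K C).card)

lemma gapped_of_mul_le {K k : ℕ} {C : Finset (Finset (Fin n))} (hk : k < K) (hKn : K ≤ n)
    (h : (cl K C).card * K ≤ (sh C).card * k) : Gapped K C := by
  have h1 : (cl K C).card * K + (sh C).card ≤ (sh C).card * K := by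
    calc (cl K C).card * K + (sh C).card ≤ (sh C).card * k + (sh C).card := by omega
      _ = (sh C).card * (k + 1) := by ring
      _ ≤ _ := Nat.mul_le_mul_left _ hk
  calc (sh C).card ≤ (sh C).card * K - (cl K C).card * K := by omega
    _ = K * ((sh C).card - (cl K C).card) := by rw [← Nat.sub_mul, mul_comm]
    _ ≤ _ := Nat.mul_le_mul_right _ hKn

lemma gapped_of_lay {K : ℕ} (h2K : n + 2 ≤ 2 * K) (hKn : K ≤ n) {C : Finset (Finset (Fin n))}
    (hC : C ⊆ lay n K) : Gapped K C := by
  have h := local_lym (cl_subset_lay (K := K) (A := C))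
  rw [sh_cl hC] at h
  exact gapped_of_mul_le (by omega) hKn h

lemma one_add_pow_le {δ : ℝ} (hδ : 0 ≤ δ) (k : ℕ) : (1 + δ) ^ k ≤ (2 : ℝ) ^ (2 * (δ * k)) := by
  have he : Real.exp 1 ≤ 2 ^ (2 : ℝ) := by
    have := Real.exp_one_lt_d9
    norm_num
    linarith
  calc (1 + δ) ^ k ≤ Real.exp δ ^ k := by
        gcongr
        linarith [Real.add_one_le_exp δ]
    _ = Real.exp 1 ^ (δ * k) := by
        rw [← Real.exp_nat_mul, Real.exp_one_rpow, mul_comm]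
    _ ≤ ((2 : ℝ) ^ (2 : ℝ)) ^ (δ * k) := Real.rpow_le_rpow (Real.exp_pos _).le he (by positivity)
    _ = _ := by rw [← Real.rpow_mul (by norm_num)]

/-- The weight of the linked families with prescribed shadow and closure sizes. -/
lemma sum_wt_fiber_le {K L : ℕ} (hL : n + 1 ≤ 2 ^ L) (hL1 : 1000 ≤ L) (hLn : L ^ 40 ≤ n)
    (hKn : K ≤ n) (h2K : n + 1 ≤ 2 * K) (he : (n : ℝ) / (L : ℝ) ^ 2 ≤ (n : ℝ) - K + 1)
    (hP : ∀ v ∈ lay n (K + 1), ∑ C ∈ linkedAt (K + 1) v, wt (K + 1) C ≤ (1 / 2 : ℝ) ^ (8 * L))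
    (v : Finset (Fin n)) {g a : ℕ} (hag : a ≤ g) (hgt : g ≤ n * (g - a)) (hng : n ^ 3 ≤ g)
    {𝓕 : Finset (Finset (Finset (Fin n)))}
    (h𝓕 : ∀ C ∈ 𝓕, C ∈ linkedAt K v ∧ (sh C).card = g ∧ (cl K C).card = a) :
    ∑ C ∈ 𝓕, wt K C ≤ (1 / 2 : ℝ) ^ (6 * n + 4) := by
  classical
  have hn : 1000000 * L ^ 2 ≤ n := large_bound hL1 hLn
  have hLr : (1000 : ℝ) ≤ L := by exact_mod_cast hL1
  have hnr : (1000000 : ℝ) * (L : ℝ) ^ 2 ≤ n := by exact_mod_cast hn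
  have hn0 : (0 : ℝ) < n := by nlinarith
  obtain ⟨𝒮, hcov, hS, hsum⟩ := exists_containers hL hL1 hLn hKn h2K he v hag hgt
  set δ : ℝ := (1 / 2 : ℝ) ^ (8 * L) with hδdef
  have hδ : 0 ≤ δ := by positivity
  set t : ℝ := ((g - a : ℕ) : ℝ) with ht
  have hgt' : (g : ℝ) ≤ n * t := by rw [ht]; exact_mod_cast hgt
  have hng' : (n : ℝ) ^ 3 ≤ g := by exact_mod_cast hng
  have htn : (n : ℝ) ^ 2 ≤ t := by
    have : (n : ℝ) * (n : ℝ) ^ 2 ≤ n * t := by nlinarith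
    exact le_of_mul_le_mul_left this hn0
  have ht0 : 0 ≤ t := le_trans (by positivity) htn
  have hδn : δ * (n : ℝ) ^ 8 ≤ 1 := by
    have h1 : (n : ℝ) ≤ 2 ^ L := by
      have : n ≤ 2 ^ L := by omega
      exact_mod_cast this
    calc δ * (n : ℝ) ^ 8 ≤ δ * ((2 : ℝ) ^ L) ^ 8 := by gcongr
      _ = 1 := by
        rw [hδdef, ← pow_mul, mul_comm L 8, ← mul_pow]; norm_num
  have hcnt : ∑ C ∈ 𝓕, (cnt (n - K) C : ℝ) ≤
      (1 + δ) ^ (n * g) * (2 * (2 : ℝ) ^ ((g : ℝ) - t / (4 * L ^ 2) + 17 * L)) := by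
    calc ∑ C ∈ 𝓕, (cnt (n - K) C : ℝ)
        ≤ ∑ C ∈ 𝓕, ∑ S ∈ 𝒮, (if C ⊆ S then (cnt (n - K) C : ℝ) else 0) := by
          refine sum_le_sum fun C hC => ?_
          obtain ⟨h1, h2, h3⟩ := h𝓕 C hC
          obtain ⟨h4, h5⟩ := mem_filter.1 h1
          obtain ⟨S, hS1, hS2⟩ := hcov C (mem_powerset.1 h4) h5.1 h5.2 h2 h3
          refine le_trans (by simp [hS2]) (single_le_sum (f := fun S =>
            if C ⊆ S then (cnt (n - K) C : ℝ) else 0) (fun S _ => ?_) hS1)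
          split_ifs <;> positivity
      _ = ∑ S ∈ 𝒮, ∑ C ∈ 𝓕, (if C ⊆ S then (cnt (n - K) C : ℝ) else 0) := sum_comm
      _ ≤ ∑ S ∈ 𝒮, (1 + δ) ^ (n * g) * 2 ^ S.card := by
          refine sum_le_sum fun S hS' => ?_
          rw [← sum_filter]
          calc _ ≤ ∑ C ∈ S.powerset, (cnt (n - K) C : ℝ) :=
                sum_le_sum_of_subset_of_nonneg
                  (fun C hC => mem_powerset.2 (mem_filter.1 hC).2) (fun _ _ _ => by positivity)
            _ ≤ 2 ^ S.card * (1 + δ) ^ (n * S.card) := sum_cnt_le hKn hδ hP (hS S hS').1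
            _ ≤ 2 ^ S.card * (1 + δ) ^ (n * g) := by
                gcongr
                · linarith
                · exact (hS S hS').2
            _ = _ := mul_comm _ _
      _ = (1 + δ) ^ (n * g) * ∑ S ∈ 𝒮, (2 : ℝ) ^ S.card := by rw [mul_sum]
      _ ≤ _ := by gcongr
  have hδexp : 2 * (δ * ((n * g : ℕ) : ℝ)) ≤ t / (8 * L ^ 2) := by
    rw [le_div_iff₀ (by positivity)]
    push_cast
    have h1 : δ * (n * g) ≤ δ * (n ^ 2 * t) := by
      refine mul_le_mul_of_nonneg_left ?_ hδ
      nlinarith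
    have h2 : 16 * (L : ℝ) ^ 2 ≤ (n : ℝ) ^ 6 := by
      have : (n : ℝ) ≤ n ^ 6 := le_self_pow₀ (by nlinarith) (by norm_num)
      nlinarith
    calc 2 * (δ * (n * g)) * (8 * (L : ℝ) ^ 2)
        ≤ 2 * (δ * (n ^ 2 * t)) * (8 * (L : ℝ) ^ 2) := by gcongr
      _ = δ * n ^ 2 * t * (16 * (L : ℝ) ^ 2) := by ring
      _ ≤ δ * n ^ 2 * t * n ^ 6 := by gcongr
      _ = δ * n ^ 8 * t := by ring
      _ ≤ 1 * t := by gcongr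
      _ = t := one_mul t
  have hexp : t / (8 * L ^ 2) + (1 + ((g : ℝ) - t / (4 * L ^ 2) + 17 * L)) ≤
      g + -((6 * n + 4 : ℕ) : ℝ) := by
    have h1 : t / (4 * (L : ℝ) ^ 2) = 2 * (t / (8 * L ^ 2)) := by field_simp; ring
    have h2 : 1000 * (n : ℝ) ≤ t / (8 * L ^ 2) := by
      rw [le_div_iff₀ (by positivity)]
      nlinarith
    have h3 : (L : ℝ) ≤ n := by nlinarith
    push_cast
    rw [h1]
    nlinarith
  calc ∑ C ∈ 𝓕, wt K C = (∑ C ∈ 𝓕, (cnt (n - K) C : ℝ)) / 2 ^ g := by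
        rw [sum_div]
        exact sum_congr rfl fun C hC => by rw [wt, (h𝓕 C hC).2.1]
    _ ≤ (1 / 2 : ℝ) ^ (6 * n + 4) := by
      rw [div_le_iff₀ (by positivity)]
      refine hcnt.trans ?_
      calc _ ≤ (2 : ℝ) ^ (t / (8 * L ^ 2)) *
            (2 ^ (1 : ℝ) * (2 : ℝ) ^ ((g : ℝ) - t / (4 * L ^ 2) + 17 * L)) := by
            rw [Real.rpow_one]
            gcongr
            exact (one_add_pow_le hδ _).trans (Real.rpow_le_rpow_of_exponent_le (by norm_num) hδexp)
        _ ≤ (2 : ℝ) ^ ((g : ℝ) + -((6 * n + 4 : ℕ) : ℝ)) := by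
            rw [← Real.rpow_add (by norm_num), ← Real.rpow_add (by norm_num)]
            exact Real.rpow_le_rpow_of_exponent_le (by norm_num) hexp
        _ = _ := by
            rw [Real.rpow_add (by norm_num), Real.rpow_neg (by norm_num), Real.rpow_natCast,
              Real.rpow_natCast, one_div, inv_pow, mul_comm]

lemma card_le_two_pow (C : Finset (Finset (Fin n))) : C.card ≤ 2 ^ n :=
  (card_le_univ C).trans (by simp)

open Classical in
/-- Large linked families with a gap have negligible total weight. -/
lemma sum_wt_large_le {K L : ℕ} (hL : n + 1 ≤ 2 ^ L) (hL1 : 1000 ≤ L) (hLn : L ^ 40 ≤ n)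
    (hKn : K ≤ n) (h2K : n + 1 ≤ 2 * K) (he : (n : ℝ) / (L : ℝ) ^ 2 ≤ (n : ℝ) - K + 1)
    (hP : ∀ v ∈ lay n (K + 1), ∑ C ∈ linkedAt (K + 1) v, wt (K + 1) C ≤ (1 / 2 : ℝ) ^ (8 * L))
    (v : Finset (Fin n)) :
    ∑ C ∈ (linkedAt K v).filter (fun C => n ^ 3 < C.card ∧ Gapped K C), wt K C ≤
      (1 / 2 : ℝ) ^ (4 * n) := by
  set 𝓕 := (linkedAt K v).filter (fun C => n ^ 3 < C.card ∧ Gapped K C) with h𝓕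
  set R := range (2 ^ n + 1) with hR
  have hmaps : ∀ C ∈ 𝓕, ((sh C).card, (cl K C).card) ∈ R ×ˢ R := fun C _ => by
    rw [mem_product, hR, mem_range, mem_range]
    exact ⟨Nat.lt_succ_of_le (card_le_two_pow (sh C)),
      Nat.lt_succ_of_le (card_le_two_pow (cl K C))⟩
  rw [← sum_fiberwise_of_maps_to hmaps]
  calc _ ≤ ∑ p ∈ R ×ˢ R, (1 / 2 : ℝ) ^ (6 * n + 4) := by
        refine sum_le_sum fun p _ => ?_
        rcases (𝓕.filter fun C => ((sh C).card, (cl K C).card) = p).eq_empty_or_nonempty with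
          h | ⟨C, hC⟩
        · rw [h, sum_empty]; positivity
        · obtain ⟨hC1, rfl⟩ := mem_filter.1 hC
          obtain ⟨hC2, hC3, hC4⟩ := mem_filter.1 hC1
          have hCl := mem_powerset.1 (mem_filter.1 hC2).1
          have hcl := card_le_card (subset_cl hCl)
          have hle : (cl K C).card ≤ (sh C).card := by
            by_contra hlt
            have h0 : (sh C).card = 0 := by
              have : (sh C).card - (cl K C).card = 0 := by omega
              rw [Gapped, this] at hC4
              omega
            have h1 := local_lym hCl
            rw [h0] at h1
            have : 0 < C.card * K := Nat.mul_pos (by omega) (by omega)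
            omega
          refine sum_wt_fiber_le hL hL1 hLn hKn h2K he hP v hle hC4 (by omega) fun D hD => ?_
          obtain ⟨hD1, hD2⟩ := mem_filter.1 hD
          exact ⟨(mem_filter.1 hD1).1, congrArg Prod.fst hD2, congrArg Prod.snd hD2⟩
    _ = ((2 : ℝ) ^ n + 1) ^ 2 * (1 / 2 : ℝ) ^ (6 * n + 4) := by
        rw [sum_const, card_product, hR, card_range, nsmul_eq_mul]; push_cast; ring
    _ ≤ ((2 : ℝ) ^ (n + 2)) ^ 2 * (1 / 2 : ℝ) ^ (6 * n + 4) := by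
        gcongr
        rw [pow_add]
        have : (1 : ℝ) ≤ 2 ^ n := one_le_pow₀ (by norm_num)
        linarith
    _ = (1 / 2 : ℝ) ^ (4 * n) := by
        have : 6 * n + 4 = (n + 2) * 2 + 4 * n := by ring
        rw [this, pow_add (1 / 2 : ℝ), ← pow_mul, ← mul_assoc, ← mul_pow]
        norm_num

open Classical in
lemma sum_wt_gapped_le {K L : ℕ} (hL : n + 1 ≤ 2 ^ L) (hL1 : 1000 ≤ L) (hLn : L ^ 40 ≤ n)
    (hKn : K ≤ n) (h2K : n + 1 ≤ 2 * K)
    (hP : ∀ v ∈ lay n (K + 1), ∑ C ∈ linkedAt (K + 1) v, wt (K + 1) C ≤ (1 / 2 : ℝ) ^ (8 * L))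
    (v : Finset (Fin n)) (q : ℕ) :
    ∑ C ∈ (linkedAt K v).filter (fun C => q ≤ C.card ∧ Gapped K C), wt K C ≤
      2 * (1 / 2 : ℝ) ^ (30 * L * q) + (1 / 2 : ℝ) ^ (4 * n) := by
  by_cases he : (n - K + 1) * L ^ 2 ≤ n
  · calc _ ≤ ∑ C ∈ (linkedAt K v).filter (fun C => q ≤ C.card ∧ C.card ≤ 2 ^ n), wt K C := by
          refine sum_le_sum_of_subset_of_nonneg (fun C hC => ?_) fun _ _ _ => wt_nonneg _ _
          obtain ⟨h1, h2⟩ := mem_filter.1 hC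
          exact mem_filter.2 ⟨h1, h2.1, card_le_two_pow C⟩
      _ ≤ 2 * (1 / 2 : ℝ) ^ (30 * L * q) :=
          sum_wt_small_le hL (by omega) (fun K' hK' U hU _ => expansion_of_high hL1 (by omega)
            (le_trans (Nat.mul_le_mul_right _ (by omega)) he) hU) v
      _ ≤ _ := le_add_of_nonneg_right (by positivity)
  · have he' : (n : ℝ) / (L : ℝ) ^ 2 ≤ (n : ℝ) - K + 1 := by
      have hLr : (1000 : ℝ) ≤ L := by exact_mod_cast hL1
      rw [div_le_iff₀ (by positivity)]
      have h1 : n ≤ (n - K + 1) * L ^ 2 := by omega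
      have h2 : ((n - K : ℕ) : ℝ) = (n : ℝ) - K := Nat.cast_sub hKn
      rw [← h2]
      exact_mod_cast h1
    calc _ ≤ ∑ C ∈ (linkedAt K v).filter (fun C => q ≤ C.card ∧ C.card ≤ n ^ 3) ∪
          (linkedAt K v).filter (fun C => n ^ 3 < C.card ∧ Gapped K C), wt K C := by
          refine sum_le_sum_of_subset_of_nonneg (fun C hC => ?_) fun _ _ _ => wt_nonneg _ _
          obtain ⟨h1, h2, h3⟩ := mem_filter.1 hC
          rcases le_or_gt C.card (n ^ 3) with h | h
          · exact mem_union_left _ (mem_filter.2 ⟨h1, h2, h⟩)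
          · exact mem_union_right _ (mem_filter.2 ⟨h1, h, h3⟩)
      _ ≤ _ := by
          rw [← sum_union_inter]
          exact le_add_of_nonneg_right (sum_nonneg fun _ _ => wt_nonneg _ _)
      _ ≤ _ := add_le_add
          (sum_wt_small_le hL (by omega) (fun K' hK' U hU hc =>
            expansion_of_card_le hL hL1 hLn (by omega) hU hc) v)
          (sum_wt_large_le hL hL1 hLn hKn h2K he' hP v)

/-- Above the middle layer the linked families through a point have small total weight. -/
lemma sum_wt_linkedAt_le {L : ℕ} (hL : n + 1 ≤ 2 ^ L) (hL1 : 1000 ≤ L) (hLn : L ^ 40 ≤ n)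
    {K : ℕ} (h2K : n + 2 ≤ 2 * K) (v : Finset (Fin n)) (hv : v ∈ lay n K) :
    ∑ C ∈ linkedAt K v, wt K C ≤ (1 / 2 : ℝ) ^ (8 * L) := by
  classical
  induction h : n - K using Nat.strong_induction_on generalizing K v with
  | _ d ih =>
    have hKn : K ≤ n := by
      rw [← mem_lay.1 hv]
      exact (card_le_univ v).trans (by simp)
    have hP : ∀ w ∈ lay n (K + 1),
        ∑ C ∈ linkedAt (K + 1) w, wt (K + 1) C ≤ (1 / 2 : ℝ) ^ (8 * L) := by
      intro w hw
      have : K + 1 ≤ n := by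
        rw [← mem_lay.1 hw]
        exact (card_le_univ w).trans (by simp)
      exact ih (n - (K + 1)) (by omega) (by omega) w hw rfl
    have hn := large_bound hL1 hLn
    calc ∑ C ∈ linkedAt K v, wt K C
        = ∑ C ∈ (linkedAt K v).filter (fun C => 1 ≤ C.card ∧ Gapped K C), wt K C := by
          rw [filter_true_of_mem fun C hC => ?_]
          obtain ⟨h1, -, h2⟩ := mem_filter.1 hC
          exact ⟨card_pos.2 ⟨v, h2⟩, gapped_of_lay h2K hKn (mem_powerset.1 h1)⟩
      _ ≤ 2 * (1 / 2 : ℝ) ^ (30 * L * 1) + (1 / 2 : ℝ) ^ (4 * n) :=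
          sum_wt_gapped_le hL hL1 hLn hKn (by omega) hP v 1
      _ ≤ 2 * (1 / 2 : ℝ) ^ (8 * L + 2) + (1 / 2 : ℝ) ^ (8 * L + 2) := by
          gcongr 2 * ?_ + ?_
          · exact pow_le_pow_of_le_one (by norm_num) (by norm_num) (by omega)
          · exact pow_le_pow_of_le_one (by norm_num) (by norm_num) (by nlinarith)
      _ ≤ (1 / 2 : ℝ) ^ (8 * L) := by
          rw [pow_add]
          have : (0 : ℝ) ≤ (1 / 2 : ℝ) ^ (8 * L) := by positivity
          linarith

open Classical in
/-- Linked families with a gap and with many members have negligible total weight. -/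
lemma sum_wt_gapped_le_two_pow {K L : ℕ} (hL : n + 1 ≤ 2 ^ L) (hL1 : 1000 ≤ L)
    (hLn : L ^ 40 ≤ n) (hKn : K ≤ n) (h2K : n + 1 ≤ 2 * K) (v : Finset (Fin n)) :
    ∑ C ∈ (linkedAt K v).filter (fun C => K + 1 ≤ C.card ∧ Gapped K C), wt K C ≤
      (1 / 2 : ℝ) ^ (3 * n) := by
  have hn := large_bound hL1 hLn
  calc _ ≤ 2 * (1 / 2 : ℝ) ^ (30 * L * (K + 1)) + (1 / 2 : ℝ) ^ (4 * n) :=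
        sum_wt_gapped_le hL hL1 hLn hKn h2K (fun w hw =>
          sum_wt_linkedAt_le hL hL1 hLn (by omega) w hw) v _
    _ ≤ 2 * (1 / 2 : ℝ) ^ (3 * n + 2) + (1 / 2 : ℝ) ^ (3 * n + 2) := by
        gcongr 2 * ?_ + ?_
        · refine pow_le_pow_of_le_one (by norm_num) (by norm_num) ?_
          nlinarith
        · exact pow_le_pow_of_le_one (by norm_num) (by norm_num) (by nlinarith)
    _ ≤ _ := by
        rw [pow_add]
        have : (0 : ℝ) ≤ (1 / 2 : ℝ) ^ (3 * n) := by positivity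
        linarith

/-- Families in the layers from `K` on that are closed downwards within these layers and meet
layer `K` in `C`. -/
def stack (K : ℕ) (C : Finset (Finset (Fin n))) : Finset (Finset (Finset (Fin n))) :=
  univ.filter fun V => (∀ w ∈ V, K ≤ w.card) ∧ V.filter (fun w => w.card = K) = C ∧
    ∀ w ∈ V, K < w.card → dn w ⊆ V

lemma mem_stack {K : ℕ} {C V : Finset (Finset (Fin n))} :
    V ∈ stack K C ↔ (∀ w ∈ V, K ≤ w.card) ∧ V.filter (fun w => w.card = K) = C ∧
      ∀ w ∈ V, K < w.card → dn w ⊆ V := by simp [stack]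

lemma card_stack_le (j : ℕ) : ∀ {K : ℕ} (C : Finset (Finset (Fin n))), n ≤ K + j →
    (stack K C).card ≤ cnt j C := by
  induction j with
  | zero =>
    intro K C hK
    rw [cnt, card_le_one]
    have key : ∀ V ∈ stack K C, V = C := fun V hV => by
      obtain ⟨h1, h2, -⟩ := mem_stack.1 hV
      rw [← h2, filter_true_of_mem fun w hw => ?_]
      have := h1 w hw
      have : w.card ≤ n := (card_le_univ w).trans (by simp)
      omega
    intro V hV W hW
    rw [key V hV, key W hW]
  | succ j ih =>
    intro K C hK
    rw [cnt]
    refine le_trans ?_ (sum_le_sum fun U _ => ih (K := K + 1) U (by omega))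
    rw [← card_sigma]
    refine card_le_card_of_injOn (fun V => ⟨V.filter (fun w => w.card = K + 1),
      V.filter fun w => K < w.card⟩) (fun V hV => ?_) fun V hV W hW h => ?_
    · obtain ⟨h1, h2, h3⟩ := mem_stack.1 hV
      refine mem_sigma.2 ⟨mem_powerset.2 fun w hw => ?_, mem_stack.2 ⟨fun w hw => ?_, ?_, ?_⟩⟩
      · obtain ⟨hw1, hw2⟩ := mem_filter.1 hw
        refine mem_ext.2 ⟨card_pos.1 (by omega), fun y hy => ?_⟩
        rw [← h2]
        have := card_of_mem_dn hy
        exact mem_filter.2 ⟨h3 w hw1 (by omega) hy, by omega⟩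
      · exact (mem_filter.1 hw).2
      · ext w
        simp only [mem_filter]
        constructor
        · rintro ⟨⟨a, -⟩, b⟩; exact ⟨a, b⟩
        · rintro ⟨a, b⟩; exact ⟨⟨a, by omega⟩, b⟩
      · intro w hw hlt y hy
        have := card_of_mem_dn hy
        exact mem_filter.2 ⟨h3 w (mem_filter.1 hw).1 (by omega) hy, by omega⟩
    · have h' : V.filter (fun w => K < w.card) = W.filter (fun w => K < w.card) :=
        eq_of_heq (Sigma.mk.inj h).2
      have key : ∀ X ∈ stack K C, C ∪ X.filter (fun w => K < w.card) = X := fun X hX => by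
        obtain ⟨h1, h2, -⟩ := mem_stack.1 hX
        rw [← h2]
        ext w
        simp only [mem_union, mem_filter]
        constructor
        · rintro (a | a) <;> exact a.1
        · intro a
          rcases (h1 w a).eq_or_lt with e | e
          · exact Or.inl ⟨a, e.symm⟩
          · exact Or.inr ⟨a, e⟩
      rw [← key V hV, ← key W hW, h']

open Classical in
/-- The upper sets of the Boolean lattice. -/
noncomputable def upp (n : ℕ) : Finset (Finset (Finset (Fin n))) :=
  univ.filter fun 𝓤 => IsUpperSet (𝓤 : Set (Finset (Fin n)))

lemma mem_upp {𝓤 : Finset (Finset (Fin n))} :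
    𝓤 ∈ upp n ↔ IsUpperSet (𝓤 : Set (Finset (Fin n))) := by simp [upp]

lemma mem_of_subset {𝓤 : Finset (Finset (Fin n))} (h : 𝓤 ∈ upp n) {x y : Finset (Fin n)}
    (hxy : x ⊆ y) (hx : x ∈ 𝓤) : y ∈ 𝓤 := mem_upp.1 h hxy hx

lemma mem_upp_of_insert {W : Finset (Finset (Fin n))}
    (h : ∀ x ∈ W, ∀ i ∉ x, insert i x ∈ W) : W ∈ upp n := by
  refine mem_upp.2 fun x y hxy hx => ?_
  have key : ∀ t : Finset (Fin n), x ∪ t ∈ W := fun t => by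
    induction t using Finset.induction_on with
    | empty => simpa using hx
    | insert i t _ ih =>
      rw [union_insert]
      by_cases hi : i ∈ x ∪ t
      · rwa [insert_eq_of_mem hi]
      · exact h _ ih i hi
  have := key y
  rwa [union_eq_right.2 hxy] at this

/-- The members of layer `K` outside `𝓤`. -/
def zer (K : ℕ) (𝓤 : Finset (Finset (Fin n))) : Finset (Finset (Fin n)) := lay n K \ 𝓤

lemma mem_zer {K : ℕ} {𝓤 : Finset (Finset (Fin n))} {x : Finset (Fin n)} :
    x ∈ zer K 𝓤 ↔ x.card = K ∧ x ∉ 𝓤 := by rw [zer, mem_sdiff, mem_lay]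

open Classical in
/-- The upper sets for which `C` is a union of components of the zeros in layer `K`. -/
noncomputable def isolating (K : ℕ) (C : Finset (Finset (Fin n))) :
    Finset (Finset (Finset (Fin n))) :=
  (upp n).filter fun 𝓤 => C ⊆ zer K 𝓤 ∧ ∀ c ∈ C, ∀ z ∈ zer K 𝓤 \ C, ¬ adj c z

lemma mem_isolating {K : ℕ} {C 𝓤 : Finset (Finset (Fin n))} : 𝓤 ∈ isolating K C ↔
    𝓤 ∈ upp n ∧ C ⊆ zer K 𝓤 ∧ ∀ c ∈ C, ∀ z ∈ zer K 𝓤 \ C, ¬ adj c z := by simp [isolating]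

/-- The sets outside `𝓤` all of whose `K`-subsets lie in `C`. -/
def hull (K : ℕ) (C 𝓤 : Finset (Finset (Fin n))) : Finset (Finset (Fin n)) :=
  univ.filter fun w => w ∉ 𝓤 ∧ K ≤ w.card ∧ ∀ z ⊆ w, z.card = K → z ∈ C

lemma mem_hull {K : ℕ} {C 𝓤 : Finset (Finset (Fin n))} {w : Finset (Fin n)} :
    w ∈ hull K C 𝓤 ↔ w ∉ 𝓤 ∧ K ≤ w.card ∧ ∀ z ⊆ w, z.card = K → z ∈ C := by simp [hull]

lemma hull_mem_stack {K : ℕ} {C 𝓤 : Finset (Finset (Fin n))} (h𝓤 : 𝓤 ∈ upp n)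
    (hC : C ⊆ zer K 𝓤) : hull K C 𝓤 ∈ stack K C := by
  refine mem_stack.2 ⟨fun w hw => (mem_hull.1 hw).2.1, ?_, fun w hw hlt y hy => ?_⟩
  · ext c
    rw [mem_filter, mem_hull]
    constructor
    · rintro ⟨⟨-, -, h⟩, hc⟩
      exact h c Subset.rfl hc
    · intro hc
      obtain ⟨h1, h2⟩ := mem_zer.1 (hC hc)
      refine ⟨⟨h2, h1.ge, fun z hz hzc => ?_⟩, h1⟩
      rwa [eq_of_subset_of_card_le hz (by omega)]
  · obtain ⟨h1, -, h3⟩ := mem_hull.1 hw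
    have hyw := subset_of_mem_dn hy
    have := card_of_mem_dn hy
    exact mem_hull.2 ⟨fun h => h1 (mem_of_subset h𝓤 hyw h), by omega,
      fun z hz hzc => h3 z (hz.trans hyw) hzc⟩

lemma mem_dn_insert {x : Finset (Fin n)} {i : Fin n} (hi : i ∉ x) : x ∈ dn (insert i x) :=
  mem_dn.2 ⟨i, mem_insert_self _ _, erase_insert hi⟩

/-- Filling in the hull of an isolated family and part of its shadow keeps an upper set. -/
lemma union_hull_mem_upp {K : ℕ} {C B 𝓤 : Finset (Finset (Fin n))}
    (h𝓤 : 𝓤 ∈ isolating K C) (hB : B ⊆ sh C) : 𝓤 ∪ hull K C 𝓤 ∪ B ∈ upp n := by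
  obtain ⟨hU, hC, hiso⟩ := mem_isolating.1 h𝓤
  have hclosed : ∀ c ∈ C, ∀ z ∈ zer K 𝓤, adj c z → z ∈ C := fun c hc z hz h => by
    by_contra hzC
    exact hiso c hc z (mem_sdiff.2 ⟨hz, hzC⟩) h
  refine mem_upp_of_insert fun x hx i hi => ?_
  by_cases hins : insert i x ∈ 𝓤
  · exact mem_union_left _ (mem_union_left _ hins)
  refine mem_union_left _ (mem_union_right _ (mem_hull.2 ⟨hins, ?_⟩))
  rcases mem_union.1 hx with hx | hx
  · rcases mem_union.1 hx with hx | hx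
    · exact (hins (mem_of_subset hU (subset_insert _ _) hx)).elim
    · obtain ⟨-, h2, h3⟩ := mem_hull.1 hx
      refine ⟨by rw [card_insert_of_notMem hi]; omega, fun z hz hzK => ?_⟩
      by_cases hiz : i ∈ z
      · have hsub : z.erase i ⊆ x := fun j hj => by
          obtain ⟨hj1, hj2⟩ := mem_erase.1 hj
          exact (mem_insert.1 (hz hj2)).resolve_left hj1
        have hcard := card_erase_add_one hiz
        obtain ⟨j, hjx, hj⟩ := exists_mem_notMem_of_card_lt_card
          (s := z.erase i) (t := x) (by omega)
        refine hclosed (insert j (z.erase i)) (h3 _ (insert_subset hjx hsub) ?_) z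
          (mem_zer.2 ⟨hzK, fun h => hins (mem_of_subset hU hz h)⟩) ?_
        · rw [card_insert_of_notMem hj]; omega
        · exact not_disjoint_iff.2 ⟨z.erase i, mem_dn_insert hj, mem_dn.2 ⟨i, hiz, rfl⟩⟩
      · exact h3 z (fun j hj => (mem_insert.1 (hz hj)).resolve_left fun h => hiz (h ▸ hj)) hzK
  · obtain ⟨c, hc, hxc⟩ := mem_sh.1 (hB hx)
    have hcK := (mem_zer.1 (hC hc)).1
    have h1 := card_of_mem_dn hxc
    have h2 : (insert i x).card = K := by rw [card_insert_of_notMem hi]; omega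
    refine ⟨h2.ge, fun z hz hzK => ?_⟩
    rw [eq_of_subset_of_card_le hz (by omega)]
    exact hclosed c hc _ (mem_zer.2 ⟨h2, hins⟩)
      (not_disjoint_iff.2 ⟨x, hxc, mem_dn_insert hi⟩)

lemma card_isolating_mul_le {K : ℕ} (C : Finset (Finset (Fin n))) :
    (isolating K C).card * 2 ^ (sh C).card ≤ cnt (n - K) C * (upp n).card := by
  refine le_trans ?_ (Nat.mul_le_mul_right _ (card_stack_le (n - K) (K := K) C (by omega)))
  rw [← card_powerset, ← card_product, ← card_product]
  have hdisj : ∀ 𝓤 ∈ isolating K C, Disjoint 𝓤 (hull K C 𝓤) ∧ Disjoint 𝓤 (sh C) ∧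
      Disjoint (hull K C 𝓤) (sh C) := fun 𝓤 h𝓤 => by
    obtain ⟨hU, hC, -⟩ := mem_isolating.1 h𝓤
    refine ⟨disjoint_left.2 fun x hx hx' => (mem_hull.1 hx').1 hx,
      disjoint_left.2 fun x hx hx' => ?_, disjoint_left.2 fun x hx hx' => ?_⟩
    · obtain ⟨c, hc, hxc⟩ := mem_sh.1 hx'
      exact (mem_zer.1 (hC hc)).2 (mem_of_subset hU (subset_of_mem_dn hxc) hx)
    · obtain ⟨c, hc, hxc⟩ := mem_sh.1 hx'
      have h1 := (mem_zer.1 (hC hc)).1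
      have h2 := card_of_mem_dn hxc
      have h3 := (mem_hull.1 hx).2.1
      omega
  refine card_le_card_of_injOn (fun p => (hull K C p.1, p.1 ∪ hull K C p.1 ∪ p.2))
    (fun p hp => ?_) fun p hp p' hp' h => ?_
  · obtain ⟨h1, h2⟩ := mem_product.1 hp
    obtain ⟨hU, hC, -⟩ := mem_isolating.1 h1
    exact mem_product.2 ⟨hull_mem_stack hU hC, union_hull_mem_upp h1 (mem_powerset.1 h2)⟩
  · have key : ∀ q ∈ isolating K C ×ˢ (sh C).powerset,
        (q.1 ∪ hull K C q.1 ∪ q.2) \ (hull K C q.1 ∪ sh C) = q.1 ∧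
        (q.1 ∪ hull K C q.1 ∪ q.2) ∩ sh C = q.2 := fun q hq => by
      obtain ⟨h1, h2⟩ := mem_product.1 hq
      obtain ⟨d1, d2, d3⟩ := hdisj _ h1
      have h2 := mem_powerset.1 h2
      constructor
      · rw [union_assoc, union_sdiff_distrib, sdiff_eq_self_of_disjoint
          (disjoint_union_right.2 ⟨d1, d2⟩), sdiff_eq_empty_iff_subset.2
          (union_subset_union_right h2), union_empty]
      · rw [union_inter_distrib_right, union_inter_distrib_right, disjoint_iff_inter_eq_empty.1 d2,
          disjoint_iff_inter_eq_empty.1 d3, union_empty, empty_union, inter_eq_left.2 h2]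
    obtain ⟨e1, e2⟩ := Prod.mk.inj h
    have k1 := key p hp
    have k2 := key p' hp'
    rw [e2, e1] at k1
    exact Prod.ext (k1.1.symm.trans k2.1) (k1.2.symm.trans k2.2)

open Classical in
/-- The upper sets whose zeros in layer `K` are gapped and contain all the lower neighbours of
some set. -/
noncomputable def clogged (n K : ℕ) : Finset (Finset (Finset (Fin n))) :=
  (upp n).filter fun 𝓤 => (∃ x ∈ lay n (K + 1), dn x ⊆ zer K 𝓤) ∧ ∀ C ⊆ zer K 𝓤, Gapped K C

lemma mem_clogged {K : ℕ} {𝓤 : Finset (Finset (Fin n))} : 𝓤 ∈ clogged n K ↔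
    𝓤 ∈ upp n ∧ (∃ x ∈ lay n (K + 1), dn x ⊆ zer K 𝓤) ∧ ∀ C ⊆ zer K 𝓤, Gapped K C := by
  simp [clogged]

lemma mem_linkedAt {K : ℕ} {v : Finset (Fin n)} {C : Finset (Finset (Fin n))} :
    C ∈ linkedAt K v ↔ C ⊆ lay n K ∧ Linked adj C ∧ v ∈ C := by simp [linkedAt]

lemma exists_isolating_of_mem_clogged {K : ℕ} {𝓤 : Finset (Finset (Fin n))}
    (h : 𝓤 ∈ clogged n K) : ∃ v ∈ lay n K, ∃ C ∈ linkedAt K v,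
      (K + 1 ≤ C.card ∧ Gapped K C) ∧ 𝓤 ∈ isolating K C := by
  obtain ⟨hU, ⟨x, hx, hxZ⟩, hgap⟩ := mem_clogged.1 h
  have hxK := mem_lay.1 hx
  obtain ⟨i, hi⟩ := card_pos.1 (show 0 < x.card by omega)
  have hv : x.erase i ∈ dn x := mem_dn.2 ⟨i, hi, rfl⟩
  obtain ⟨C, hCZ, hvC, hlink, hiso⟩ := exists_component adj_symm (hxZ hv)
  have hCl : C ⊆ lay n K := hCZ.trans sdiff_subset
  have hdn : dn x ⊆ C := fun y hy => by
    by_contra hyC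
    refine hiso _ hvC y (mem_sdiff.2 ⟨hxZ hy, hyC⟩) ?_
    obtain ⟨j, hj, rfl⟩ := mem_dn.1 hy
    have hij : i ≠ j := fun e => hyC (e ▸ hvC)
    exact not_disjoint_iff.2 ⟨(x.erase i).erase j, mem_dn.2 ⟨j, mem_erase.2 ⟨hij.symm, hj⟩, rfl⟩,
      mem_dn.2 ⟨i, mem_erase.2 ⟨hij, hi⟩, erase_right_comm⟩⟩
  refine ⟨x.erase i, hCl hvC, C, mem_linkedAt.2 ⟨hCl, hlink, hvC⟩,
    ⟨?_, hgap C hCZ⟩, mem_isolating.2 ⟨hU, hCZ, hiso⟩⟩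
  rw [← hxK, ← card_dn]
  exact card_le_card hdn

/-- Few upper sets are clogged. -/
lemma card_clogged_le {K L : ℕ} (hL : n + 1 ≤ 2 ^ L) (hL1 : 1000 ≤ L) (hLn : L ^ 40 ≤ n)
    (hKn : K ≤ n) (h2K : n + 1 ≤ 2 * K) :
    ((clogged n K).card : ℝ) ≤ (1 / 2 : ℝ) ^ n * (upp n).card := by
  classical
  have hsub : clogged n K ⊆ (lay n K).biUnion fun v =>
      ((linkedAt K v).filter fun C => K + 1 ≤ C.card ∧ Gapped K C).biUnion (isolating K) := by
    intro 𝓤 h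
    obtain ⟨v, hv, C, hC, hC', hU⟩ := exists_isolating_of_mem_clogged h
    exact mem_biUnion.2 ⟨v, hv, mem_biUnion.2 ⟨C, mem_filter.2 ⟨hC, hC'⟩, hU⟩⟩
  have hiso : ∀ C : Finset (Finset (Fin n)),
      ((isolating K C).card : ℝ) ≤ wt K C * (upp n).card := fun C => by
    rw [wt, div_mul_eq_mul_div, le_div_iff₀ (by positivity)]
    exact_mod_cast card_isolating_mul_le C
  have hcard : (clogged n K).card ≤ ∑ v ∈ lay n K,
      ∑ C ∈ (linkedAt K v).filter (fun C => K + 1 ≤ C.card ∧ Gapped K C),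
        (isolating K C).card :=
    (card_le_card hsub).trans (card_biUnion_le.trans (sum_le_sum fun v _ => card_biUnion_le))
  calc ((clogged n K).card : ℝ) ≤ ∑ v ∈ lay n K,
        ∑ C ∈ (linkedAt K v).filter (fun C => K + 1 ≤ C.card ∧ Gapped K C),
          ((isolating K C).card : ℝ) := by exact_mod_cast hcard
    _ ≤ ∑ v ∈ lay n K, (1 / 2 : ℝ) ^ (3 * n) * (upp n).card := by
        refine sum_le_sum fun v _ => ?_
        refine (sum_le_sum fun C _ => hiso C).trans ?_
        rw [← sum_mul]
        gcongr
        exact sum_wt_gapped_le_two_pow hL hL1 hLn hKn h2K v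
    _ = (lay n K).card * (1 / 2 : ℝ) ^ (3 * n) * (upp n).card := by
        rw [sum_const, nsmul_eq_mul, mul_assoc]
    _ ≤ 2 ^ n * (1 / 2 : ℝ) ^ (n + n) * (upp n).card := by
        gcongr ?_ * ?_ * _
        · exact_mod_cast card_le_two_pow (lay n K)
        · exact pow_le_pow_of_le_one (by norm_num) (by norm_num) (by omega)
    _ = _ := by
        rw [pow_add, ← mul_assoc, ← mul_pow]
        norm_num

open Finset.Colex in
/-- Initial segments of the colexicographic order contain initial segments of every smaller
size. -/
lemma exists_isInitSeg_card_eq {r c : ℕ} {𝒞 : Finset (Finset (Fin n))} (h𝒞 : IsInitSeg 𝒞 r)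
    (hc : c ≤ 𝒞.card) : ∃ 𝒟 ⊆ 𝒞, IsInitSeg 𝒟 r ∧ 𝒟.card = c := by
  induction 𝒞 using Finset.strongInduction with
  | H 𝒞 ih =>
    rcases hc.eq_or_lt with h | h
    · exact ⟨𝒞, Subset.rfl, h𝒞, h.symm⟩
    · obtain ⟨M, hM, hmax⟩ := exists_max_image 𝒞 (fun x => toColex x)
        (card_pos.1 (show 0 < 𝒞.card by omega))
      have hseg : IsInitSeg (𝒞.erase M) r := by
        refine ⟨fun x hx => h𝒞.1 (mem_of_mem_erase (mem_coe.1 hx)), fun s t hs ht => ?_⟩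
        refine mem_erase.2 ⟨fun e => ?_, h𝒞.2 (mem_of_mem_erase hs) ht⟩
        subst e
        exact absurd (hmax s (mem_of_mem_erase hs)) (not_le.2 ht.1)
      obtain ⟨𝒟, h1, h2⟩ := ih _ (erase_ssubset hM) hseg (by rw [card_erase_of_mem hM]; omega)
      exact ⟨𝒟, h1.trans (erase_subset _ _), h2⟩

lemma last_notMem_iff {m : ℕ} {s : Finset (Fin (m + 1))} :
    Fin.last m ∉ s ↔ ∀ b ∈ s, b < Fin.last m := by
  constructor
  · intro h b hb
    exact (Fin.le_last b).lt_of_ne fun e => h (e ▸ hb)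
  · intro h h'
    exact lt_irrefl _ (h _ h')

lemma isInitSeg_avoiding_last (m r : ℕ) :
    Finset.Colex.IsInitSeg (powersetCard r (univ.erase (Fin.last m))) r := by
  have hmem : ∀ s : Finset (Fin (m + 1)), s ∈ powersetCard r (univ.erase (Fin.last m)) ↔
      Fin.last m ∉ s ∧ s.card = r := fun s => by
    rw [mem_powersetCard, subset_erase]
    simp
  refine ⟨fun s hs => ((hmem s).1 (mem_coe.1 hs)).2, fun s t hs ht => (hmem t).2 ⟨?_, ht.2⟩⟩
  exact last_notMem_iff.2 (Finset.Colex.forall_lt_mono ht.1.le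
    (last_notMem_iff.1 ((hmem s).1 hs).1))

/-- Families of moderate size just above the middle of an odd cube have expanding shadows. -/
lemma card_mul_le_card_sh_mul {m : ℕ} {A : Finset (Finset (Fin (2 * m + 1)))}
    (hA : A ⊆ lay (2 * m + 1) (m + 1)) (hc : A.card ≤ (2 * m).choose (m + 1)) :
    A.card * (m + 1) ≤ (sh A).card * m := by
  obtain ⟨𝒟, h𝒟, hseg, hcard⟩ := exists_isInitSeg_card_eq
    (isInitSeg_avoiding_last (2 * m) (m + 1)) (c := A.card) (by
      rw [card_powersetCard, card_erase_of_mem (mem_univ _)]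
      simpa using hc)
  have hKK : (sh 𝒟).card ≤ (sh A).card := by
    rw [sh_eq_shadow, sh_eq_shadow]
    exact kruskal_katona (fun x hx => mem_lay.1 (hA (mem_coe.1 hx))) hcard.le hseg
  rw [← hcard]
  refine le_trans ?_ (Nat.mul_le_mul_right m hKK)
  have hlast : ∀ x ∈ 𝒟, Fin.last (2 * m) ∉ x ∧ x.card = m + 1 := fun x hx => by
    obtain ⟨h1, h2⟩ := mem_powersetCard.1 (h𝒟 hx)
    exact ⟨fun h => (mem_erase.1 (h1 h)).1 rfl, h2⟩
  refine card_mul_le_card_mul (fun x y => y ∈ dn x) (fun x hx => ?_) fun y hy => ?_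
  · rw [← (hlast x hx).2, ← card_dn]
    exact card_le_card fun y hy => mem_filter.2 ⟨dn_subset_sh hx hy, hy⟩
  · obtain ⟨x, hx, hyx⟩ := mem_sh.1 hy
    have hy1 := card_of_mem_dn hyx
    have hy2 : Fin.last (2 * m) ∉ y := fun h => (hlast x hx).1 (subset_of_mem_dn hyx h)
    have hx2 := (hlast x hx).2
    calc _ ≤ ((up y).erase (insert (Fin.last (2 * m)) y)).card := by
          refine card_le_card fun z hz => ?_
          obtain ⟨hz1, hz2⟩ := mem_filter.1 hz
          refine mem_erase.2 ⟨fun e => (hlast z hz1).1 ?_, mem_up_iff.2 hz2⟩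
          rw [e]
          exact mem_insert_self _ _
      _ = m := by
          rw [card_erase_of_mem (mem_up.2 ⟨_, hy2, rfl⟩), card_up]
          omega

lemma gapped_of_card_cl_le {m : ℕ} {Z C : Finset (Finset (Fin (2 * m + 1)))}
    (hZ : Z ⊆ lay (2 * m + 1) (m + 1))
    (hc : (cl (m + 1) Z).card ≤ (2 * m).choose (m + 1)) (hC : C ⊆ Z) : Gapped (m + 1) C := by
  have h := card_mul_le_card_sh_mul (cl_subset_lay (A := C))
    ((card_le_card (cl_mono hC)).trans hc)
  rw [sh_cl (hC.trans hZ)] at h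
  exact gapped_of_mul_le (by omega) (by omega) h

/-- The dual of a family of sets. -/
def dual (𝓤 : Finset (Finset (Fin n))) : Finset (Finset (Fin n)) := univ.filter fun x => xᶜ ∉ 𝓤

lemma mem_dual {𝓤 : Finset (Finset (Fin n))} {x : Finset (Fin n)} : x ∈ dual 𝓤 ↔ xᶜ ∉ 𝓤 := by
  simp [dual]

lemma dual_dual (𝓤 : Finset (Finset (Fin n))) : dual (dual 𝓤) = 𝓤 := by
  ext x; simp [mem_dual]

lemma dual_mem_upp {𝓤 : Finset (Finset (Fin n))} (h : 𝓤 ∈ upp n) : dual 𝓤 ∈ upp n :=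
  mem_upp.2 fun _ _ hxy hx => mem_dual.2 fun hy =>
    mem_dual.1 hx (mem_of_subset h (compl_subset_compl.2 hxy) hy)

lemma card_preimage_dual_le (X Y : Finset (Finset (Finset (Fin n)))) :
    (Y.filter fun 𝓤 => dual 𝓤 ∈ X).card ≤ X.card :=
  card_le_card_of_injOn dual (fun _ h => (mem_filter.1 h).2) fun 𝓤 _ 𝓥 _ h => by
    rw [← dual_dual 𝓤, h, dual_dual]

/-- In an odd cube the zeros of an upper set or those of its dual have a gap. -/
lemma gapped_or_gapped_dual {m : ℕ} (hm : 1 ≤ m) {𝓤 : Finset (Finset (Fin (2 * m + 1)))}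
    (h𝓤 : 𝓤 ∈ upp (2 * m + 1)) :
    (∀ C ⊆ zer (m + 1) 𝓤, Gapped (m + 1) C) ∨ ∀ C ⊆ zer (m + 1) (dual 𝓤), Gapped (m + 1) C := by
  set Z := zer (m + 1) 𝓤 with hZdef
  have hZ : Z ⊆ lay (2 * m + 1) (m + 1) := sdiff_subset
  rcases le_or_gt (cl (m + 1) Z).card ((2 * m).choose (m + 1)) with h | h
  · exact Or.inl fun C hC => gapped_of_card_cl_le hZ h hC
  · refine Or.inr fun C hC => gapped_of_card_cl_le
      (Z := zer (m + 1) (dual 𝓤)) sdiff_subset ?_ hC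
    have hsh : (2 * m).choose m ≤ (sh Z).card := by
      rw [← sh_cl hZ, sh_eq_shadow]
      exact kruskal_katona_lovasz_form (i := 1) (r := m + 1) (by omega) (by omega) (by omega)
        (fun x hx => mem_lay.1 (cl_subset_lay (mem_coe.1 hx))) h.le
    set D := (cl (m + 1) (zer (m + 1) (dual 𝓤))).image compl with hD
    have hDcard : D.card = (cl (m + 1) (zer (m + 1) (dual 𝓤))).card :=
      card_image_of_injective _ compl_injective
    have hDlay : D ⊆ lay (2 * m + 1) m := fun x hx => by
      obtain ⟨y, hy, rfl⟩ := mem_image.1 hx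
      have := (mem_cl.1 hy).1
      rw [mem_lay, card_compl, Fintype.card_fin]
      omega
    have hdisj : Disjoint D (sh Z) := disjoint_left.2 fun x hx hx' => by
      obtain ⟨y, hy, rfl⟩ := mem_image.1 hx
      obtain ⟨z, hz, hyz⟩ := mem_sh.1 hx'
      obtain ⟨i, hi, hiz⟩ := mem_dn.1 hyz
      refine (mem_zer.1 hz).2 ?_
      have hiy : i ∈ y := by
        by_contra hiy
        have := mem_compl.2 hiy
        rw [← hiz] at this
        exact (mem_erase.1 this).1 rfl
      have hzy : z = (y.erase i)ᶜ := by
        rw [compl_erase, ← hiz, insert_erase hi]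
      obtain ⟨w, hw, hyw⟩ := mem_sh.1 ((mem_cl.1 hy).2 (mem_dn.2 ⟨i, hiy, rfl⟩))
      have hw' : wᶜ ∈ 𝓤 := by
        have := (mem_zer.1 hw).2
        rwa [mem_dual, not_not] at this
      rw [hzy]
      exact mem_of_subset h𝓤 (compl_subset_compl.2 (subset_of_mem_dn hyw)) hw'
    have htot : D.card + (sh Z).card ≤ (2 * m + 1).choose m := by
      rw [← card_union_of_disjoint hdisj]
      refine (card_le_card (union_subset hDlay (sh_subset_lay hZ))).trans (le_of_eq ?_)
      rw [lay, card_powersetCard, card_univ, Fintype.card_fin]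
    obtain ⟨k, rfl⟩ := Nat.exists_eq_add_of_le' hm
    have hpascal := Nat.choose_succ_succ' (2 * (k + 1)) k
    have hsymm : (2 * (k + 1)).choose (k + 1 + 1) = (2 * (k + 1)).choose k :=
      Nat.choose_symm_of_eq_add (by omega)
    omega

/-- Every set of layer `K + 1` has a lower neighbour in `𝓤`. -/
def Free (K : ℕ) (𝓤 : Finset (Finset (Fin n))) : Prop := ¬ ∃ x ∈ lay n (K + 1), dn x ⊆ zer K 𝓤

lemma Free.exists_ssubset {K : ℕ} {𝓤 : Finset (Finset (Fin n))} (h : Free K 𝓤)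
    {x : Finset (Fin n)} (hx : K + 1 ≤ x.card) : ∃ z ∈ 𝓤, z ⊂ x := by
  obtain ⟨y, hyx, hy⟩ := exists_subset_card_eq hx
  have : ¬ dn y ⊆ zer K 𝓤 := fun h' => h ⟨y, mem_lay.2 hy, h'⟩
  obtain ⟨z, hz, hz'⟩ := not_subset.1 this
  have hc := card_of_mem_dn hz
  refine ⟨z, ?_, ?_⟩
  · by_contra hzU
    exact hz' (mem_zer.2 ⟨by omega, hzU⟩)
  · refine ((subset_of_mem_dn hz).trans hyx).ssubset_of_ne fun e => ?_
    rw [e] at hc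
    omega

/-- The conditions defining Korshunov's class, for upper sets. -/
def Central (K K' : ℕ) (𝓤 : Finset (Finset (Fin n))) : Prop := Free K 𝓤 ∧ Free K' (dual 𝓤)

open Classical in
lemma card_not_central_even_le {m L : ℕ} (hL : 2 * m + 1 ≤ 2 ^ L) (hL1 : 1000 ≤ L)
    (hLn : L ^ 40 ≤ 2 * m) :
    (((upp (2 * m)).filter fun 𝓤 => ¬ Central (m + 1) (m + 1) 𝓤).card : ℝ) ≤
      4 * (1 / 2 : ℝ) ^ (2 * m) * (upp (2 * m)).card := by
  have hn := large_bound hL1 hLn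
  have hm : 1 ≤ m := by nlinarith
  have hsub : ((upp (2 * m)).filter fun 𝓤 => ¬ Central (m + 1) (m + 1) 𝓤) ⊆
      clogged (2 * m) (m + 1) ∪
        (upp (2 * m)).filter fun 𝓤 => dual 𝓤 ∈ clogged (2 * m) (m + 1) := by
    intro 𝓤 h
    obtain ⟨hU, hc⟩ := mem_filter.1 h
    have hgap : ∀ 𝓥 : Finset (Finset (Fin (2 * m))), ∀ C ⊆ zer (m + 1) 𝓥, Gapped (m + 1) C :=
      fun 𝓥 C hC => gapped_of_lay (by omega) (by omega) (hC.trans sdiff_subset)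
    by_cases h1 : Free (m + 1) 𝓤
    · have h2 : ¬ Free (m + 1) (dual 𝓤) := fun h2 => hc ⟨h1, h2⟩
      exact mem_union_right _ (mem_filter.2 ⟨hU, mem_clogged.2
        ⟨dual_mem_upp hU, not_not.1 h2, hgap _⟩⟩)
    · exact mem_union_left _ (mem_clogged.2 ⟨hU, not_not.1 h1, hgap _⟩)
  have h1 := (card_le_card hsub).trans (card_union_le _ _)
  have h2 := card_preimage_dual_le (clogged (2 * m) (m + 1)) (upp (2 * m))
  have h3 := card_clogged_le hL hL1 hLn (K := m + 1) (by omega) (by omega)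
  have h4 : (((upp (2 * m)).filter fun 𝓤 => ¬ Central (m + 1) (m + 1) 𝓤).card : ℝ) ≤
      (clogged (2 * m) (m + 1)).card + (clogged (2 * m) (m + 1)).card := by
    exact_mod_cast h1.trans (Nat.add_le_add_left h2 _)
  have h5 : 0 ≤ (1 / 2 : ℝ) ^ (2 * m) * (upp (2 * m)).card := by positivity
  linarith

open Classical in
lemma card_not_central_odd_le {m L : ℕ} (hL : 2 * m + 1 + 1 ≤ 2 ^ L) (hL1 : 1000 ≤ L)
    (hLn : L ^ 40 ≤ 2 * m + 1) :
    (((upp (2 * m + 1)).filter fun 𝓤 =>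
      ¬ (Central (m + 1) (m + 2) 𝓤 ∨ Central (m + 2) (m + 1) 𝓤)).card : ℝ) ≤
      4 * (1 / 2 : ℝ) ^ (2 * m + 1) * (upp (2 * m + 1)).card := by
  have hn := large_bound hL1 hLn
  have hm : 1 ≤ m := by nlinarith
  set B₁ := clogged (2 * m + 1) (m + 1) with hB₁
  set B₂ := clogged (2 * m + 1) (m + 2) with hB₂
  have hsub : ((upp (2 * m + 1)).filter fun 𝓤 =>
      ¬ (Central (m + 1) (m + 2) 𝓤 ∨ Central (m + 2) (m + 1) 𝓤)) ⊆
      (B₁ ∪ B₂) ∪ ((upp (2 * m + 1)).filter (fun 𝓤 => dual 𝓤 ∈ B₁) ∪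
        (upp (2 * m + 1)).filter fun 𝓤 => dual 𝓤 ∈ B₂) := by
    intro 𝓤 h
    obtain ⟨hU, hc⟩ := mem_filter.1 h
    rw [not_or] at hc
    have hgap : ∀ 𝓥 : Finset (Finset (Fin (2 * m + 1))), ∀ C ⊆ zer (m + 2) 𝓥,
        Gapped (m + 2) C :=
      fun 𝓥 C hC => gapped_of_lay (by omega) (by omega) (hC.trans sdiff_subset)
    rcases gapped_or_gapped_dual hm hU with hg | hg
    · by_cases h1 : Free (m + 1) 𝓤
      · have h2 : ¬ Free (m + 2) (dual 𝓤) := fun h2 => hc.1 ⟨h1, h2⟩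
        exact mem_union_right _ (mem_union_right _ (mem_filter.2 ⟨hU, mem_clogged.2
          ⟨dual_mem_upp hU, not_not.1 h2, hgap _⟩⟩))
      · exact mem_union_left _ (mem_union_left _ (mem_clogged.2 ⟨hU, not_not.1 h1, hg⟩))
    · by_cases h1 : Free (m + 2) 𝓤
      · have h2 : ¬ Free (m + 1) (dual 𝓤) := fun h2 => hc.2 ⟨h1, h2⟩
        exact mem_union_right _ (mem_union_left _ (mem_filter.2 ⟨hU, mem_clogged.2
          ⟨dual_mem_upp hU, not_not.1 h2, hg⟩⟩))
      · exact mem_union_left _ (mem_union_right _ (mem_clogged.2 ⟨hU, not_not.1 h1, hgap _⟩))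
  have h1 := (card_le_card hsub).trans ((card_union_le _ _).trans
    (Nat.add_le_add (card_union_le _ _) (card_union_le _ _)))
  have h2 := card_preimage_dual_le B₁ (upp (2 * m + 1))
  have h2' := card_preimage_dual_le B₂ (upp (2 * m + 1))
  have h3 := card_clogged_le hL hL1 hLn (K := m + 1) (by omega) (by omega)
  have h3' := card_clogged_le hL hL1 hLn (K := m + 2) (by omega) (by omega)
  have h4 : (((upp (2 * m + 1)).filter fun 𝓤 =>
      ¬ (Central (m + 1) (m + 2) 𝓤 ∨ Central (m + 2) (m + 1) 𝓤)).card : ℝ) ≤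
      (B₁.card + B₂.card) + (B₁.card + B₂.card) := by
    exact_mod_cast h1.trans (Nat.add_le_add_left (Nat.add_le_add h2 h2') _)
  rw [← hB₁] at h3
  rw [← hB₂] at h3'
  linarith

/-- The set of coordinates where `x` is true. -/
def supp (x : Fin n → Bool) : Finset (Fin n) := univ.filter fun i => x i = true

/-- The Boolean vector supported on `s`. -/
def vec (s : Finset (Fin n)) : Fin n → Bool := fun i => decide (i ∈ s)

lemma supp_vec (s : Finset (Fin n)) : supp (vec s) = s := by
  ext i; simp [supp, vec]

lemma vec_supp (x : Fin n → Bool) : vec (supp x) = x := by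
  funext i; simp [supp, vec]

lemma vec_mono {s t : Finset (Fin n)} (h : s ⊆ t) : vec s ≤ vec t := fun i => by
  by_cases hi : i ∈ s
  · simp [vec, hi, h hi]
  · simp [vec, hi]

lemma supp_mono {x y : Fin n → Bool} (h : x ≤ y) : supp x ⊆ supp y := fun i hi => by
  have h1 : x i = true := (mem_filter.1 hi).2
  have h2 := h i
  rw [h1] at h2
  exact mem_filter.2 ⟨mem_univ _, top_le_iff.1 h2⟩

/-- The family of sets on which `f` is true. -/
def ones (f : (Fin n → Bool) → Bool) : Finset (Finset (Fin n)) :=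
  univ.filter fun s => f (vec s) = true

lemma mem_ones {f : (Fin n → Bool) → Bool} {s : Finset (Fin n)} :
    s ∈ ones f ↔ f (vec s) = true := by simp [ones]

lemma ones_mem_upp {f : (Fin n → Bool) → Bool} (hf : Monotone f) : ones f ∈ upp n :=
  mem_upp.2 fun _ _ hst hs => mem_ones.2 (top_le_iff.1 ((mem_ones.1 hs).ge.trans
    (hf (vec_mono hst))))

lemma ones_injective : Function.Injective (ones (n := n)) := fun f g h => by
  funext x
  rw [Bool.eq_iff_iff, ← vec_supp x, ← mem_ones, ← mem_ones, h]

lemma card_upp_le : (upp n).card ≤ (monotoneFuns n).card := by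
  classical
  refine card_le_card_of_injOn (fun 𝓤 x => decide (supp x ∈ 𝓤)) (fun 𝓤 h𝓤 => ?_) ?_
  · refine mem_filter.2 ⟨mem_univ _, fun x y hxy => ?_⟩
    by_cases hx : supp x ∈ 𝓤
    · simp [mem_of_subset h𝓤 (supp_mono hxy) hx]
    · simp [hx]
  · intro 𝓤 _ 𝓥 _ h
    ext s
    have := congrFun h (vec s)
    simpa [supp_vec] using this

lemma Central.spec {K K' : ℕ} {f : (Fin n → Bool) → Bool} (hf : Monotone f)
    (h : Central K K' (ones f)) :
    (∀ x, MinimalOne f x → n ≤ weight x + K' ∧ weight x ≤ K) ∧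
      ∀ x, K + 1 ≤ weight x → f x = true := by
  refine ⟨fun x hx => ⟨?_, ?_⟩, fun x hx => ?_⟩
  · by_contra hlt
    have hw : weight x = (supp x).card := rfl
    have hc : K' + 1 ≤ (supp x)ᶜ.card := by
      rw [card_compl, Fintype.card_fin]
      omega
    obtain ⟨z, hz, hzx⟩ := h.2.exists_ssubset hc
    refine mem_dual.1 (mem_of_subset (dual_mem_upp (ones_mem_upp hf)) hzx.1 hz) ?_
    rw [compl_compl, mem_ones, vec_supp]
    exact hx.1
  · by_contra hlt
    obtain ⟨z, hz, hzx⟩ := h.1.exists_ssubset (x := supp x) (not_le.1 hlt)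
    have hlt' : vec z < x := by
      refine lt_of_le_of_ne ?_ fun e => ?_
      · rw [← vec_supp x]
        exact vec_mono hzx.1
      · rw [← e, supp_vec] at hzx
        exact hzx.2 Subset.rfl
    have := hx.2 _ hlt'
    rw [mem_ones.1 hz] at this
    exact absurd this (by simp)
  · obtain ⟨z, hz, hzx⟩ := h.1.exists_ssubset (x := supp x) hx
    rw [← vec_supp x, ← mem_ones]
    exact mem_of_subset (ones_mem_upp hf) hzx.1 hz

lemma M0_subset (n : ℕ) : M0 n ⊆ monotoneFuns n := by
  classical exact filter_subset _ _

lemma mem_monotoneFuns {f : (Fin n → Bool) → Bool} : f ∈ monotoneFuns n ↔ Monotone f := by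
  simp [monotoneFuns]

lemma mem_M0 {f : (Fin n → Bool) → Bool} : f ∈ M0 n ↔ Monotone f ∧
    ((Even n ∧ evenCond n f) ∨ (Odd n ∧ (oddCondA n f ∨ oddCondB n f))) := by
  simp [M0, monotoneFuns]

/-- Almost all monotone functions belong to Korshunov's class, quantitatively. -/
lemma card_sdiff_M0_le {L : ℕ} (hL : n + 1 ≤ 2 ^ L) (hL1 : 1000 ≤ L) (hLn : L ^ 40 ≤ n) :
    ((monotoneFuns n \ M0 n).card : ℝ) ≤ 4 * (1 / 2 : ℝ) ^ n * (monotoneFuns n).card := by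
  classical
  have hupp : ((upp n).card : ℝ) ≤ (monotoneFuns n).card := by exact_mod_cast card_upp_le
  have hn := large_bound hL1 hLn
  have hn' : 4 ≤ n := by nlinarith
  suffices h : ((monotoneFuns n \ M0 n).card : ℝ) ≤ 4 * (1 / 2 : ℝ) ^ n * (upp n).card from
    h.trans (by gcongr)
  rcases Nat.even_or_odd' n with ⟨m, rfl | rfl⟩
  · refine le_trans ?_ (card_not_central_even_le hL hL1 hLn)
    refine Nat.cast_le.2 (card_le_card_of_injOn ones (fun f hf => ?_) ones_injective.injOn)
    obtain ⟨hf1, hf2⟩ := mem_sdiff.1 (mem_coe.1 hf)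
    have hmono := mem_monotoneFuns.1 hf1
    refine mem_filter.2 ⟨ones_mem_upp hmono, fun hc => hf2 (mem_M0.2 ⟨hmono, Or.inl
      ⟨even_two_mul m, ?_⟩⟩)⟩
    obtain ⟨h1, h2⟩ := hc.spec hmono
    refine ⟨fun x hx => ?_, fun x hx => h2 x (by omega)⟩
    have := h1 x hx
    omega
  · refine le_trans ?_ (card_not_central_odd_le hL hL1 hLn)
    refine Nat.cast_le.2 (card_le_card_of_injOn ones (fun f hf => ?_) ones_injective.injOn)
    obtain ⟨hf1, hf2⟩ := mem_sdiff.1 (mem_coe.1 hf)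
    have hmono := mem_monotoneFuns.1 hf1
    refine mem_filter.2 ⟨ones_mem_upp hmono, fun hc => hf2 (mem_M0.2 ⟨hmono, Or.inr
      ⟨odd_two_mul_add_one m, ?_⟩⟩)⟩
    rcases hc with hc | hc
    · obtain ⟨h1, h2⟩ := hc.spec hmono
      refine Or.inl ⟨fun x hx => ?_, fun x hx => h2 x (by omega)⟩
      have := h1 x hx
      omega
    · obtain ⟨h1, h2⟩ := hc.spec hmono
      refine Or.inr ⟨fun x hx => ?_, fun x hx => h2 x (by omega)⟩
      have := h1 x hx
      omega

lemma eventually_log_bounds : ∀ᶠ n : ℕ in Filter.atTop,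
    n + 1 ≤ 2 ^ (Nat.log 2 n + 1) ∧ 1000 ≤ Nat.log 2 n + 1 ∧ (Nat.log 2 n + 1) ^ 40 ≤ n := by
  have hlog : Filter.Tendsto (fun n : ℕ => Nat.log 2 n) Filter.atTop Filter.atTop :=
    Filter.tendsto_atTop_atTop.2 fun b => ⟨2 ^ b, fun a ha =>
      Nat.le_log_of_pow_le (by norm_num) ha⟩
  have hpoly : ∀ᶠ k : ℕ in Filter.atTop, (k + 1) ^ 40 ≤ 2 ^ k := by
    have h := (tendsto_pow_const_div_const_pow_of_one_lt 40 (r := (2 : ℝ)) (by norm_num)).comp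
      (Filter.tendsto_add_atTop_nat 1)
    filter_upwards [h.eventually (gt_mem_nhds (show (0 : ℝ) < 1 / 2 by norm_num))] with k hk
    simp only [Function.comp] at hk
    rw [div_lt_iff₀ (by positivity), pow_succ (2 : ℝ)] at hk
    have : (((k + 1) ^ 40 : ℕ) : ℝ) < ((2 ^ k : ℕ) : ℝ) := by push_cast at hk ⊢; linarith
    exact (Nat.cast_lt.1 this).le
  filter_upwards [hlog.eventually hpoly, hlog.eventually_ge_atTop 1000,
    Filter.eventually_ge_atTop 1] with n h1 h2 h3
  exact ⟨Nat.lt_pow_succ_log_self (by norm_num) n, by omega,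
    h1.trans (Nat.pow_log_le_self 2 (by omega))⟩

end Dedekind

/-- Korshunov: almost all monotone Boolean functions lie in `M_0(n)`,
i.e. `|M_0(n)| / |M(n)| → 1` as `n → ∞`. -/
theorem korshunov_M0_ratio :
    Filter.Tendsto (fun n : ℕ => ((M0 n).card : ℝ) / ((monotoneFuns n).card : ℝ))
      Filter.atTop (nhds 1) := by
  have hlow : ∀ᶠ n : ℕ in Filter.atTop, 1 - 4 * (1 / 2 : ℝ) ^ n ≤
      ((M0 n).card : ℝ) / ((monotoneFuns n).card : ℝ) := by
    filter_upwards [Dedekind.eventually_log_bounds] with n hn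
    have h1 := Dedekind.card_sdiff_M0_le hn.1 hn.2.1 hn.2.2
    have hpos : (0 : ℝ) < (monotoneFuns n).card := by
      exact_mod_cast card_pos.2 ⟨fun _ => true, Dedekind.mem_monotoneFuns.2 monotone_const⟩
    have h2 : ((monotoneFuns n \ M0 n).card : ℝ) + (M0 n).card = (monotoneFuns n).card := by
      exact_mod_cast card_sdiff_add_card_eq_card (Dedekind.M0_subset n)
    rw [le_div_iff₀ hpos]
    linarith
  have hlim : Filter.Tendsto (fun n : ℕ => 1 - 4 * (1 / 2 : ℝ) ^ n) Filter.atTop (nhds 1) := by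
    have := (tendsto_pow_atTop_nhds_zero_of_lt_one (r := (1 / 2 : ℝ)) (by norm_num)
      (by norm_num)).const_mul 4 |>.const_sub 1
    simpa using this
  refine tendsto_of_tendsto_of_tendsto_of_le_of_le' hlim tendsto_const_nhds hlow ?_
  exact Filter.Eventually.of_forall fun n => div_le_one_of_le₀
    (by exact_mod_cast card_le_card (Dedekind.M0_subset n)) (Nat.cast_nonneg _)
end

section
/- (Bshouty–Tamon bound.) For every monotone Boolean function f of n variables (n \ge 1), the average sensitivity satisfies s^f \le \sqrt{n}. -/
open Finset

/-- The `±1`-valued encoding of a Boolean: `true ↦ 1`, `false ↦ -1`. -/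
def boolSign (b : Bool) : ℝ := if b then 1 else -1

theorem boolSign_not (b : Bool) : boolSign (!b) = -boolSign b := by
  cases b <;> simp [boolSign]

theorem boolSign_mul_self (b : Bool) : boolSign b * boolSign b = 1 := by
  cases b <;> simp [boolSign]

theorem flipCoord_involutive {n : ℕ} (i : Fin n) :
    Function.Involutive fun x : Fin n → Bool => flipCoord x i := by
  intro x
  simp [flipCoord]

theorem flipCoord_self {n : ℕ} (x : Fin n → Bool) (i : Fin n) : flipCoord x i i = !x i := by
  simp [flipCoord]

theorem flipCoord_of_ne {n : ℕ} (x : Fin n → Bool) {i j : Fin n} (h : j ≠ i) :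
    flipCoord x i j = x j := by
  simp [flipCoord, h]

/-- Flipping a coordinate permutes the cube, so it preserves sums over the cube. -/
theorem sum_flipCoord {n : ℕ} (i : Fin n) (g : (Fin n → Bool) → ℝ) :
    ∑ x, g (flipCoord x i) = ∑ x, g x :=
  Equiv.sum_comp (flipCoord_involutive i).toPerm g

/-- Distinct coordinate signs are orthogonal on the cube. -/
theorem sum_boolSign_mul_boolSign {n : ℕ} (i j : Fin n) :
    ∑ x : Fin n → Bool, boolSign (x i) * boolSign (x j) = if i = j then 2 ^ n else 0 := by
  split_ifs with h
  · subst h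
    simp [boolSign_mul_self]
  · have key := sum_flipCoord i fun x => boolSign (x i) * boolSign (x j)
    simp only [flipCoord_self, flipCoord_of_ne _ (Ne.symm h), boolSign_not, neg_mul,
      sum_neg_distrib] at key
    linarith

theorem sum_sq_sum_boolSign (n : ℕ) :
    ∑ x : Fin n → Bool, (∑ i, boolSign (x i)) ^ 2 = n * 2 ^ n := by
  simp_rw [sq, sum_mul_sum]
  rw [sum_comm]
  simp_rw [sum_comm (s := (univ : Finset (Fin n → Bool))), sum_boolSign_mul_boolSign]
  simp

/-- For monotone `f`, flipping `x i` can change `f x` only in the direction of `x i`. -/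
theorem Monotone.boolSign_sub_flipCoord_mul {n : ℕ} {f : (Fin n → Bool) → Bool}
    (hf : Monotone f) (x : Fin n → Bool) (i : Fin n) :
    (boolSign (f x) - boolSign (f (flipCoord x i))) * boolSign (x i) =
      2 * if f (flipCoord x i) ≠ f x then 1 else 0 := by
  cases hx : x i
  · have h : f x ≤ f (flipCoord x i) :=
      hf (le_update_iff.2 ⟨by simp [hx], fun _ _ => le_rfl⟩)
    revert h
    cases f x <;> cases f (flipCoord x i) <;> norm_num [boolSign]
  · have h : f (flipCoord x i) ≤ f x :=
      hf (update_le_iff.2 ⟨by simp [hx], fun _ _ => le_rfl⟩)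
    revert h
    cases f x <;> cases f (flipCoord x i) <;> norm_num [boolSign]

/-- For monotone `f`, the influence of a coordinate is its degree-one Fourier coefficient. -/
theorem Monotone.sum_flipCoord_ne {n : ℕ} {f : (Fin n → Bool) → Bool}
    (hf : Monotone f) (i : Fin n) :
    ∑ x, (if f (flipCoord x i) ≠ f x then (1 : ℝ) else 0) =
      ∑ x, boolSign (f x) * boolSign (x i) := by
  have hsum := sum_congr rfl fun x (_ : x ∈ univ) => hf.boolSign_sub_flipCoord_mul x i
  have hinv : ∀ x, f (flipCoord (flipCoord x i) i) = f x := fun x =>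
    congrArg f (flipCoord_involutive i x)
  have hneg := sum_flipCoord i fun x => boolSign (f (flipCoord x i)) * boolSign (x i)
  simp only [hinv, flipCoord_self, boolSign_not, mul_neg, sum_neg_distrib] at hneg
  simp only [sub_mul, sum_sub_distrib, ← mul_sum] at hsum
  linarith

theorem Monotone.sum_sensAt {n : ℕ} {f : (Fin n → Bool) → Bool} (hf : Monotone f) :
    ∑ x, (sensAt f x : ℝ) = ∑ x, boolSign (f x) * ∑ i, boolSign (x i) := by
  simp_rw [sensAt, card_filter, Nat.cast_sum, Nat.cast_ite, Nat.cast_one, Nat.cast_zero, mul_sum]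
  rw [sum_comm, sum_comm (s := (univ : Finset (Fin n → Bool)))]
  exact sum_congr rfl fun i _ => hf.sum_flipCoord_ne i

/-- Bshouty–Tamon: the average sensitivity of a monotone Boolean function
of `n ≥ 1` variables is at most `√n`. -/
theorem avgSens_le_sqrt (n : ℕ) (hn : 1 ≤ n) (f : (Fin n → Bool) → Bool)
    (hf : Monotone f) :
    avgSens f ≤ Real.sqrt n := by
  apply Real.le_sqrt_of_sq_le
  have hcs := sum_mul_sq_le_sq_mul_sq univ (fun x => boolSign (f x))
    fun x : Fin n → Bool => ∑ i, boolSign (x i)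
  rw [← hf.sum_sensAt, sum_sq_sum_boolSign] at hcs
  simp only [sq (boolSign _), boolSign_mul_self, sum_const, card_univ, Fintype.card_fun,
    Fintype.card_bool, Fintype.card_fin, nsmul_eq_mul, Nat.cast_pow, Nat.cast_ofNat,
    mul_one] at hcs
  rw [avgSens, mul_pow, inv_pow, inv_mul_le_iff₀ (by positivity)]
  linarith
end
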